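/- Let β∈(0,1/8), K>0 and τ∈(0,1). There exists a constant N₇=N₇(K,β,τ)∈(0,1) such that the following holds. Let (u,Π) be a classical axisymmetric solution of the 3D Navier–Stokes equations on Q(1) satisfying A(R)·ω(R)^β ≤ K for all 0<R≤1/4. Then for every 0<R≤1/4 with J_R>0, the associated normalized function h satisfies inf_{Q(R/4)} h ≥ (1/2)·N₇·(ln(100/R))^{τ−1}. -/

import Mathlib

open Real MeasureTheory Set
open scoped ENNReal
noncomputable section

abbrev E3 := EuclideanSpace ℝ (Fin 3)

/-- `i`-th standard basis vector of `ℝ³`. -/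
def ee (i : Fin 3) : E3 := EuclideanSpace.single i 1

/-- partial derivative of a scalar function in the direction `eᵢ`. -/
def pd (f : E3 → ℝ) (i : Fin 3) (x : E3) : ℝ := fderiv ℝ f x (ee i)

/-- Laplacian of a scalar function. -/
def lap (f : E3 → ℝ) (x : E3) : ℝ := ∑ i, pd (fun y => pd f i y) i x

/-- parabolic cylinder `Q(z₀,R) = B(x₀,R) × (t₀ - R², t₀)`. -/
def Qyl (z₀ : E3 × ℝ) (R : ℝ) : Set (E3 × ℝ) :=
  (Metric.ball z₀.1 R) ×ˢ (Ioo (z₀.2 - R ^ 2) z₀.2)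

/-- `(u, P)` is a classical solution of the 3D Navier–Stokes equations on the open set `U`,
which contains the closure of `Q(1)`. -/
structure IsNSQ1 (u : E3 → ℝ → E3) (P : E3 → ℝ → ℝ) (U : Set (E3 × ℝ)) : Prop where
  open_U : IsOpen U
  subset_U : closure (Qyl (0, 0) 1) ⊆ U
  smooth_u : ContDiffOn ℝ (⊤ : ℕ∞) (fun z : E3 × ℝ => u z.1 z.2) U
  smooth_P : ContDiffOn ℝ (⊤ : ℕ∞) (fun z : E3 × ℝ => P z.1 z.2) U
  momentum : ∀ x : E3, ∀ t : ℝ, (x, t) ∈ U → ∀ j : Fin 3,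
    deriv (fun s => u x s j) t
      + (∑ i, u x t i * pd (fun y => u y t j) i x)
      - lap (fun y => u y t j) x
      + pd (fun y => P y t) j x = 0
  divfree : ∀ x : E3, ∀ t : ℝ, (x, t) ∈ U → ∑ i, pd (fun y => u y t i) i x = 0

/-- `(u, P)` is axially symmetric on `U`: in cylindrical coordinates
`u = uʳ eᵣ + uᶿ e_θ + u³ e₃` and `P = p(r, x₃, t)`. -/
def IsAxisym (u : E3 → ℝ → E3) (P : E3 → ℝ → ℝ) (U : Set (E3 × ℝ)) : Prop :=
  ∃ ur uθ u3 pp : ℝ → ℝ → ℝ → ℝ,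
    ∀ x : E3, ∀ t : ℝ, (x, t) ∈ U → x 0 ^ 2 + x 1 ^ 2 ≠ 0 →
      u x t 0 = ur (Real.sqrt (x 0 ^ 2 + x 1 ^ 2)) (x 2) t
                  * (x 0 / Real.sqrt (x 0 ^ 2 + x 1 ^ 2))
                - uθ (Real.sqrt (x 0 ^ 2 + x 1 ^ 2)) (x 2) t
                  * (x 1 / Real.sqrt (x 0 ^ 2 + x 1 ^ 2)) ∧
      u x t 1 = ur (Real.sqrt (x 0 ^ 2 + x 1 ^ 2)) (x 2) t
                  * (x 1 / Real.sqrt (x 0 ^ 2 + x 1 ^ 2))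
                + uθ (Real.sqrt (x 0 ^ 2 + x 1 ^ 2)) (x 2) t
                  * (x 0 / Real.sqrt (x 0 ^ 2 + x 1 ^ 2)) ∧
      u x t 2 = u3 (Real.sqrt (x 0 ^ 2 + x 1 ^ 2)) (x 2) t ∧
      P x t = pp (Real.sqrt (x 0 ^ 2 + x 1 ^ 2)) (x 2) t

/-- `Γ = r uᶿ = x₁ u₂ - x₂ u₁`. -/
def Gam (u : E3 → ℝ → E3) (x : E3) (t : ℝ) : ℝ := x 0 * u x t 1 - x 1 * u x t 0

/-- Cartesian components of `b = uʳ eᵣ + u³ e₃ = u - uᶿ e_θ`. -/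
def bcomp (u : E3 → ℝ → E3) (x : E3) (t : ℝ) : Fin 3 → ℝ :=
  ![u x t 0 + x 1 * Gam u x t / (x 0 ^ 2 + x 1 ^ 2),
    u x t 1 - x 0 * Gam u x t / (x 0 ^ 2 + x 1 ^ 2),
    u x t 2]

/-- Euclidean norm of `b`. -/
def bnorm (u : E3 → ℝ → E3) (x : E3) (t : ℝ) : ℝ :=
  Real.sqrt (∑ i, (bcomp u x t i) ^ 2)

/-- `A(z₀,R)`. -/
def AA (u : E3 → ℝ → E3) (z₀ : E3 × ℝ) (R : ℝ) : ℝ :=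
  ⨆ t ∈ Ioo (z₀.2 - R ^ 2) z₀.2, R⁻¹ * ∫ x in Metric.ball z₀.1 R, ‖u x t‖ ^ 2

/-- `E(z₀,R)`. -/
def EE (u : E3 → ℝ → E3) (z₀ : E3 × ℝ) (R : ℝ) : ℝ :=
  R⁻¹ * ∫ t in Ioo (z₀.2 - R ^ 2) z₀.2, ∫ x in Metric.ball z₀.1 R,
    ∑ j, ∑ i, (pd (fun y => u y t j) i x) ^ 2

/-- `C(z₀,R)`. -/
def CC (u : E3 → ℝ → E3) (z₀ : E3 × ℝ) (R : ℝ) : ℝ :=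
  (R ^ 2)⁻¹ * ∫ t in Ioo (z₀.2 - R ^ 2) z₀.2, ∫ x in Metric.ball z₀.1 R, ‖u x t‖ ^ 3

/-- `D(z₀,R)`. -/
def DD (P : E3 → ℝ → ℝ) (z₀ : E3 × ℝ) (R : ℝ) : ℝ :=
  (R ^ 2)⁻¹ * ∫ t in Ioo (z₀.2 - R ^ 2) z₀.2, ∫ x in Metric.ball z₀.1 R, |P x t| ^ (3/2 : ℝ)

/-- `𝓔(z₀,R) = A + E + D`. -/
def EEE (u : E3 → ℝ → E3) (P : E3 → ℝ → ℝ) (z₀ : E3 × ℝ) (R : ℝ) : ℝ :=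
  AA u z₀ R + EE u z₀ R + DD P z₀ R

/-- the weight `ω(R) = (ln ln (100/R))⁻¹`. -/
def omg (R : ℝ) : ℝ := (Real.log (Real.log (100 / R)))⁻¹

/-- `G(z₀,R) = R^{1-3/p-2/q} ‖b‖_{L^{p,q}(Q(z₀,R))}` (space norm `Lᵖ`, time norm `L^q`). -/
def Gfun (u : E3 → ℝ → E3) (p q : ℝ≥0∞) (z₀ : E3 × ℝ) (R : ℝ) : ℝ :=
  R ^ (1 - 3 / p.toReal - 2 / q.toReal) *
    (eLpNorm (fun t =>
        (eLpNorm (fun x => bnorm u x t) p (volume.restrict (Metric.ball z₀.1 R))).toReal)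
      q (volume.restrict (Ioo (z₀.2 - R ^ 2) z₀.2))).toReal

/-- `m_R = inf_{Q(R)} Γ`. -/
def mR (u : E3 → ℝ → E3) (R : ℝ) : ℝ :=
  sInf ((fun z : E3 × ℝ => Gam u z.1 z.2) '' Qyl (0, 0) R)

/-- `M_R = sup_{Q(R)} Γ`. -/
def MMR (u : E3 → ℝ → E3) (R : ℝ) : ℝ :=
  sSup ((fun z : E3 × ℝ => Gam u z.1 z.2) '' Qyl (0, 0) R)

/-- `J_R = M_R - m_R`. -/
def JR (u : E3 → ℝ → E3) (R : ℝ) : ℝ := MMR u R - mR u R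

/-- the normalized function `h`. -/
def hfun (u : E3 → ℝ → E3) (R : ℝ) (x : E3) (t : ℝ) : ℝ :=
  if -(mR u R) < MMR u R then 2 * (MMR u R - Gam u x t) / JR u R
  else 2 * (Gam u x t - mR u R) / JR u R

/-- oscillation of `Γ` over `Q(z₀,R)`. -/
def oscΓ (u : E3 → ℝ → E3) (z₀ : E3 × ℝ) (R : ℝ) : ℝ :=
  sSup ((fun z : E3 × ℝ => Gam u z.1 z.2) '' Qyl z₀ R) -
    sInf ((fun z : E3 × ℝ => Gam u z.1 z.2) '' Qyl z₀ R)

/-- Lebesgue measure restricted to the closed unit ball. -/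
def muB : Measure E3 := volume.restrict (Metric.closedBall 0 1)

instance : IsFiniteMeasure muB := by
  unfold muB
  exact isFiniteMeasure_restrict.2 (measure_closedBall_lt_top).ne

lemma Continuous.integrable_muB {f : E3 → ℝ} (hf : Continuous f) : Integrable f muB :=
  hf.continuousOn.integrableOn_compact (isCompact_closedBall 0 1)

lemma integral_muB_mono {f g : E3 → ℝ} (hf : Continuous f) (hg : Continuous g)
    (h : ∀ x, ‖x‖ ≤ 1 → f x ≤ g x) : ∫ x, f x ∂muB ≤ ∫ x, g x ∂muB := by
  refine setIntegral_mono_on hf.integrable_muB hg.integrable_muB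
    Metric.isClosed_closedBall.measurableSet ?_
  intro x hx
  exact h x (by simpa using hx)

lemma integral_muB_nonneg {f : E3 → ℝ} (h : ∀ x, ‖x‖ ≤ 1 → 0 ≤ f x) : 0 ≤ ∫ x, f x ∂muB := by
  refine setIntegral_nonneg Metric.isClosed_closedBall.measurableSet ?_
  intro x hx
  exact h x (by simpa using hx)

lemma integral_muB_congr {f g : E3 → ℝ} (h : ∀ x, ‖x‖ ≤ 1 → f x = g x) :
    ∫ x, f x ∂muB = ∫ x, g x ∂muB := by
  refine setIntegral_congr_fun Metric.isClosed_closedBall.measurableSet ?_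
  intro x hx
  exact h x (by simpa using hx)

lemma integral_muB_eq {f : E3 → ℝ} (h : ∀ x, 1 < ‖x‖ → f x = 0) :
    ∫ x, f x ∂muB = ∫ x, f x := by
  refine setIntegral_eq_integral_of_forall_compl_eq_zero ?_
  intro x hx
  exact h x (by simpa using hx)

/-! ### Partial derivatives -/

lemma pd_add {f g : E3 → ℝ} {x : E3} (hf : DifferentiableAt ℝ f x) (hg : DifferentiableAt ℝ g x)
    (i : Fin 3) : pd (fun y => f y + g y) i x = pd f i x + pd g i x := by
  simp [pd, fderiv_fun_add hf hg]

lemma pd_sub {f g : E3 → ℝ} {x : E3} (hf : DifferentiableAt ℝ f x) (hg : DifferentiableAt ℝ g x)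
    (i : Fin 3) : pd (fun y => f y - g y) i x = pd f i x - pd g i x := by
  simp [pd, fderiv_fun_sub hf hg]

lemma pd_mul {f g : E3 → ℝ} {x : E3} (hf : DifferentiableAt ℝ f x) (hg : DifferentiableAt ℝ g x)
    (i : Fin 3) : pd (fun y => f y * g y) i x = pd f i x * g x + f x * pd g i x := by
  simp [pd, fderiv_fun_mul hf hg]; ring

lemma pd_const_mul {f : E3 → ℝ} {x : E3} (hf : DifferentiableAt ℝ f x) (c : ℝ)
    (i : Fin 3) : pd (fun y => c * f y) i x = c * pd f i x := by
  simp [pd, fderiv_const_mul hf]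

lemma pd_const (c : ℝ) (i : Fin 3) (x : E3) : pd (fun _ => c) i x = 0 := by
  simp [pd]

lemma pd_comp {f : E3 → ℝ} {Ψ : ℝ → ℝ} {d : ℝ} {x : E3} (hΨ : HasDerivAt Ψ d (f x))
    (hf : DifferentiableAt ℝ f x) (i : Fin 3) :
    pd (fun y => Ψ (f y)) i x = d * pd f i x := by
  have := hΨ.comp_hasFDerivAt x hf.hasFDerivAt
  have h2 : fderiv ℝ (fun y => Ψ (f y)) x = d • fderiv ℝ f x := this.fderiv
  simp [pd, h2]

lemma pd_coord (j i : Fin 3) (x : E3) : pd (fun y : E3 => y j) i x = if j = i then 1 else 0 := by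
  have : HasFDerivAt (fun y : E3 => y j) (EuclideanSpace.proj j : E3 →L[ℝ] ℝ) x :=
    (EuclideanSpace.proj j : E3 →L[ℝ] ℝ).hasFDerivAt
  unfold pd ee
  rw [this.fderiv]
  simp

lemma differentiable_coord (j : Fin 3) : Differentiable ℝ (fun y : E3 => y j) :=
  (EuclideanSpace.proj j : E3 →L[ℝ] ℝ).differentiable

lemma contDiff_coord (j : Fin 3) {n : WithTop ℕ∞} : ContDiff ℝ n (fun y : E3 => y j) :=
  (EuclideanSpace.proj j : E3 →L[ℝ] ℝ).contDiff

lemma continuous_coord (j : Fin 3) : Continuous (fun y : E3 => y j) :=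
  (EuclideanSpace.proj j : E3 →L[ℝ] ℝ).continuous

lemma norm_sq_eq_coords (x : E3) : ‖x‖ ^ 2 = x 0 ^ 2 + x 1 ^ 2 + x 2 ^ 2 := by
  rw [EuclideanSpace.norm_sq_eq]; simp [Fin.sum_univ_three]

lemma pd_congr {f g : E3 → ℝ} {x : E3} (h : f =ᶠ[nhds x] g) (i : Fin 3) : pd f i x = pd g i x := by
  simp [pd, h.fderiv_eq]

lemma contDiff_pd {f : E3 → ℝ} {n : ℕ} (hf : ContDiff ℝ (n + 1 : ℕ) f) (i : Fin 3) :
    ContDiff ℝ n (pd f i) := by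
  have : ContDiff ℝ n (fderiv ℝ f) := hf.fderiv_right (by norm_cast)
  exact this.clm_apply contDiff_const

lemma contDiff_pd_one {f : E3 → ℝ} (hf : ContDiff ℝ 2 f) (i : Fin 3) :
    ContDiff ℝ 1 (pd f i) := by
  exact_mod_cast contDiff_pd (n := 1) (by exact_mod_cast hf) i

lemma continuous_pd {f : E3 → ℝ} (hf : ContDiff ℝ 1 f) (i : Fin 3) :
    Continuous (pd f i) := by
  have := contDiff_pd (n := 0) (f := f) (by exact_mod_cast hf) i
  exact this.continuous

lemma ibp_muB {f g : E3 → ℝ} (hf : ContDiff ℝ 1 f) (hg : ContDiff ℝ 1 g)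
    (h0 : ∀ x, 1 ≤ ‖x‖ → g x = 0) (i : Fin 3) :
    ∫ x, f x * pd g i x ∂muB = - ∫ x, pd f i x * g x ∂muB := by
  have hpd : ∀ x, 1 < ‖x‖ → pd g i x = 0 := by
    intro x hx
    have : g =ᶠ[nhds x] fun _ => 0 := by
      have : {y : E3 | 1 < ‖y‖} ∈ nhds x := (isOpen_lt continuous_const continuous_norm).mem_nhds hx
      filter_upwards [this] with y hy
      exact h0 y (le_of_lt hy)
    rw [pd_congr this, pd_const]
  rw [integral_muB_eq (fun x hx => by rw [hpd x hx, mul_zero]),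
    integral_muB_eq (fun x hx => by rw [h0 x hx.le, mul_zero])]
  have hcs : HasCompactSupport g := by
    apply HasCompactSupport.of_support_subset_isCompact (isCompact_closedBall (0 : E3) 1)
    intro x hx
    by_contra hx'
    exact hx (h0 x (by simp at hx'; exact hx'.le))
  have hcs' : HasCompactSupport (pd g i) := by
    apply HasCompactSupport.of_support_subset_isCompact (isCompact_closedBall (0 : E3) 1)
    intro x hx
    by_contra hx'
    exact hx (hpd x (by simpa using hx'))
  refine integral_mul_fderiv_eq_neg_fderiv_mul_of_integrable (v := ee i) ?_ ?_ ?_ ?_ ?_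
  · exact ((continuous_pd hf i).mul hg.continuous).integrable_of_hasCompactSupport hcs.mul_left
  · exact (hf.continuous.mul (continuous_pd hg i)).integrable_of_hasCompactSupport hcs'.mul_left
  · exact (hf.continuous.mul hg.continuous).integrable_of_hasCompactSupport hcs.mul_left
  · exact fun x _ => hf.differentiable (by norm_num) x
  · exact fun x _ => hg.differentiable (by norm_num) x

/-! ### Time slices -/

lemma hasFDerivAt_slice {F : E3 × ℝ → ℝ} {x : E3} {t : ℝ} (hF : DifferentiableAt ℝ F (x, t)) :
    HasFDerivAt (fun y => F (y, t)) ((fderiv ℝ F (x, t)).comp (ContinuousLinearMap.inl ℝ E3 ℝ)) x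
        := by
  have h1 : HasFDerivAt (fun y : E3 => (y, t)) (ContinuousLinearMap.inl ℝ E3 ℝ) x :=
    hasFDerivAt_prodMk_left x t
  exact (hF.hasFDerivAt).comp x h1

lemma pd_slice {F : E3 × ℝ → ℝ} {x : E3} {t : ℝ} (hF : DifferentiableAt ℝ F (x, t)) (i : Fin 3) :
    pd (fun y => F (y, t)) i x = fderiv ℝ F (x, t) (ee i, 0) := by
  simp [pd, (hasFDerivAt_slice hF).fderiv]

lemma hasDerivAt_slice {F : E3 × ℝ → ℝ} {x : E3} {t : ℝ} (hF : DifferentiableAt ℝ F (x, t)) :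
    HasDerivAt (fun s => F (x, s)) (fderiv ℝ F (x, t) (0, 1)) t := by
  have h1 : HasDerivAt (fun s : ℝ => (x, s)) ((0 : E3), (1 : ℝ)) t :=
    (hasDerivAt_const t x).prodMk (hasDerivAt_id t)
  exact (hF.hasFDerivAt).comp_hasDerivAt t h1

lemma contDiff_slice {F : E3 × ℝ → ℝ} {n : WithTop ℕ∞} (hF : ContDiff ℝ n F) (t : ℝ) :
    ContDiff ℝ n (fun y => F (y, t)) :=
  hF.comp (contDiff_id.prodMk contDiff_const)

lemma contDiff_pd_slice {F : E3 × ℝ → ℝ} {n : ℕ} (hF : ContDiff ℝ (n + 1 : ℕ) F) (i : Fin 3) :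
    ContDiff ℝ n (fun z : E3 × ℝ => pd (fun y => F (y, z.2)) i z.1) := by
  have h1 : ContDiff ℝ n (fderiv ℝ F) := hF.fderiv_right (by norm_cast)
  have h2 : ContDiff ℝ n (fun z => fderiv ℝ F z (ee i, 0)) := h1.clm_apply contDiff_const
  convert h2 using 2 with z
  exact pd_slice (x := z.1) (t := z.2) (hF.differentiable (by simp) _) i

lemma continuous_pd_slice {F : E3 × ℝ → ℝ} (hF : ContDiff ℝ 1 F) (i : Fin 3) :
    Continuous (fun z : E3 × ℝ => pd (fun y => F (y, z.2)) i z.1) :=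
  (contDiff_pd_slice (n := 0) (by exact_mod_cast hF) i).continuous

lemma continuous_deriv_slice {F : E3 × ℝ → ℝ} (hF : ContDiff ℝ 1 F) :
    Continuous (fun z : E3 × ℝ => deriv (fun s => F (z.1, s)) z.2) := by
  have h1 : Continuous (fderiv ℝ F) := hF.continuous_fderiv (by norm_num)
  have h2 : Continuous (fun z => fderiv ℝ F z (0, 1)) := h1.clm_apply continuous_const
  convert h2 using 2 with z
  exact (hasDerivAt_slice (x := z.1) (t := z.2) (hF.differentiable (by simp) _)).deriv

/-- Continuity in time of integrals over the unit ball. -/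
lemma continuous_integral_muB {f : E3 × ℝ → ℝ} (hf : Continuous f) :
    Continuous fun t => ∫ x, f (x, t) ∂muB := by
  have : Continuous (Function.uncurry fun (t : ℝ) (x : E3) => f (x, t)) :=
    hf.comp continuous_swap
  exact continuous_parametric_integral_of_continuous this (isCompact_closedBall 0 1)

lemma hasDerivAt_integral_muB {F : E3 × ℝ → ℝ} (hF : ContDiff ℝ 1 F) (t : ℝ) :
    HasDerivAt (fun s => ∫ x, F (x, s) ∂muB) (∫ x, deriv (fun s => F (x, s)) t ∂muB) t := by
  have hc := continuous_deriv_slice hF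
  obtain ⟨C, hC⟩ := ((isCompact_closedBall (0 : E3) 1).prod
    (isCompact_Icc (a := t - 1) (b := t + 1))).exists_bound_of_continuousOn hc.continuousOn
  refine (hasDerivAt_integral_of_dominated_loc_of_deriv_le (bound := fun _ => C)
    (s := Icc (t - 1) (t + 1)) (F' := fun s x => deriv (fun s => F (x, s)) s)
    (Icc_mem_nhds (by linarith) (by linarith)) ?_ ?_ ?_ ?_ ?_ ?_).2
  · exact Filter.Eventually.of_forall fun s =>
      (hF.continuous.comp (by fun_prop)).aestronglyMeasurable
  · exact Continuous.integrable_muB (hF.continuous.comp (by fun_prop))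
  · have : Continuous (fun x : E3 => deriv (fun s => F (x, s)) t) :=
      hc.comp (f := fun x : E3 => (x, t)) (by fun_prop)
    exact this.aestronglyMeasurable
  · refine (ae_restrict_iff' Metric.isClosed_closedBall.measurableSet).2
      (Filter.Eventually.of_forall fun x hx s hs => ?_)
    exact hC (x, s) ⟨hx, hs⟩
  · exact integrable_const _
  · refine Filter.Eventually.of_forall fun x s _ => ?_
    have := hasDerivAt_slice (x := x) (t := s) (hF.differentiable (by norm_num) _)
    rwa [← this.deriv] at this

/-! ### Cutoffs -/

lemma hasDerivAt_comp_max {g g1 : ℝ → ℝ} (hg : ∀ s, 0 ≤ s → HasDerivAt g (g1 s) s)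
    (h0 : g 0 = 0) (h1 : g1 0 = 0) (s : ℝ) :
    HasDerivAt (fun s => g (max s 0)) (g1 (max s 0)) s := by
  rcases lt_trichotomy s 0 with hs | hs | hs
  · rw [max_eq_right hs.le, h1]
    refine (hasDerivAt_const s (0 : ℝ)).congr_of_eventuallyEq ?_
    filter_upwards [Iio_mem_nhds hs] with y hy
    rw [max_eq_right (le_of_lt hy), h0]
  · subst hs
    rw [max_self, h1]
    have hl : HasDerivWithinAt (fun s => g (max s 0)) 0 (Iic 0) 0 := by
      refine (hasDerivWithinAt_const (0 : ℝ) (Iic 0) (0 : ℝ)).congr ?_ (by simp [h0])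
      intro y hy
      rw [max_eq_right hy, h0]
    have hr : HasDerivWithinAt (fun s => g (max s 0)) 0 (Ici 0) 0 := by
      have := (hg 0 le_rfl).hasDerivWithinAt (s := Ici 0)
      rw [h1] at this
      refine this.congr ?_ (by simp)
      intro y hy
      rw [max_eq_left hy]
    have := hl.union hr
    rwa [Iic_union_Ici, hasDerivWithinAt_univ] at this
  · rw [max_eq_left hs.le]
    refine (hg s hs.le).congr_of_eventuallyEq ?_
    filter_upwards [Ioi_mem_nhds hs] with y hy
    rw [max_eq_left (le_of_lt hy)]

lemma hasDerivAt_max_pow (m : ℕ) (s : ℝ) :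
    HasDerivAt (fun s : ℝ => (max s 0) ^ (m + 2)) ((m + 2) * (max s 0) ^ (m + 1)) s := by
  refine hasDerivAt_comp_max (g := fun s => s ^ (m + 2)) (g1 := fun s => (m + 2) * s ^ (m + 1))
    (fun s _ => ?_) (by simp) (by simp) s
  simpa using hasDerivAt_pow (m + 2) s

lemma contDiff_max_pow (n k : ℕ) : ContDiff ℝ n (fun s : ℝ => (max s 0) ^ (n + k + 1)) := by
  induction n generalizing k with
  | zero =>
    simp only [Nat.cast_zero, contDiff_zero]
    fun_prop
  | succ n ih =>
    have hd : ∀ s : ℝ, HasDerivAt (fun s : ℝ => (max s 0) ^ (n + 1 + k + 1))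
        (((n + k : ℕ) + 2) * (max s 0) ^ (n + k + 1)) s := by
      intro s
      have := hasDerivAt_max_pow (n + k) s
      rwa [show n + k + 2 = n + 1 + k + 1 by ring] at this
    rw [Nat.cast_add, Nat.cast_one, contDiff_succ_iff_deriv]
    refine ⟨fun s => (hd s).differentiableAt, by simp, ?_⟩
    rw [show deriv _ = _ from funext fun s => (hd s).deriv]
    exact contDiff_const.mul (ih k)

/-- Powers of the positive part of `ρ² - |x|²`. -/
def wt (ρ : ℝ) (m : ℕ) (x : E3) : ℝ := (max (ρ ^ 2 - ‖x‖ ^ 2) 0) ^ m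

lemma wt_nonneg (ρ : ℝ) (m : ℕ) (x : E3) : 0 ≤ wt ρ m x := pow_nonneg (le_max_right _ _) _

lemma wt_eq_zero {ρ : ℝ} {m : ℕ} {x : E3} (hm : m ≠ 0) (hρ : 0 ≤ ρ) (hx : ρ ≤ ‖x‖) :
    wt ρ m x = 0 := by
  unfold wt
  rw [max_eq_right (by nlinarith), zero_pow hm]

lemma wt_base_le {ρ : ℝ} (h0 : 0 ≤ ρ) (h1 : ρ ≤ 1) (x : E3) : max (ρ ^ 2 - ‖x‖ ^ 2) 0 ≤ 1 := by
  refine max_le ?_ zero_le_one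
  nlinarith [norm_nonneg x]

lemma wt_le_wt {ρ : ℝ} {m n : ℕ} (h0 : 0 ≤ ρ) (h1 : ρ ≤ 1) (h : m ≤ n) (x : E3) :
    wt ρ n x ≤ wt ρ m x :=
  pow_le_pow_of_le_one (le_max_right _ _) (wt_base_le h0 h1 x) h

lemma wt_le_one {ρ : ℝ} {m : ℕ} (h0 : 0 ≤ ρ) (h1 : ρ ≤ 1) (x : E3) : wt ρ m x ≤ 1 :=
  pow_le_one₀ (le_max_right _ _) (wt_base_le h0 h1 x)

lemma wt_pow (ρ : ℝ) (m n : ℕ) (x : E3) : wt ρ m x ^ n = wt ρ (m * n) x := by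
  unfold wt; rw [pow_mul]

lemma contDiff_wt (ρ : ℝ) {n m : ℕ} (h : n + 1 ≤ m) : ContDiff ℝ n (wt ρ m) := by
  obtain ⟨k, rfl⟩ := Nat.exists_eq_add_of_le h
  have := contDiff_max_pow n k
  rw [show n + k + 1 = n + 1 + k by ring] at this
  exact this.comp (contDiff_const.sub (contDiff_norm_sq ℝ))

lemma contDiff_wt_one (ρ : ℝ) {m : ℕ} (h : 2 ≤ m) : ContDiff ℝ 1 (wt ρ m) := by
  exact_mod_cast contDiff_wt ρ (n := 1) h

lemma contDiff_wt_two (ρ : ℝ) {m : ℕ} (h : 3 ≤ m) : ContDiff ℝ 2 (wt ρ m) := by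
  exact_mod_cast contDiff_wt ρ (n := 2) h

lemma continuous_wt (ρ : ℝ) (m : ℕ) : Continuous (wt ρ m) := by
  unfold wt; fun_prop

lemma pd_wt (ρ : ℝ) (m : ℕ) (i : Fin 3) (x : E3) :
    pd (wt ρ (m + 2)) i x = -(2 * (m + 2)) * (x i * wt ρ (m + 1) x) := by
  have h1 : HasFDerivAt (fun y : E3 => ρ ^ 2 - ‖y‖ ^ 2) (-(2 • innerSL ℝ x)) x :=
    (hasStrictFDerivAt_norm_sq x).hasFDerivAt.const_sub (ρ ^ 2)
  have h2 : pd (fun y : E3 => ρ ^ 2 - ‖y‖ ^ 2) i x = - (2 * x i) := by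
    unfold pd
    rw [h1.fderiv]
    simp [ee, EuclideanSpace.inner_single_right]
  have h3 := pd_comp (f := fun y : E3 => ρ ^ 2 - ‖y‖ ^ 2)
    (hasDerivAt_max_pow m (ρ ^ 2 - ‖x‖ ^ 2)) h1.differentiableAt i
  rw [h2] at h3
  unfold wt
  rw [h3]; ring

lemma lap_wt (ρ : ℝ) (m : ℕ) (x : E3) :
    lap (wt ρ (m + 3)) x = -(6 * (m + 3)) * wt ρ (m + 2) x
      + 4 * (m + 3) * (m + 2) * ‖x‖ ^ 2 * wt ρ (m + 1) x := by
  have h1 : ∀ i : Fin 3, (fun y => pd (wt ρ (m + 3)) i y) =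
      fun y => -(2 * ((m : ℝ) + 3)) * (y i * wt ρ (m + 2) y) := by
    intro i
    funext y
    have := pd_wt ρ (m + 1) i y
    push_cast at this
    rw [show m + 3 = m + 1 + 2 by ring, this]
    ring_nf
  have hd : ∀ k : ℕ, DifferentiableAt ℝ (wt ρ (k + 2)) x := fun k =>
    (contDiff_wt_one ρ (by omega)).differentiable (by norm_num) x
  have h2 : ∀ i : Fin 3, pd (fun y => pd (wt ρ (m + 3)) i y) i x =
      -(2 * ((m : ℝ) + 3)) * (wt ρ (m + 2) x + x i * (-(2 * (m + 2)) * (x i * wt ρ (m + 1) x))) :=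
          by
    intro i
    rw [h1 i, pd_const_mul (f := fun y : E3 => y i * wt ρ (m + 2) y)
      ((differentiable_coord i x).mul (hd m)),
      pd_mul (differentiable_coord i x) (hd m), pd_coord, pd_wt]
    simp
  unfold lap
  simp only [h2, Fin.sum_univ_three, norm_sq_eq_coords]
  ring

/-! ### A convex truncation -/

/-- A convex `C²` truncation with slope at most one. -/
def lam (s : ℝ) : ℝ := (max s 0) ^ 3 / (1 + max s 0) ^ 2

/-- Derivative of `lam`. -/
def lam1 (s : ℝ) : ℝ := (max s 0) ^ 2 * (max s 0 + 3) / (1 + max s 0) ^ 3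

/-- Second derivative of `lam`. -/
def lam2 (s : ℝ) : ℝ := 6 * max s 0 / (1 + max s 0) ^ 4

lemma hasDerivAt_lam (s : ℝ) : HasDerivAt lam (lam1 s) s := by
  refine hasDerivAt_comp_max (g := fun s => s ^ 3 / (1 + s) ^ 2)
    (g1 := fun s => s ^ 2 * (s + 3) / (1 + s) ^ 3) (fun s hs => ?_) (by simp) (by simp) s
  have h := (hasDerivAt_pow 3 s).div (((hasDerivAt_id s).const_add 1).pow 2)
    (by simp only [id, Pi.pow_apply]; positivity)
  have e : (fun s : ℝ => s ^ 3 / (1 + s) ^ 2) =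
    ((fun x : ℝ => x ^ 3) / (fun x => 1 + id x) ^ 2) := by funext y; simp
  rw [e]
  refine h.congr_deriv ?_
  have : 1 + s ≠ 0 := by positivity
  simp
  field_simp
  ring

lemma hasDerivAt_lam1 (s : ℝ) : HasDerivAt lam1 (lam2 s) s := by
  refine hasDerivAt_comp_max (g := fun s => s ^ 2 * (s + 3) / (1 + s) ^ 3)
    (g1 := fun s => 6 * s / (1 + s) ^ 4) (fun s hs => ?_) (by simp) (by simp) s
  have h := ((hasDerivAt_pow 2 s).mul ((hasDerivAt_id s).add_const 3)).div
    (((hasDerivAt_id s).const_add 1).pow 3) (by simp only [id, Pi.pow_apply]; positivity)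
  have e : (fun s : ℝ => s ^ 2 * (s + 3) / (1 + s) ^ 3) =
    ((fun x : ℝ => x ^ 2) * (fun x => id x + 3)) / (fun x => 1 + id x) ^ 3 := by funext y; simp
  rw [e]
  refine h.congr_deriv ?_
  have : 1 + s ≠ 0 := by positivity
  simp
  field_simp
  ring

lemma continuous_lam2 : Continuous lam2 := by
  unfold lam2
  refine Continuous.div (by fun_prop) (by fun_prop) fun s => ?_
  have := le_max_right s 0
  positivity

lemma contDiff_lam1 : ContDiff ℝ 1 lam1 := by
  rw [show (1 : WithTop ℕ∞) = 0 + 1 by norm_num, contDiff_succ_iff_deriv]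
  refine ⟨fun s => (hasDerivAt_lam1 s).differentiableAt, by simp, ?_⟩
  rw [show deriv _ = _ from funext fun s => (hasDerivAt_lam1 s).deriv, contDiff_zero]
  exact continuous_lam2

lemma contDiff_lam : ContDiff ℝ 2 lam := by
  rw [show (2 : WithTop ℕ∞) = 1 + 1 by norm_num, contDiff_succ_iff_deriv]
  refine ⟨fun s => (hasDerivAt_lam s).differentiableAt, by simp, ?_⟩
  rw [show deriv _ = _ from funext fun s => (hasDerivAt_lam s).deriv]
  exact contDiff_lam1

lemma lam_nonneg (s : ℝ) : 0 ≤ lam s := by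
  have := le_max_right s 0
  unfold lam; positivity

lemma lam1_nonneg (s : ℝ) : 0 ≤ lam1 s := by
  have := le_max_right s 0
  unfold lam1; positivity

lemma lam2_nonneg (s : ℝ) : 0 ≤ lam2 s := by
  have := le_max_right s 0
  unfold lam2; positivity

lemma lam1_le_one (s : ℝ) : lam1 s ≤ 1 := by
  have := le_max_right s 0
  unfold lam1
  rw [div_le_one (by positivity)]
  nlinarith

lemma lam_of_nonpos {s : ℝ} (hs : s ≤ 0) : lam s = 0 := by
  simp [lam, max_eq_right hs]

lemma lam_monotone : Monotone lam :=
  monotone_of_deriv_nonneg (fun s => (hasDerivAt_lam s).differentiableAt)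
    fun s => by rw [(hasDerivAt_lam s).deriv]; exact lam1_nonneg s

lemma lam_pos {s : ℝ} (hs : 0 < s) : 0 < lam s := by
  unfold lam; rw [max_eq_left hs.le]; positivity

lemma lam_lower {L r : ℝ} (hL : 1 ≤ L) (hr : 0 < r) (hr1 : r ≤ 1) : L * r ^ 3 / 4 ≤ lam (L * r) :=
    by
  unfold lam
  have hLr : 0 ≤ L * r := by positivity
  rw [max_eq_left hLr, le_div_iff₀ (by positivity)]
  have h1 : 1 + L * r ≤ 2 * L := by nlinarith
  have h2 : (1 + L * r) ^ 2 ≤ 4 * L ^ 2 := by nlinarith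
  calc L * r ^ 3 / 4 * (1 + L * r) ^ 2 ≤ L * r ^ 3 / 4 * (4 * L ^ 2) := by gcongr
    _ = (L * r) ^ 3 := by ring

/-- Squared length of the gradient. -/
def gradSq (f : E3 → ℝ) (x : E3) : ℝ := ∑ i, (pd f i x) ^ 2

lemma gradSq_nonneg (f : E3 → ℝ) (x : E3) : 0 ≤ gradSq f x :=
  Finset.sum_nonneg fun _ _ => sq_nonneg _

lemma continuous_gradSq {f : E3 → ℝ} (hf : ContDiff ℝ 1 f) : Continuous (gradSq f) :=
  continuous_finsetSum _ fun i _ => (continuous_pd hf i).pow 2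

lemma continuous_gradSq_slice {F : E3 × ℝ → ℝ} (hF : ContDiff ℝ 1 F) :
    Continuous (fun z : E3 × ℝ => gradSq (fun y => F (y, z.2)) z.1) :=
  continuous_finsetSum _ fun i _ => (continuous_pd_slice hF i).pow 2

/-! ### Integration by parts identities -/

lemma integral_mul_lap {p ζ : E3 → ℝ} (hp : ContDiff ℝ 2 p) (hζ : ContDiff ℝ 1 ζ)
    (h0 : ∀ x, 1 ≤ ‖x‖ → ζ x = 0) :
    ∫ x, ζ x * lap p x ∂muB = - ∫ x, ∑ i, pd p i x * pd ζ i x ∂muB := by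
  have hp1 : ContDiff ℝ 1 p := hp.of_le (by norm_num)
  have key : ∀ i, ∫ x, ζ x * pd (fun y => pd p i y) i x ∂muB = - ∫ x, pd p i x * pd ζ i x ∂muB := by
    intro i
    have := ibp_muB (contDiff_pd_one hp i) hζ h0 i
    rw [this, neg_neg]
    congr 1; funext x; ring
  have hc : ∀ i, Continuous (fun x => ζ x * pd (fun y => pd p i y) i x) := fun i =>
    hζ.continuous.mul (continuous_pd (contDiff_pd_one hp i) i)
  have hc2 : ∀ i, Continuous (fun x => pd p i x * pd ζ i x) := fun i =>
    (continuous_pd hp1 i).mul (continuous_pd hζ i)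
  unfold lap
  simp only [Finset.mul_sum]
  rw [integral_finsetSum _ fun i _ => (hc i).integrable_muB,
    integral_finsetSum _ fun i _ => (hc2 i).integrable_muB, ← Finset.sum_neg_distrib]
  exact Finset.sum_congr rfl fun i _ => key i

lemma integral_mul_lap_eq {p ζ : E3 → ℝ} (hp : ContDiff ℝ 2 p) (hζ : ContDiff ℝ 2 ζ)
    (h0 : ∀ x, 1 ≤ ‖x‖ → ζ x = 0) (h1 : ∀ i x, 1 ≤ ‖x‖ → pd ζ i x = 0) :
    ∫ x, ζ x * lap p x ∂muB = ∫ x, p x * lap ζ x ∂muB := by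
  have hp1 : ContDiff ℝ 1 p := hp.of_le (by norm_num)
  have hζ1 : ContDiff ℝ 1 ζ := hζ.of_le (by norm_num)
  rw [integral_mul_lap hp hζ1 h0]
  have key : ∀ i, ∫ x, p x * pd (fun y => pd ζ i y) i x ∂muB = - ∫ x, pd p i x * pd ζ i x ∂muB :=
    fun i => ibp_muB hp1 (contDiff_pd_one hζ i) (h1 i) i
  have hc : ∀ i, Continuous (fun x => p x * pd (fun y => pd ζ i y) i x) := fun i =>
    hp.continuous.mul (continuous_pd (contDiff_pd_one hζ i) i)
  have hc2 : ∀ i, Continuous (fun x => pd p i x * pd ζ i x) := fun i =>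
    (continuous_pd hp1 i).mul (continuous_pd hζ1 i)
  unfold lap
  simp only [Finset.mul_sum]
  rw [integral_finsetSum _ fun i _ => (hc i).integrable_muB,
    integral_finsetSum _ fun i _ => (hc2 i).integrable_muB, ← Finset.sum_neg_distrib]
  exact Finset.sum_congr rfl fun i _ => (key i).symm

lemma contDiff_comp_coord {b : E3 → E3} {n : WithTop ℕ∞} (hb : ContDiff ℝ n b) (i : Fin 3) :
    ContDiff ℝ n (fun y => b y i) := (contDiff_coord i).comp hb

lemma integral_mul_drift {p ζ : E3 → ℝ} {b : E3 → E3} (hp : ContDiff ℝ 1 p) (hζ : ContDiff ℝ 1 ζ)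
    (hb : ContDiff ℝ 1 b) (h0 : ∀ x, 1 ≤ ‖x‖ → ζ x = 0)
    (hdiv : ∀ x, ‖x‖ ≤ 1 → ∑ i, pd (fun y => b y i) i x = 0) :
    ∫ x, ζ x * ∑ i, b x i * pd p i x ∂muB = - ∫ x, p x * ∑ i, b x i * pd ζ i x ∂muB := by
  have hbi := contDiff_comp_coord hb
  have key : ∀ i, ∫ x, p x * pd (fun y => ζ y * b y i) i x ∂muB
      = - ∫ x, pd p i x * (ζ x * b x i) ∂muB :=
    fun i => ibp_muB hp (hζ.mul (hbi i)) (fun x hx => by rw [h0 x hx, zero_mul]) i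
  have e1 : ∫ x, ζ x * ∑ i, b x i * pd p i x ∂muB
      = ∑ i, ∫ x, pd p i x * (ζ x * b x i) ∂muB := by
    have hgi : ∀ i, Integrable (fun x => pd p i x * (ζ x * b x i)) muB := fun i =>
      ((continuous_pd hp i).mul (hζ.continuous.mul (hbi i).continuous)).integrable_muB
    rw [← integral_finsetSum _ fun i _ => hgi i]
    congr 1; funext x; rw [Finset.mul_sum]; exact Finset.sum_congr rfl fun i _ => by ring
  have e2 : ∫ x, p x * ∑ i, b x i * pd ζ i x ∂muB
      = ∑ i, ∫ x, p x * pd (fun y => ζ y * b y i) i x ∂muB := by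
    have hgi : ∀ i, Integrable (fun x => p x * pd (fun y => ζ y * b y i) i x) muB := fun i =>
      (hp.continuous.mul (continuous_pd (hζ.mul (hbi i)) i)).integrable_muB
    rw [← integral_finsetSum _ fun i _ => hgi i]
    refine integral_muB_congr fun x hx => ?_
    have : ∀ i, pd (fun y => ζ y * b y i) i x = pd ζ i x * b x i + ζ x * pd (fun y => b y i) i x :=
      fun i => pd_mul (hζ.differentiable (by norm_num) x) ((hbi i).differentiable (by norm_num) x) i
    simp only [this, mul_add, Finset.sum_add_distrib]
    have h2 : ∑ i, p x * (ζ x * pd (fun y => b y i) i x) = 0 := by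
      rw [← Finset.mul_sum, ← Finset.mul_sum, hdiv x hx]; simp
    rw [h2, add_zero, Finset.mul_sum]
    exact Finset.sum_congr rfl fun i _ => by ring
  rw [e1, e2, ← Finset.sum_neg_distrib]
  exact Finset.sum_congr rfl fun i _ => by rw [key i, neg_neg]

/-- The singular radial drift has a good sign against radially decreasing weights, for functions
vanishing near the axis. -/
lemma integral_mul_radial {p ζ σ : E3 → ℝ} (hp : ContDiff ℝ 1 p) (hζ : ContDiff ℝ 1 ζ)
    (h0 : ∀ x, 1 ≤ ‖x‖ → ζ x = 0)
    (hax : ∀ x : E3, x 0 ^ 2 + x 1 ^ 2 = 0 → p =ᶠ[nhds x] fun _ => 0)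
    (hσ : ∀ i x, pd ζ i x = x i * σ x) :
    Continuous (fun x => (x 0 * pd p 0 x + x 1 * pd p 1 x) / (x 0 ^ 2 + x 1 ^ 2)) ∧
    ∫ x, ζ x * ((x 0 * pd p 0 x + x 1 * pd p 1 x) / (x 0 ^ 2 + x 1 ^ 2)) ∂muB
      = - ∫ x, p x * σ x ∂muB := by
  set k : Fin 3 → E3 → ℝ := fun i x => p x * (x i / (x 0 ^ 2 + x 1 ^ 2)) with hk
  have hrat : ∀ i x, (x : E3) 0 ^ 2 + x 1 ^ 2 ≠ 0 →
      ContDiffAt ℝ 1 (fun x : E3 => x i / (x 0 ^ 2 + x 1 ^ 2)) x := fun i x hx =>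
    (contDiff_coord i).contDiffAt.div
      (((contDiff_coord 0).pow 2).add ((contDiff_coord 1).pow 2)).contDiffAt hx
  have hkC : ∀ i, ContDiff ℝ 1 (k i) := by
    intro i
    rw [contDiff_iff_contDiffAt]
    intro x
    by_cases hx : x 0 ^ 2 + x 1 ^ 2 = 0
    · refine (contDiffAt_const (c := (0 : ℝ))).congr_of_eventuallyEq ?_
      filter_upwards [hax x hx] with y hy
      simp [hk, hy]
    · exact hp.contDiffAt.mul (hrat i x hx)
  have hsum : ∀ x, pd (k 0) 0 x + pd (k 1) 1 x
      = (x 0 * pd p 0 x + x 1 * pd p 1 x) / (x 0 ^ 2 + x 1 ^ 2) := by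
    intro x
    by_cases hx : x 0 ^ 2 + x 1 ^ 2 = 0
    · have : ∀ i, k i =ᶠ[nhds x] fun _ => 0 := by
        intro i
        filter_upwards [hax x hx] with y hy
        simp [hk, hy]
      rw [pd_congr (this 0), pd_congr (this 1), hx]; simp [pd_const]
    · have hd : DifferentiableAt ℝ p x := hp.differentiable (by norm_num) x
      have hr2 : DifferentiableAt ℝ (fun x : E3 => x 0 ^ 2 + x 1 ^ 2) x :=
        (((contDiff_coord 0 (n := 1)).pow 2).add ((contDiff_coord 1).pow 2)).differentiable
          (by norm_num) x
      have hpr2 : ∀ i, pd (fun x : E3 => x 0 ^ 2 + x 1 ^ 2) i x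
          = 2 * x 0 * (if (0 : Fin 3) = i then 1 else 0)
            + 2 * x 1 * (if (1 : Fin 3) = i then 1 else 0) := by
        intro i
        rw [pd_add (f := fun x : E3 => x 0 ^ 2) (g := fun x : E3 =>
            x 1 ^ 2) ((differentiable_coord 0 x).pow 2)
          ((differentiable_coord 1 x).pow 2)]
        have h := pd_comp (f := fun y : E3 =>
            y 0) (hasDerivAt_pow 2 (x 0)) (differentiable_coord 0 x) i
        have h' := pd_comp (f := fun y : E3 =>
            y 1) (hasDerivAt_pow 2 (x 1)) (differentiable_coord 1 x) i
        rw [h, h', pd_coord, pd_coord]; norm_num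
      have hq : ∀ i, pd (k i) i x = pd p i x * (x i / (x 0 ^ 2 + x 1 ^ 2))
          + p x * (1 / (x 0 ^ 2 + x 1 ^ 2)
            + x i * (-(x 0 ^ 2 + x 1 ^ 2)⁻¹ ^ 2 * pd (fun x : E3 => x 0 ^ 2 + x 1 ^ 2) i x)) := by
        intro i
        have hinv := pd_comp (f := fun x : E3 => x 0 ^ 2 + x 1 ^ 2) (hasDerivAt_inv hx) hr2 i
        have hdi : DifferentiableAt ℝ (fun x : E3 => (x 0 ^ 2 + x 1 ^ 2)⁻¹) x := hr2.inv hx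
        simp only [hk, div_eq_mul_inv]
        rw [pd_mul hd (g := fun x : E3 => x i * (x 0 ^ 2 + x 1 ^ 2)⁻¹)
          ((differentiable_coord i x).mul hdi),
          pd_mul (differentiable_coord i x) hdi, hinv, pd_coord]
        simp
      rw [hq, hq, hpr2, hpr2]
      simp
      field_simp
      ring
  refine ⟨?_, ?_⟩
  · simp only [← hsum]
    exact (continuous_pd (hkC 0) 0).add (continuous_pd (hkC 1) 1)
  · simp only [← hsum, mul_add]
    have hi : ∀ i, Integrable (fun x => ζ x * pd (k i) i x) muB := fun i =>
      (hζ.continuous.mul (continuous_pd (hkC i) i)).integrable_muB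
    have hi' : ∀ i, Integrable (fun x => k i x * pd ζ i x) muB := fun i =>
      ((hkC i).continuous.mul (continuous_pd hζ i)).integrable_muB
    have key : ∀ i, ∫ x, ζ x * pd (k i) i x ∂muB = - ∫ x, k i x * pd ζ i x ∂muB := by
      intro i
      rw [ibp_muB (hkC i) hζ h0 i, neg_neg]
      congr 1; funext x; ring
    rw [integral_add (hi 0) (hi 1), key, key, ← neg_add, ← integral_add (hi' 0) (hi' 1)]
    congr 2
    funext x
    by_cases hx : x 0 ^ 2 + x 1 ^ 2 = 0
    · have : p x = 0 := (hax x hx).self_of_nhds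
      simp [hk, this]
    · rw [hσ, hσ]
      simp only [hk]
      field_simp

/-! ### Sobolev inequality -/

lemma norm_fderiv_sq_le (f : E3 → ℝ) (x : E3) : ‖fderiv ℝ f x‖ ≤ √(gradSq f x) := by
  refine ContinuousLinearMap.opNorm_le_bound _ (sqrt_nonneg _) fun v => ?_
  have hv : v = ∑ i, v i • ee i := by
    ext j
    simp [ee, Pi.single_apply]
  have h1 : fderiv ℝ f x v = ∑ i, v i * pd f i x := by
    conv_lhs => rw [hv]
    simp [map_sum, pd]
  rw [h1, Real.norm_eq_abs, EuclideanSpace.norm_eq, mul_comm, ← Real.sqrt_mul (by positivity)]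
  refine Real.abs_le_sqrt ?_
  simp only [Real.norm_eq_abs, sq_abs, gradSq]
  exact Finset.sum_mul_sq_le_sq_mul_sq _ _ _

lemma exists_sobolev_const : ∃ C : ℝ, 0 < C ∧ ∀ f : E3 → ℝ, ContDiff ℝ 1 f →
    (∀ x, 1 ≤ ‖x‖ → f x = 0) →
    ∫ x, f x ^ 6 ∂muB ≤ C * (∫ x, gradSq f x ∂muB) ^ 3 := by
  set K : ℝ := (SNormLESNormFDerivOfEqConst ℝ (volume : Measure E3) (2 : ℝ) : ℝ) with hK
  refine ⟨K ^ 6 + 1, by positivity, fun f hf h0 => ?_⟩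
  have hcs : HasCompactSupport f := by
    apply HasCompactSupport.of_support_subset_isCompact (isCompact_closedBall (0 : E3) 1)
    intro x hx
    by_contra hx'
    exact hx (h0 x (by simp at hx'; exact hx'.le))
  have hpd : ∀ x, 1 < ‖x‖ → fderiv ℝ f x = 0 := by
    intro x hx
    have : f =ᶠ[nhds x] fun _ => 0 := by
      have : {y : E3 | 1 < ‖y‖} ∈ nhds x := (isOpen_lt continuous_const continuous_norm).mem_nhds hx
      filter_upwards [this] with y hy
      exact h0 y (le_of_lt hy)
    rw [this.fderiv_eq]; simp
  have h6 := eLpNorm_le_eLpNorm_fderiv_of_eq (volume : Measure E3) hf hcs (p := 2) (p' := 6)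
    (by norm_num) (by simp) (by simp; norm_num)
  have hm1 : MemLp f (6 : ℝ≥0∞) volume := hf.continuous.memLp_of_hasCompactSupport hcs
  have hm2 : MemLp (fderiv ℝ f) (2 : ℝ≥0∞) volume :=
    (hf.continuous_fderiv (by norm_num)).memLp_of_hasCompactSupport (hcs.fderiv (𝕜 := ℝ))
  rw [show ((6 : NNReal) : ℝ≥0∞) = 6 by norm_cast, show ((2 : NNReal) : ℝ≥0∞) = 2 by norm_cast,
    hm1.eLpNorm_eq_integral_rpow_norm (by norm_num) (by norm_num),
    hm2.eLpNorm_eq_integral_rpow_norm (by norm_num) (by norm_num)] at h6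
  have h7 := ENNReal.toReal_mono (by finiteness) h6
  rw [ENNReal.toReal_mul, ENNReal.toReal_ofReal (by positivity),
    ENNReal.toReal_ofReal (by positivity)] at h7
  simp only [ENNReal.toReal_ofNat, ENNReal.coe_toReal] at h7
  have e6 : ∫ x, ‖f x‖ ^ (6 : ℝ) = ∫ x, f x ^ 6 ∂muB := by
    rw [integral_muB_eq (fun x hx => by rw [h0 x hx.le]; norm_num)]
    congr 1; funext x
    rw [show (6 : ℝ) = ((6 : ℕ) : ℝ) by norm_num, rpow_natCast, Real.norm_eq_abs,
      Even.pow_abs (by decide)]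
  have e2 : ∫ x, ‖fderiv ℝ f x‖ ^ (2 : ℝ) ≤ ∫ x, gradSq f x ∂muB := by
    rw [← integral_muB_eq (f := fun x => ‖fderiv ℝ f x‖ ^ (2 : ℝ))
      (fun x hx => by rw [hpd x hx]; simp)]
    refine integral_muB_mono ?_ (continuous_gradSq hf) fun x _ => ?_
    · have := hf.continuous_fderiv (by norm_num)
      simp only [rpow_two]
      exact this.norm.pow 2
    · rw [rpow_two]
      calc _ ≤ √(gradSq f x) ^ 2 := by gcongr; exact norm_fderiv_sq_le f x
        _ = _ := Real.sq_sqrt (gradSq_nonneg f x)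
  rw [e6] at h7
  set X := ∫ x, f x ^ 6 ∂muB
  set Y := ∫ x, gradSq f x ∂muB
  set Y' := ∫ x, ‖fderiv ℝ f x‖ ^ (2 : ℝ)
  have hX : 0 ≤ X := integral_muB_nonneg fun x _ => by positivity
  have hY' : 0 ≤ Y' := integral_nonneg fun x => by positivity
  have hpow := pow_le_pow_left₀ (by positivity) h7 6
  have a1 : (X ^ ((6 : ℝ)⁻¹)) ^ 6 = X := by
    rw [← rpow_natCast, ← rpow_mul hX]; norm_num
  have a2 : (Y' ^ ((2 : ℝ)⁻¹)) ^ 6 = Y' ^ 3 := by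
    rw [← rpow_natCast, ← rpow_mul hY']; norm_num
  rw [mul_pow, a1, a2] at hpow
  have hK' : (((SNormLESNormFDerivOfEqConst ℝ (volume : Measure E3) ((2 : NNReal) : ℝ) : NNReal) :
      ℝ))
    = K := by rw [hK]; norm_num
  rw [hK'] at hpow
  calc X ≤ K ^ 6 * Y' ^ 3 := hpow
    _ ≤ (K ^ 6 + 1) * Y ^ 3 := by gcongr; linarith

/-! ### Weighted Poincaré inequality -/

lemma sq_sub_le_segment {f : E3 → ℝ} (hf : ContDiff ℝ 1 f) (x y : E3) :
    (f x - f y) ^ 2 ≤ ‖x - y‖ ^ 2 * ∫ s in (0 : ℝ)..1, gradSq f (y + s • (x - y)) := by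
  set φ : ℝ → ℝ := fun s => fderiv ℝ f (y + s • (x - y)) (x - y)
  have hline : ∀ s : ℝ, HasDerivAt (fun s : ℝ => y + s • (x - y)) (x - y) s := by
    intro s
    simpa using ((hasDerivAt_id s).smul_const (x - y)).const_add y
  have hd : ∀ s : ℝ, HasDerivAt (fun s : ℝ => f (y + s • (x - y))) (φ s) s := by
    intro s
    exact ((hf.differentiable (by norm_num) _).hasFDerivAt).comp_hasDerivAt s (hline s)
  have hlc : Continuous (fun s : ℝ => y + s • (x - y)) := by fun_prop
  have hφc : Continuous φ :=
    ((hf.continuous_fderiv (by norm_num)).comp hlc).clm_apply continuous_const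
  have hgc : Continuous (fun s : ℝ => gradSq f (y + s • (x - y))) :=
    (continuous_gradSq hf).comp hlc
  have hftc : ∫ s in (0 : ℝ)..1, φ s = f x - f y := by
    rw [intervalIntegral.integral_eq_sub_of_hasDerivAt (fun s _ => hd s)
      (hφc.intervalIntegrable _ _)]
    simp
  have hcs : (∫ s in (0 : ℝ)..1, φ s) ^ 2 ≤ ∫ s in (0 : ℝ)..1, φ s ^ 2 := by
    set c := ∫ s in (0 : ℝ)..1, φ s
    have h0 : 0 ≤ ∫ s in (0 : ℝ)..1, (φ s ^ 2 - 2 * c * φ s + c ^ 2) :=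
      intervalIntegral.integral_nonneg (by norm_num) fun s _ => by nlinarith [sq_nonneg (φ s - c)]
    have i1 : IntervalIntegrable (fun s => φ s ^ 2) volume 0 1 := (hφc.pow 2).intervalIntegrable _ _
    have i2 : IntervalIntegrable (fun s => 2 * c * φ s) volume 0 1 :=
      (hφc.const_mul (2 * c)).intervalIntegrable _ _
    rw [intervalIntegral.integral_add (i1.sub i2) (by simp), intervalIntegral.integral_sub i1 i2,
      intervalIntegral.integral_const_mul] at h0
    simp only [intervalIntegral.integral_const, sub_zero, one_smul] at h0
    nlinarith
  rw [← hftc]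
  refine hcs.trans ?_
  rw [← intervalIntegral.integral_const_mul]
  refine intervalIntegral.integral_mono_on (by norm_num) ((hφc.pow 2).intervalIntegrable _ _)
    ((hgc.const_mul _).intervalIntegrable _ _) fun s _ => ?_
  have h1 : |φ s| ≤ √(gradSq f (y + s • (x - y))) * ‖x - y‖ :=
    ((fderiv ℝ f (y + s • (x - y))).le_opNorm (x - y)).trans
      (mul_le_mul_of_nonneg_right (norm_fderiv_sq_le f _) (norm_nonneg _))
  calc φ s ^ 2 = |φ s| ^ 2 := (sq_abs _).symm
    _ ≤ (√(gradSq f (y + s • (x - y))) * ‖x - y‖) ^ 2 := by gcongr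
    _ = _ := by rw [mul_pow, Real.sq_sqrt (gradSq_nonneg _ _)]; ring

lemma wt_segment {m : ℕ} (x y : E3) {s : ℝ} (hs : s ∈ Icc (0 : ℝ) 1) :
    wt 1 m x * wt 1 m y ≤ wt 1 m (y + s • (x - y)) := by
  have hz : ‖y + s • (x - y)‖ ≤ max ‖x‖ ‖y‖ := by
    have : y + s • (x - y) = (1 - s) • y + s • x := by module
    rw [this]
    refine (norm_add_le _ _).trans ?_
    rw [norm_smul, norm_smul, Real.norm_of_nonneg (by linarith [hs.2] : 0 ≤ 1 - s),
      Real.norm_of_nonneg hs.1]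
    have h1 := mul_le_mul_of_nonneg_left (le_max_right ‖x‖ ‖y‖) (by linarith [hs.2] : 0 ≤ 1 - s)
    have h2 := mul_le_mul_of_nonneg_left (le_max_left ‖x‖ ‖y‖) hs.1
    linarith
  have mono : ∀ a : E3, ‖y + s • (x - y)‖ ≤ ‖a‖ → wt 1 m a ≤ wt 1 m (y + s • (x - y)) := by
    intro a ha
    unfold wt
    gcongr
  have h1 : ∀ a : E3, wt 1 m a ≤ 1 := fun a => wt_le_one zero_le_one le_rfl a
  have h0 : ∀ a : E3, 0 ≤ wt 1 m a := fun a => wt_nonneg _ _ _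
  rcases le_max_iff.1 hz with h | h
  · exact (mul_le_of_le_one_right (h0 x) (h1 y)).trans (mono x h)
  · exact (mul_le_of_le_one_left (h0 y) (h1 x)).trans (mono y h)

lemma integral_comp_segment_le {G : E3 → ℝ} (hG : Continuous G) (hG0 : ∀ x, 0 ≤ G x)
    (hG1 : ∀ x, 1 ≤ ‖x‖ → G x = 0) (c : E3) {s : ℝ} (hs : 1 / 2 ≤ s) :
    ∫ x, G (c + s • x) ∂muB ≤ 8 * ∫ x, G x ∂muB := by
  have hcs : HasCompactSupport G := by
    apply HasCompactSupport.of_support_subset_isCompact (isCompact_closedBall (0 : E3) 1)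
    intro x hx
    by_contra hx'
    exact hx (hG1 x (by simp at hx'; exact hx'.le))
  have hgi : Integrable G volume := hG.integrable_of_hasCompactSupport hcs
  have hs0 : s ≠ 0 := by linarith
  have hint2 : Integrable (fun x => G (c + s • x)) volume := by
    have := (hgi.comp_add_left c).comp_smul hs0
    exact this
  have e : ∫ x, G x ∂muB = ∫ x, G x := integral_muB_eq fun x hx => hG1 x hx.le
  calc ∫ x, G (c + s • x) ∂muB ≤ ∫ x, G (c + s • x) :=
        integral_mono_measure Measure.restrict_le_self (Filter.Eventually.of_forall fun x => hG0 _)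
          hint2
    _ = |(s ^ 3)⁻¹| * ∫ x, G x := by
        rw [Measure.integral_comp_smul (μ := (volume : Measure E3)) (fun x => G (c + x)) s,
            integral_add_left_eq_self]
        simp
    _ ≤ 8 * ∫ x, G x := by
        gcongr
        · exact integral_nonneg hG0
        · rw [abs_of_nonneg (by positivity)]
          rw [inv_le_comm₀ (by positivity) (by norm_num)]
          calc (8 : ℝ)⁻¹ = (1 / 2) ^ 3 := by norm_num
            _ ≤ s ^ 3 := by gcongr
    _ = _ := by rw [e]

lemma exists_poincare_const : ∃ C : ℝ, 0 < C ∧ ∀ (m : ℕ) (f : E3 → ℝ), m ≠ 0 → ContDiff ℝ 1 f →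
    ∫ y, ∫ x, wt 1 m x * wt 1 m y * (f x - f y) ^ 2 ∂muB ∂muB
      ≤ C * ∫ x, wt 1 m x * gradSq f x ∂muB := by
  set B : ℝ := muB.real univ
  refine ⟨32 * B + 1, by positivity, fun m f hm hf => ?_⟩
  set G : E3 → ℝ := fun x => wt 1 m x * gradSq f x with hGdef
  have hG : Continuous G := (continuous_wt 1 m).mul (continuous_gradSq hf)
  have hG0 : ∀ x, 0 ≤ G x := fun x => mul_nonneg (wt_nonneg _ _ _) (gradSq_nonneg _ _)
  have hG1 : ∀ x, 1 ≤ ‖x‖ → G x = 0 := fun x hx => by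
    simp only [hGdef]; rw [wt_eq_zero hm zero_le_one hx, zero_mul]
  have hcs : HasCompactSupport G := by
    apply HasCompactSupport.of_support_subset_isCompact (isCompact_closedBall (0 : E3) 1)
    intro x hx
    by_contra hx'
    exact hx (hG1 x (by simp at hx'; exact hx'.le))
  obtain ⟨K, hK⟩ := hG.bounded_above_of_compact_support hcs
  set I := ∫ x, G x ∂muB
  have hI : 0 ≤ I := integral_muB_nonneg fun x _ => hG0 x
  set ν : Measure ℝ := volume.restrict (Ioc 0 1)
  have hzc : Continuous (fun q : (E3 × E3) × ℝ => G (q.1.1 + q.2 • (q.1.2 - q.1.1))) := by fun_prop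
  have hint3 : Integrable (fun q : (E3 × E3) × ℝ => G (q.1.1 + q.2 • (q.1.2 - q.1.1)))
      ((muB.prod muB).prod ν) :=
    Integrable.of_bound hzc.aestronglyMeasurable K (Filter.Eventually.of_forall fun q => hK _)
  have hslice : ∀ s ∈ Ioc (0 : ℝ) 1,
      ∫ p : E3 × E3, G (p.1 + s • (p.2 - p.1)) ∂(muB.prod muB) ≤ 8 * B * I := by
    intro s hs
    have hc2 : Continuous (fun p : E3 × E3 => G (p.1 + s • (p.2 - p.1))) := by fun_prop
    have hint2 : Integrable (fun p : E3 × E3 => G (p.1 + s • (p.2 - p.1))) (muB.prod muB) :=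
      Integrable.of_bound hc2.aestronglyMeasurable K (Filter.Eventually.of_forall fun q => hK _)
    have hconst : ∫ _ : E3, 8 * I ∂muB = 8 * B * I := by
      rw [integral_const, smul_eq_mul]; ring
    rw [← hconst]
    rcases le_total (1 / 2) s with h | h
    · rw [integral_prod _ hint2]
      refine integral_mono hint2.integral_prod_left (integrable_const _) fun y => ?_
      have : ∀ x : E3, y + s • (x - y) = (y - s • y) + s • x := fun x => by module
      simp only [this]
      exact integral_comp_segment_le hG hG0 hG1 _ h
    · rw [integral_prod_symm _ hint2]
      refine integral_mono hint2.integral_prod_right (integrable_const _) fun x => ?_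
      have : ∀ y : E3, y + s • (x - y) = s • x + (1 - s) • y := fun x => by module
      simp only [this]
      exact integral_comp_segment_le hG hG0 hG1 _ (by linarith)
  have hLc : Continuous (fun p : E3 × E3 => wt 1 m p.2 * wt 1 m p.1 * (f p.2 - f p.1) ^ 2) := by
    have := continuous_wt 1 m
    have := hf.continuous
    fun_prop
  have hmuBsupp : ∀ᵐ p ∂(muB.prod muB), ‖(p : E3 × E3).1‖ ≤ 1 ∧ ‖p.2‖ ≤ 1 := by
    unfold muB
    rw [Measure.prod_restrict]
    refine (ae_restrict_iff' (measurableSet_closedBall.prod measurableSet_closedBall)).2 ?_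
    refine Filter.Eventually.of_forall fun p hp => ?_
    simpa using hp
  have hLint : Integrable (fun p : E3 × E3 => wt 1 m p.2 * wt 1 m p.1 * (f p.2 - f p.1) ^ 2)
      (muB.prod muB) := by
    unfold muB
    rw [Measure.prod_restrict]
    exact hLc.continuousOn.integrableOn_compact
      ((isCompact_closedBall 0 1).prod (isCompact_closedBall 0 1))
  have hpt : ∀ p : E3 × E3, ‖p.1‖ ≤ 1 ∧ ‖p.2‖ ≤ 1 →
      wt 1 m p.2 * wt 1 m p.1 * (f p.2 - f p.1) ^ 2
        ≤ 4 * ∫ s, G (p.1 + s • (p.2 - p.1)) ∂ν := by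
    rintro ⟨y, x⟩ ⟨hy, hx⟩
    simp only at hy hx ⊢
    have hn : ‖x - y‖ ^ 2 ≤ 4 := by
      have : ‖x - y‖ ≤ 2 := (norm_sub_le _ _).trans (by linarith)
      nlinarith [norm_nonneg (x - y)]
    have h1 := sq_sub_le_segment hf x y
    have hline : Continuous (fun s : ℝ => y + s • (x - y)) := by fun_prop
    have hgc : Continuous (fun s : ℝ => gradSq f (y + s • (x - y))) :=
      (continuous_gradSq hf).comp hline
    have hGc : Continuous (fun s : ℝ => G (y + s • (x - y))) := hG.comp hline
    have hg0 : 0 ≤ ∫ s in (0 : ℝ)..1, gradSq f (y + s • (x - y)) :=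
      intervalIntegral.integral_nonneg (by norm_num) fun s _ => gradSq_nonneg _ _
    have hw : 0 ≤ wt 1 m x * wt 1 m y := mul_nonneg (wt_nonneg _ _ _) (wt_nonneg _ _ _)
    calc wt 1 m x * wt 1 m y * (f x - f y) ^ 2
        ≤ wt 1 m x * wt 1 m y * (4 * ∫ s in (0 : ℝ)..1, gradSq f (y + s • (x - y))) := by
          gcongr
          exact h1.trans (by gcongr)
      _ = 4 * ∫ s in (0 : ℝ)..1, wt 1 m x * wt 1 m y * gradSq f (y + s • (x - y)) := by
          rw [intervalIntegral.integral_const_mul]; ring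
      _ ≤ 4 * ∫ s in (0 : ℝ)..1, G (y + s • (x - y)) := by
          gcongr
          refine intervalIntegral.integral_mono_on (by norm_num)
            ((hgc.const_mul _).intervalIntegrable _ _) (hGc.intervalIntegrable _ _) fun s hs => ?_
          exact mul_le_mul_of_nonneg_right (wt_segment x y hs) (gradSq_nonneg _ _)
      _ = _ := by rw [intervalIntegral.integral_of_le (by norm_num)]
  calc ∫ y, ∫ x, wt 1 m x * wt 1 m y * (f x - f y) ^ 2 ∂muB ∂muB
      = ∫ p : E3 × E3, wt 1 m p.2 * wt 1 m p.1 * (f p.2 - f p.1) ^ 2 ∂(muB.prod muB) := by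
        rw [integral_prod _ hLint]
    _ ≤ ∫ p : E3 × E3, 4 * ∫ s, G (p.1 + s • (p.2 - p.1)) ∂ν ∂(muB.prod muB) := by
        refine integral_mono_ae hLint (hint3.integral_prod_left.const_mul 4) ?_
        filter_upwards [hmuBsupp] with p hp using hpt p hp
    _ = 4 * ∫ s, ∫ p : E3 × E3, G (p.1 + s • (p.2 - p.1)) ∂(muB.prod muB) ∂ν := by
        rw [integral_const_mul, integral_integral_swap hint3]
    _ ≤ 4 * ∫ s, 8 * B * I ∂ν := by
        gcongr 4 * ?_
        refine integral_mono_ae hint3.integral_prod_right (integrable_const _) ?_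
        filter_upwards [ae_restrict_mem measurableSet_Ioc] with s hs using hslice s hs
    _ = 32 * B * I := by
        rw [integral_const]; simp [ν]; ring
    _ ≤ (32 * B + 1) * I := by nlinarith

attribute [fun_prop] continuous_wt continuous_pd continuous_gradSq

@[fun_prop]
lemma continuous_lap {f : E3 → ℝ} (hf : ContDiff ℝ 2 f) : Continuous (lap f) :=
  continuous_finsetSum _ fun i _ => continuous_pd (contDiff_pd_one hf i) i

lemma integral_muB_add {f g : E3 → ℝ} (hf : Continuous f) (hg : Continuous g) :
    ∫ x, (f x + g x) ∂muB = ∫ x, f x ∂muB + ∫ x, g x ∂muB :=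
  integral_add hf.integrable_muB hg.integrable_muB

lemma integral_muB_sub {f g : E3 → ℝ} (hf : Continuous f) (hg : Continuous g) :
    ∫ x, (f x - g x) ∂muB = ∫ x, f x ∂muB - ∫ x, g x ∂muB :=
  integral_sub hf.integrable_muB hg.integrable_muB

/-! ### Differential inequalities -/

lemma sub_le_integral_of_deriv_le {f f' φ : ℝ → ℝ} {a b : ℝ} (hab : a ≤ b)
    (hf : ∀ t, HasDerivAt f (f' t) t) (hφ : Continuous φ) (h : ∀ t ∈ Ioo a b, f' t ≤ φ t) :
    f b - f a ≤ ∫ t in a..b, φ t :=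
  intervalIntegral.sub_le_integral_of_hasDeriv_right_of_le hab
    (fun t _ => (hf t).continuousAt.continuousWithinAt) (fun t _ => (hf t).hasDerivWithinAt)
    (hφ.continuousOn.integrableOn_compact isCompact_Icc) h

lemma integral_le_sub_of_le_deriv {f f' φ : ℝ → ℝ} {a b : ℝ} (hab : a ≤ b)
    (hf : ∀ t, HasDerivAt f (f' t) t) (hφ : Continuous φ) (h : ∀ t ∈ Ioo a b, φ t ≤ f' t) :
    ∫ t in a..b, φ t ≤ f b - f a :=
  intervalIntegral.integral_le_sub_of_hasDeriv_right_of_le hab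
    (fun t _ => (hf t).continuousAt.continuousWithinAt) (fun t _ => (hf t).hasDerivWithinAt)
    (hφ.continuousOn.integrableOn_compact isCompact_Icc) h

/-- A positive function on the unit cylinder solving the normalized swirl equation
`∂ₜH + b·∇H - ΔH + 2 r⁻¹∂ᵣH = 0`, where `H = c₀ + x₁V₂ - x₂V₁` takes the value `c₀ ≥ 1` on the axis
and the divergence-free drift `b` has energy at most `A`. -/
structure IsNormSol (A c₀ : ℝ) (H : E3 × ℝ → ℝ) (b V : E3 × ℝ → E3) : Prop where
  one_le_A : 1 ≤ A
  one_le_c : 1 ≤ c₀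
  smooth_H : ContDiff ℝ 2 H
  smooth_b : ContDiff ℝ 1 b
  smooth_V : ContDiff ℝ 1 V
  pos : ∀ z, 0 < H z
  le_three : ∀ x t, ‖x‖ ≤ 1 → t ∈ Ioo (-1 : ℝ) 0 → H (x, t) ≤ 3
  eq_swirl : ∀ x t, H (x, t) = c₀ + (x 0 * V (x, t) 1 - x 1 * V (x, t) 0)
  div : ∀ x t, ‖x‖ ≤ 1 → t ∈ Ioo (-1 : ℝ) 0 → ∑ i, pd (fun y => b (y, t) i) i x = 0
  eqn : ∀ x t, ‖x‖ ≤ 1 → t ∈ Ioo (-1 : ℝ) 0 →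
    deriv (fun s => H (x, s)) t + ∑ i, b (x, t) i * pd (fun y => H (y, t)) i x
      - lap (fun y => H (y, t)) x
      = -2 * (pd (fun y => V (y, t) 1) 0 x - pd (fun y => V (y, t) 0) 1 x)
  radial : ∀ x t, ‖x‖ ≤ 1 → t ∈ Ioo (-1 : ℝ) 0 →
    (x 0 ^ 2 + x 1 ^ 2) * (pd (fun y => V (y, t) 1) 0 x - pd (fun y => V (y, t) 0) 1 x)
      = x 0 * pd (fun y => H (y, t)) 0 x + x 1 * pd (fun y => H (y, t)) 1 x
  energy : ∀ t ∈ Ioo (-1 : ℝ) 0, ∫ x, ∑ i, b (x, t) i ^ 2 ∂muB ≤ A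

lemma contDiff_slice_vec {b : E3 × ℝ → E3} {n : WithTop ℕ∞} (hb : ContDiff ℝ n b) (t : ℝ) :
    ContDiff ℝ n (fun y => b (y, t)) :=
  hb.comp (contDiff_id.prodMk contDiff_const)

lemma continuous_slice_coord {b : E3 × ℝ → E3} (hb : Continuous b) (t : ℝ) (i : Fin 3) :
    Continuous (fun y => b (y, t) i) :=
  (continuous_coord i).comp (hb.comp (by fun_prop))

/-- Time derivative of a weighted integral. -/
lemma hasDerivAt_integral_weight {p : E3 × ℝ → ℝ} {ζ : E3 → ℝ} (hp : ContDiff ℝ 1 p)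
    (hζ : ContDiff ℝ 1 ζ) (t : ℝ) :
    HasDerivAt (fun t => ∫ x, ζ x * p (x, t) ∂muB)
      (∫ x, ζ x * deriv (fun s => p (x, s)) t ∂muB) t := by
  have := hasDerivAt_integral_muB (F := fun z => ζ z.1 * p z) ((hζ.comp contDiff_fst).mul hp) t
  refine this.congr_deriv ?_
  congr 1; funext x
  exact (((hasDerivAt_slice (hp.differentiable (by norm_num)
      (x, t))).differentiableAt.hasDerivAt).const_mul
    (ζ x)).deriv

lemma pd_wt_one_of_le {m : ℕ} (i : Fin 3) {x : E3} (hx : 1 ≤ ‖x‖) : pd (wt 1 (m + 2)) i x = 0 := by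
  rw [pd_wt, wt_eq_zero (by omega) zero_le_one hx]; simp

lemma integral_wt_pos (m : ℕ) : 0 < ∫ x, wt 1 m x ∂muB := by
  rcases Nat.eq_zero_or_pos m with rfl | hm
  · have : (fun x : E3 => wt 1 0 x) = fun _ => 1 := by funext x; simp [wt]
    rw [this, integral_const, smul_eq_mul, mul_one, muB, measureReal_restrict_apply_univ]
    exact ENNReal.toReal_pos (Metric.measure_closedBall_pos volume _ one_pos).ne'
      (isCompact_closedBall _ _).measure_lt_top.ne
  · rw [integral_muB_eq fun x hx => wt_eq_zero hm.ne' zero_le_one hx.le]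
    have hcs : HasCompactSupport (wt 1 m) := by
      apply HasCompactSupport.of_support_subset_isCompact (isCompact_closedBall (0 : E3) 1)
      intro x hx
      by_contra hx'
      exact hx (wt_eq_zero hm.ne' zero_le_one (by simp at hx'; exact hx'.le))
    refine (continuous_wt 1 m).integral_pos_of_hasCompactSupport_nonneg_nonzero hcs
      (fun x => wt_nonneg _ _ _) (x := 0) ?_
    simp [wt]

lemma drift_young {b x : E3} (hx : ‖x‖ ≤ 1) {ε : ℝ} (hε : 0 < ε) :
    |∑ i, b i * x i| ≤ 1 / (2 * ε) + ε / 2 * ∑ i, b i ^ 2 := by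
  have h1 : ∑ i, x i ^ 2 ≤ 1 := by
    have := norm_sq_eq_coords x
    simp only [Fin.sum_univ_three]
    nlinarith [norm_nonneg x]
  have h2 : ∀ i, |b i * x i| ≤ 1 / (2 * ε) * x i ^ 2 + ε / 2 * b i ^ 2 := by
    intro i
    have h3 : 1 / (2 * ε) * x i ^ 2 + ε / 2 * b i ^ 2 - |b i * x i|
        = (|x i| - ε * |b i|) ^ 2 / (2 * ε) := by
      rw [abs_mul, ← sq_abs (x i), ← sq_abs (b i)]
      field_simp; ring
    have h4 : 0 ≤ (|x i| - ε * |b i|) ^ 2 / (2 * ε) := by positivity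
    linarith
  calc |∑ i, b i * x i| ≤ ∑ i, |b i * x i| := Finset.abs_sum_le_sum_abs _ _
    _ ≤ ∑ i, (1 / (2 * ε) * x i ^ 2 + ε / 2 * b i ^ 2) := Finset.sum_le_sum fun i _ => h2 i
    _ = 1 / (2 * ε) * ∑ i, x i ^ 2 + ε / 2 * ∑ i, b i ^ 2 := by
      rw [Finset.sum_add_distrib, Finset.mul_sum, Finset.mul_sum]
    _ ≤ 1 / (2 * ε) * 1 + ε / 2 * ∑ i, b i ^ 2 := by gcongr
    _ = _ := by ring

namespace IsNormSol

variable {A c₀ : ℝ} {H : E3 × ℝ → ℝ} {b V : E3 × ℝ → E3}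

lemma continuous_sq_drift (h : IsNormSol A c₀ H b V) (t : ℝ) :
    Continuous (fun x => ∑ i, b (x, t) i ^ 2) :=
  continuous_finsetSum _ fun i _ => (continuous_slice_coord h.smooth_b.continuous t i).pow 2

lemma continuous_integral_weight (h : IsNormSol A c₀ H b V) (m : ℕ) :
    Continuous fun t => ∫ x, wt 1 m x * H (x, t) ∂muB :=
  continuous_integral_muB (f := fun z => wt 1 m z.1 * H z)
    (((continuous_wt 1 m).comp continuous_fst).mul h.smooth_H.continuous)

/-- The weighted mass can only decrease slowly, because of the source on the axis. -/
lemma mass_deriv_ge (h : IsNormSol A c₀ H b V) {t : ℝ} (ht : t ∈ Ioo (-1 : ℝ) 0) {κ : ℝ}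
    (hκ : κ = ∫ x, wt 1 4 x ∂muB) :
    15 * κ - (130 + 15 * A / κ) * ∫ x, wt 1 3 x * H (x, t) ∂muB
      ≤ ∫ x, wt 1 5 x * deriv (fun s => H (x, s)) t ∂muB := by
  have hκ0 : 0 < κ := hκ ▸ integral_wt_pos 4
  have hA : 0 < A := lt_of_lt_of_le one_pos h.one_le_A
  have hH2 := contDiff_slice h.smooth_H t
  have hH1 : ContDiff ℝ 1 (fun y => H (y, t)) := hH2.of_le (by norm_num)
  have hb1 := contDiff_slice_vec h.smooth_b t
  have hV1 := contDiff_slice_vec h.smooth_V t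
  have hVi := contDiff_comp_coord hV1
  have hζ2 : ContDiff ℝ 2 (wt 1 5) := contDiff_wt_two 1 (by norm_num)
  have hζ1 : ContDiff ℝ 1 (wt 1 5) := contDiff_wt_one 1 (by norm_num)
  have h0 : ∀ x : E3, 1 ≤ ‖x‖ → wt 1 5 x = 0 := fun x hx => wt_eq_zero (by norm_num) zero_le_one hx
  have hpd : ∀ (i : Fin 3) x, pd (wt 1 5) i x = -10 * (x i * wt 1 4 x) := by
    intro i x
    have := pd_wt 1 3 i x
    norm_num at this ⊢
    exact this
  have hlap : ∀ x, lap (wt 1 5) x = -30 * wt 1 4 x + 80 * ‖x‖ ^ 2 * wt 1 3 x := by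
    intro x
    have := lap_wt 1 2 x
    norm_num at this ⊢
    exact this
  have hHC := h.smooth_H
  have hHC1 : ContDiff ℝ 1 H := h.smooth_H.of_le (by norm_num)
  have hbC := h.smooth_b
  have hVC := h.smooth_V
  have e1 : ∫ x, wt 1 5 x * deriv (fun s => H (x, s)) t ∂muB
      = ∫ x, wt 1 5 x * lap (fun y => H (y, t)) x ∂muB
        - ∫ x, wt 1 5 x * ∑ i, b (x, t) i * pd (fun y => H (y, t)) i x ∂muB
        - 2 * (∫ x, wt 1 5 x * pd (fun y => V (y, t) 1) 0 x ∂muB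
          - ∫ x, wt 1 5 x * pd (fun y => V (y, t) 0) 1 x ∂muB) := by
    rw [← integral_muB_sub (by fun_prop) (by fun_prop),
      ← integral_muB_sub (by fun_prop) (by fun_prop), ← integral_const_mul,
      ← integral_muB_sub (by fun_prop) (by fun_prop)]
    refine integral_muB_congr fun x hx => ?_
    have := h.eqn x t hx ht
    have h2 : deriv (fun s => H (x, s)) t = lap (fun y => H (y, t)) x
      - ∑ i, b (x, t) i * pd (fun y => H (y, t)) i x
      - 2 * (pd (fun y => V (y, t) 1) 0 x - pd (fun y => V (y, t) 0) 1 x) := by linarith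
    rw [h2]; ring
  have e2 := integral_mul_lap_eq hH2 hζ2 h0 (fun i x hx => pd_wt_one_of_le (m := 3) i hx)
  have e3 := integral_mul_drift hH1 hζ1 hb1 h0 (fun x hx => h.div x t hx ht)
  have e4 : ∀ i j, ∫ x, wt 1 5 x * pd (fun y => V (y, t) i) j x ∂muB
      = 10 * ∫ x, V (x, t) i * (x j * wt 1 4 x) ∂muB := by
    intro i j
    have := ibp_muB (hVi i) hζ1 h0 j
    have h2 : ∫ x, wt 1 5 x * pd (fun y => V (y, t) i) j x ∂muB
      = ∫ x, pd (fun y => V (y, t) i) j x * wt 1 5 x ∂muB := by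
      congr 1; funext x; ring
    rw [h2, ← neg_eq_iff_eq_neg.2 this, ← integral_neg, ← integral_const_mul]
    congr 1; funext x; rw [hpd]; ring
  have e5 : ∫ x, wt 1 5 x * deriv (fun s => H (x, s)) t ∂muB
      = ∫ x, (H (x, t) * (-30 * wt 1 4 x + 80 * ‖x‖ ^ 2 * wt 1 3 x)
          - 10 * H (x, t) * wt 1 4 x * (∑ i, b (x, t) i * x i)
          - 20 * (H (x, t) - c₀) * wt 1 4 x) ∂muB := by
    rw [e1, e2, e3, e4, e4]
    have hb' : ∀ x : E3, ∑ i, b (x, t) i * pd (wt 1 5) i x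
        = -10 * wt 1 4 x * ∑ i, b (x, t) i * x i := by
      intro x; rw [Finset.mul_sum]; exact Finset.sum_congr rfl fun i _ => by rw [hpd]; ring
    simp only [hb', hlap]
    rw [sub_neg_eq_add, ← mul_sub, ← integral_muB_sub (by fun_prop) (by fun_prop),
      ← integral_const_mul, ← integral_const_mul, ← integral_muB_add (by fun_prop) (by fun_prop),
      ← integral_muB_sub (by fun_prop) (by fun_prop)]
    congr 1; funext x
    rw [h.eq_swirl x t]; ring
  set ε := κ / (3 * A) with hε
  have hε0 : 0 < ε := by positivity
  have hlow : ∫ x, (20 * wt 1 4 x - (130 + 15 * A / κ) * (wt 1 3 x * H (x, t))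
        - 15 * ε * ∑ i, b (x, t) i ^ 2) ∂muB
      ≤ ∫ x, wt 1 5 x * deriv (fun s => H (x, s)) t ∂muB := by
    rw [e5]
    refine integral_muB_mono (by fun_prop) (by fun_prop) fun x hx => ?_
    have hyo := drift_young (b := b (x, t)) hx hε0
    have hHp := h.pos (x, t)
    have hH3 := h.le_three x t hx ht
    have w4 : 0 ≤ wt 1 4 x := wt_nonneg _ _ _
    have w34 : wt 1 4 x ≤ wt 1 3 x := wt_le_wt zero_le_one le_rfl (by norm_num) x
    have w31 : wt 1 4 x ≤ 1 := wt_le_one zero_le_one le_rfl x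
    set S := ∑ i, b (x, t) i * x i
    set B := ∑ i, b (x, t) i ^ 2
    have hB : 0 ≤ B := Finset.sum_nonneg fun i _ => sq_nonneg _
    have hε2 : 1 / (2 * ε) = 3 * A / (2 * κ) := by rw [hε]; field_simp
    have hS : S ≤ 3 * A / (2 * κ) + ε / 2 * B := by rw [← hε2]; exact (le_abs_self _).trans hyo
    have hAk : 0 ≤ A / κ := by positivity
    have t1 : H (x, t) * wt 1 4 x * S ≤ H (x, t) * wt 1 3 x * (3 * A / (2 * κ)) + 3 * (ε / 2 * B)
        := by
      have q1 : H (x, t) * wt 1 4 x * S ≤ H (x, t) * wt 1 4 x * (3 * A / (2 * κ) + ε / 2 * B) := by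
        gcongr
      have q2 : H (x, t) * wt 1 4 x * (3 * A / (2 * κ)) ≤ H (x, t) * wt 1 3 x * (3 * A / (2 * κ))
          := by
        gcongr
      have q3 : H (x, t) * wt 1 4 x ≤ 3 * 1 := by gcongr
      have q4 : H (x, t) * wt 1 4 x * (ε / 2 * B) ≤ 3 * (ε / 2 * B) :=
        mul_le_mul_of_nonneg_right (by linarith) (by positivity)
      nlinarith
    have t2 : 0 ≤ H (x, t) * (80 * ‖x‖ ^ 2 * wt 1 3 x) := by
      have := wt_nonneg 1 3 x
      positivity
    have t3 : H (x, t) * wt 1 4 x ≤ H (x, t) * wt 1 3 x := by gcongr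
    have t4 : wt 1 4 x ≤ c₀ * wt 1 4 x := le_mul_of_one_le_left w4 h.one_le_c
    have t5 : 0 ≤ H (x, t) * wt 1 3 x := mul_nonneg hHp.le (wt_nonneg _ _ _)
    have t6 : 15 * A / κ * (wt 1 3 x * H (x, t)) = 10 * (H (x, t) * wt 1 3 x * (3 * A / (2 * κ)))
        := by
      field_simp; ring
    nlinarith
  refine le_trans ?_ hlow
  rw [integral_muB_sub (by fun_prop) (by fun_prop), integral_muB_sub (by fun_prop) (by fun_prop),
    integral_const_mul, integral_const_mul, integral_const_mul, ← hκ]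
  have := h.energy t ht
  have h5 : 15 * ε * ∫ x, ∑ i, b (x, t) i ^ 2 ∂muB ≤ 15 * ε * A := by gcongr
  have h6 : 15 * ε * A = 5 * κ := by rw [hε]; field_simp; ring
  linarith

end IsNormSol

lemma exists_mass_const : ∃ c : ℝ, 0 < c ∧ c ≤ 1 ∧
    ∀ (A c₀ : ℝ) (H : E3 × ℝ → ℝ) (b V : E3 × ℝ → E3), IsNormSol A c₀ H b V →
      c / A ≤ ∫ t in (-3 / 4 : ℝ)..(-1 / 4), ∫ x, wt 1 3 x * H (x, t) ∂muB := by
  set κ := ∫ x, wt 1 4 x ∂muB with hκ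
  have hκ0 : 0 < κ := integral_wt_pos 4
  have hc0 : 0 < (15 * κ / 48) / (9 + κ⁻¹) := by positivity
  refine ⟨min ((15 * κ / 48) / (9 + κ⁻¹)) 1, lt_min hc0 one_pos, min_le_right _ _, ?_⟩
  intro A c₀ H b V h
  have hA : 0 < A := lt_of_lt_of_le one_pos h.one_le_A
  set m : ℝ → ℝ := fun t => ∫ x, wt 1 3 x * H (x, t) ∂muB with hm
  set M : ℝ → ℝ := fun t => ∫ x, wt 1 5 x * H (x, t) ∂muB with hM
  have cm : Continuous m := h.continuous_integral_weight 3
  have hM' : ∀ t, HasDerivAt M (∫ x, wt 1 5 x * deriv (fun s => H (x, s)) t ∂muB) t :=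
    fun t => hasDerivAt_integral_weight (h.smooth_H.of_le (by norm_num))
      (contDiff_wt_one 1 (by norm_num)) t
  have hMm : ∀ t, 0 ≤ M t ∧ M t ≤ m t := by
    intro t
    have cH : Continuous (fun y => H (y, t)) := (contDiff_slice h.smooth_H t).continuous
    constructor
    · exact integral_muB_nonneg fun x _ => mul_nonneg (wt_nonneg _ _ _) (h.pos _).le
    · refine integral_muB_mono ((continuous_wt 1 5).mul cH) ((continuous_wt 1 3).mul cH)
        fun x _ => ?_
      exact mul_le_mul_of_nonneg_right (wt_le_wt zero_le_one le_rfl (by norm_num) x) (h.pos _).le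
  set θ : ℝ → ℝ := fun t => (t + 3 / 4) * (-1 / 4 - t) with hθ
  have hθ' : ∀ t, HasDerivAt θ (-2 * t - 1) t := by
    intro t
    have := ((hasDerivAt_id t).add_const (3 / 4)).mul ((hasDerivAt_id t).const_sub (-1 / 4))
    refine this.congr_deriv ?_
    simp; ring
  set Q := (130 + 15 * A / κ) / 16 + 1 / 2 with hQ
  have key := integral_le_sub_of_le_deriv (a := -3 / 4) (b := -1 / 4) (by norm_num)
    (fun t => (hθ' t).mul (hM' t)) (φ := fun t => 15 * κ * θ t - Q * m t)
    (by fun_prop) (fun t ht => by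
      have ht' : t ∈ Ioo (-1 : ℝ) 0 := ⟨by linarith [ht.1], by linarith [ht.2]⟩
      have h1 := h.mass_deriv_ge ht' hκ
      have hθ0 : 0 ≤ θ t := mul_nonneg (by linarith [ht.1]) (by linarith [ht.2])
      have hθ1 : θ t ≤ 1 / 16 := by simp only [hθ]; nlinarith [sq_nonneg (t + 1 / 2)]
      have h2 := mul_le_mul_of_nonneg_left h1 hθ0
      have h3 : -(m t) / 2 ≤ (-2 * t - 1) * M t := by
        have := hMm t
        nlinarith [ht.1, ht.2]
      have hAk : 0 ≤ 15 * A / κ := by positivity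
      have h4 : 0 ≤ (130 + 15 * A / κ) * m t := mul_nonneg (by linarith) ((hMm t).1.trans (hMm t).2)
      have h5 := mul_le_mul_of_nonneg_right hθ1 h4
      simp only [hQ]
      change 15 * κ * θ t - ((130 + 15 * A / κ) / 16 + 1 / 2) * m t ≤ _
      nlinarith)
  have e0 : θ (-1 / 4) * M (-1 / 4) - θ (-3 / 4) * M (-3 / 4) = 0 := by simp [hθ]; norm_num
  have eθ : ∫ t in (-3 / 4 : ℝ)..(-1 / 4), θ t = 1 / 48 := by
    have hP : ∀ t : ℝ, HasDerivAt (fun t : ℝ => -(t ^ 3) / 3 - t ^ 2 / 2 - 3 / 16 * t) (θ t) t := by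
      intro t
      have := (((hasDerivAt_pow 3 t).neg.div_const 3).sub ((hasDerivAt_pow 2 t).div_const 2)).sub
        ((hasDerivAt_id t).const_mul (3 / 16))
      refine this.congr_deriv ?_
      simp [hθ]; ring
    have cθ : Continuous θ := by fun_prop
    rw [intervalIntegral.integral_eq_sub_of_hasDerivAt (fun t _ => hP t)
      (cθ.intervalIntegrable _ _)]
    norm_num
  have cθ : Continuous θ := by fun_prop
  have key2 : 15 * κ / 48 ≤ Q * ∫ t in (-3 / 4 : ℝ)..(-1 / 4), m t := by
    have h1 : ∫ t in (-3 / 4 : ℝ)..(-1 / 4), (15 * κ * θ t - Q * m t) ≤ 0 := by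
      refine key.trans (le_of_eq ?_)
      exact e0
    rw [intervalIntegral.integral_sub ((cθ.const_mul _).intervalIntegrable _ _)
      ((cm.const_mul _).intervalIntegrable _ _), intervalIntegral.integral_const_mul,
      intervalIntegral.integral_const_mul, eθ] at h1
    linarith
  have hQA : Q ≤ (9 + κ⁻¹) * A := by
    have h1 := h.one_le_A
    have h2 : 15 * A / κ / 16 ≤ κ⁻¹ * A := by
      rw [div_div, div_le_iff₀ (by positivity)]
      field_simp; linarith
    simp only [hQ]
    nlinarith
  have hX0 : 0 ≤ ∫ t in (-3 / 4 : ℝ)..(-1 / 4), m t :=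
    intervalIntegral.integral_nonneg (by norm_num) fun t _ => (hMm t).1.trans (hMm t).2
  have hk9 : 0 < 9 + κ⁻¹ := by positivity
  rw [div_le_iff₀ hA]
  refine (min_le_left _ _).trans ?_
  rw [div_le_iff₀ hk9]
  calc 15 * κ / 48 ≤ Q * ∫ t in (-3 / 4 : ℝ)..(-1 / 4), m t := key2
    _ ≤ ((9 + κ⁻¹) * A) * ∫ t in (-3 / 4 : ℝ)..(-1 / 4), m t := by gcongr
    _ = _ := by ring

/-! ### Energy estimates for functions of the solution -/

/-- A nonnegative `C²` function on `(0, ∞)` vanishing on `[δ, ∞)`, with its two derivatives. -/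
structure IsTest (δ : ℝ) (Ψ Ψ1 Ψ2 : ℝ → ℝ) : Prop where
  deriv1 : ∀ s, 0 < s → HasDerivAt Ψ (Ψ1 s) s
  deriv2 : ∀ s, 0 < s → HasDerivAt Ψ1 (Ψ2 s) s
  cont2 : ContinuousOn Ψ2 (Ioi 0)
  nonneg : ∀ s, 0 ≤ Ψ s
  vanish : ∀ s, δ ≤ s → Ψ s = 0

lemma IsTest.contDiffOn {δ : ℝ} {Ψ Ψ1 Ψ2 : ℝ → ℝ} (h : IsTest δ Ψ Ψ1 Ψ2) :
    ContDiffOn ℝ 2 Ψ (Ioi 0) := by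
  have h1 : ContDiffOn ℝ 1 Ψ1 (Ioi 0) := by
    rw [show (1 : WithTop ℕ∞) = 0 + 1 by norm_num, contDiffOn_succ_iff_deriv_of_isOpen isOpen_Ioi]
    refine ⟨fun s hs => (h.deriv2 s hs).differentiableAt.differentiableWithinAt, by simp, ?_⟩
    rw [contDiffOn_zero]
    exact h.cont2.congr fun s hs => (h.deriv2 s hs).deriv
  rw [show (2 : WithTop ℕ∞) = 1 + 1 by norm_num, contDiffOn_succ_iff_deriv_of_isOpen isOpen_Ioi]
  refine ⟨fun s hs => (h.deriv1 s hs).differentiableAt.differentiableWithinAt, by simp, ?_⟩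
  exact h1.congr fun s hs => (h.deriv1 s hs).deriv

lemma IsTest.contDiff_comp {δ : ℝ} {Ψ Ψ1 Ψ2 : ℝ → ℝ} (h : IsTest δ Ψ Ψ1 Ψ2) {H : E3 × ℝ → ℝ}
    (hH : ContDiff ℝ 2 H) (hpos : ∀ z, 0 < H z) : ContDiff ℝ 2 (fun z => Ψ (H z)) := by
  rw [← contDiffOn_univ]
  exact h.contDiffOn.comp hH.contDiffOn fun z _ => hpos z

lemma lap_comp {f : E3 → ℝ} {Ψ Ψ1 Ψ2 : ℝ → ℝ} (hf : ContDiff ℝ 2 f)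
    (h1 : ∀ y, HasDerivAt Ψ (Ψ1 (f y)) (f y)) (h2 : ∀ y, HasDerivAt Ψ1 (Ψ2 (f y)) (f y)) (x : E3) :
    lap (fun y => Ψ (f y)) x = Ψ1 (f x) * lap f x + Ψ2 (f x) * gradSq f x := by
  have hd : Differentiable ℝ f := hf.differentiable (by norm_num)
  have e1 : ∀ i, (fun y => pd (fun y => Ψ (f y)) i y) = fun y => Ψ1 (f y) * pd f i y := fun i =>
    funext fun y => pd_comp (h1 y) (hd y) i
  unfold lap gradSq
  rw [Finset.mul_sum, Finset.mul_sum, ← Finset.sum_add_distrib]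
  refine Finset.sum_congr rfl fun i _ => ?_
  have hd1 : DifferentiableAt ℝ (fun y => Ψ1 (f y)) x := (h2 x).differentiableAt.comp x (hd x)
  rw [e1 i, pd_mul hd1 ((contDiff_pd_one hf i).differentiable (by norm_num) x),
      pd_comp (h2 x) (hd x) i]
  ring

/-- A radially decreasing weight supported in the unit ball. -/
structure IsRadial (ζ σ : E3 → ℝ) : Prop where
  smooth : ContDiff ℝ 2 ζ
  nonneg : ∀ x, 0 ≤ ζ x
  vanish : ∀ x, 1 ≤ ‖x‖ → ζ x = 0
  pd_eq : ∀ i x, pd ζ i x = x i * σ x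
  nonpos : ∀ x, σ x ≤ 0

lemma isRadial_wt {ρ : ℝ} (h0 : 0 ≤ ρ) (h1 : ρ ≤ 1) (m : ℕ) :
    IsRadial (wt ρ (m + 3)) (fun x => -(2 * (m + 3)) * wt ρ (m + 2) x) where
  smooth := contDiff_wt_two ρ (by omega)
  nonneg := wt_nonneg _ _
  vanish x hx := wt_eq_zero (by omega) h0 (h1.trans hx)
  pd_eq i x := by
    have := pd_wt ρ (m + 1) i x
    push_cast at this
    rw [this]; ring
  nonpos x := by
    have := wt_nonneg ρ (m + 2) x
    have : 0 ≤ 2 * ((m : ℝ) + 3) * wt ρ (m + 2) x := by positivity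
    linarith

lemma IsRadial.const_mul {ζ σ : E3 → ℝ} (h : IsRadial ζ σ) {c : ℝ} (hc : 0 ≤ c) :
    IsRadial (fun x => c * ζ x) (fun x => c * σ x) where
  smooth := contDiff_const.mul h.smooth
  nonneg x := mul_nonneg hc (h.nonneg x)
  vanish x hx := by rw [h.vanish x hx, mul_zero]
  pd_eq i x := by
    rw [pd_const_mul (h.smooth.differentiable (by norm_num) x), h.pd_eq]; ring
  nonpos x := mul_nonpos_of_nonneg_of_nonpos hc (h.nonpos x)

namespace IsNormSol

variable {A c₀ : ℝ} {H : E3 × ℝ → ℝ} {b V : E3 × ℝ → E3}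

lemma gradSq_comp (h : IsNormSol A c₀ H b V) {δ : ℝ} {Ψ Ψ1 Ψ2 : ℝ → ℝ} (hΨ : IsTest δ Ψ Ψ1 Ψ2)
    (x : E3) (t : ℝ) :
    gradSq (fun y => Ψ (H (y, t))) x = Ψ1 (H (x, t)) ^ 2 * gradSq (fun y => H (y, t)) x := by
  unfold gradSq
  rw [Finset.mul_sum]
  refine Finset.sum_congr rfl fun i _ => ?_
  rw [pd_comp (f := fun y => H (y, t)) (hΨ.deriv1 _ (h.pos (x, t)))
    ((contDiff_slice h.smooth_H t).differentiable (by norm_num) x) i]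
  ring

lemma energy_ineq (h : IsNormSol A c₀ H b V) {δ : ℝ} (hδ : δ < 1) {Ψ Ψ1 Ψ2 : ℝ → ℝ}
    (hΨ : IsTest δ Ψ Ψ1 Ψ2) {ζ σ : E3 → ℝ} (hζ : IsRadial ζ σ) {t : ℝ} (ht : t ∈ Ioo (-1 : ℝ) 0) :
    ∫ x, ζ x * deriv (fun s => Ψ (H (x, s))) t ∂muB
      ≤ ∫ x, ζ x * lap (fun y => Ψ (H (y, t))) x ∂muB
        - ∫ x, ζ x * ∑ i, b (x, t) i * pd (fun y => Ψ (H (y, t))) i x ∂muB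
        - ∫ x, ζ x * (Ψ2 (H (x, t)) * gradSq (fun y => H (y, t)) x) ∂muB := by
  have hHC := h.smooth_H
  have hHC1 : ContDiff ℝ 1 H := h.smooth_H.of_le (by norm_num)
  have hbC := h.smooth_b
  have hpC2 := hΨ.contDiff_comp h.smooth_H h.pos
  have hpC1 : ContDiff ℝ 1 (fun z => Ψ (H z)) := hpC2.of_le (by norm_num)
  have hHs := contDiff_slice h.smooth_H t
  have hHd : Differentiable ℝ (fun y => H (y, t)) := hHs.differentiable (by norm_num)
  have hps : ContDiff ℝ 2 (fun y => Ψ (H (y, t))) := contDiff_slice hpC2 t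
  have hps1 : ContDiff ℝ 1 (fun y => Ψ (H (y, t))) := hps.of_le (by norm_num)
  have hζ1 : ContDiff ℝ 1 ζ := hζ.smooth.of_le (by norm_num)
  have hζc : Continuous ζ := hζ1.continuous
  have c2 : Continuous (fun x => Ψ2 (H (x, t))) :=
    hΨ.cont2.comp_continuous (by fun_prop) fun x => h.pos _
  have c2' : Continuous (fun x => Ψ2 (H (x, t)) * gradSq (fun y => H (y, t)) x) :=
    c2.mul (by fun_prop)
  have hax0 : ∀ x : E3, x 0 ^ 2 + x 1 ^ 2 = 0 → H (x, t) = c₀ := by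
    intro x hx
    have a0 : x 0 = 0 := by nlinarith [sq_nonneg (x 0), sq_nonneg (x 1)]
    have a1 : x 1 = 0 := by nlinarith [sq_nonneg (x 0), sq_nonneg (x 1)]
    rw [h.eq_swirl, a0, a1]; ring
  have hax : ∀ x : E3, x 0 ^ 2 + x 1 ^ 2 = 0 → (fun y => Ψ (H (y, t))) =ᶠ[nhds x] fun _ => 0 := by
    intro x hx
    have h1 : δ < H (x, t) := by rw [hax0 x hx]; linarith [h.one_le_c]
    have h2 : ∀ᶠ y in nhds x, δ < H (y, t) :=
      hHs.continuous.continuousAt.eventually (lt_mem_nhds h1)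
    filter_upwards [h2] with y hy using hΨ.vanish _ hy.le
  obtain ⟨cγ, eγ⟩ := integral_mul_radial hps1 hζ1 hζ.vanish hax hζ.pd_eq
  have hγ : 0 ≤ ∫ x, ζ x * ((x 0 * pd (fun y => Ψ (H (y, t))) 0 x
      + x 1 * pd (fun y => Ψ (H (y, t))) 1 x) / (x 0 ^ 2 + x 1 ^ 2)) ∂muB := by
    rw [eγ, ← integral_neg]
    refine integral_muB_nonneg fun x _ => ?_
    rw [neg_nonneg]
    exact mul_nonpos_of_nonneg_of_nonpos (hΨ.nonneg _) (hζ.nonpos x)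
  have hpt : ∀ x : E3, ‖x‖ ≤ 1 → deriv (fun s => Ψ (H (x, s))) t
      = lap (fun y => Ψ (H (y, t))) x - ∑ i, b (x, t) i * pd (fun y => Ψ (H (y, t))) i x
        - Ψ2 (H (x, t)) * gradSq (fun y => H (y, t)) x
        - 2 * ((x 0 * pd (fun y => Ψ (H (y, t))) 0 x
          + x 1 * pd (fun y => Ψ (H (y, t))) 1 x) / (x 0 ^ 2 + x 1 ^ 2)) := by
    intro x hx
    have e1 : deriv (fun s => Ψ (H (x, s))) t = Ψ1 (H (x, t)) * deriv (fun s => H (x, s)) t := by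
      have hd := hasDerivAt_slice (hHC.differentiable (by norm_num) (x, t))
      have := (hΨ.deriv1 (H (x, t)) (h.pos _)).comp t hd
      rw [hd.deriv]
      exact this.deriv
    have e2 : ∀ i, pd (fun y => Ψ (H (y, t))) i x = Ψ1 (H (x, t)) * pd (fun y => H (y, t)) i x :=
      fun i => pd_comp (f := fun y => H (y, t)) (hΨ.deriv1 _ (h.pos (x, t))) (hHd x) i
    have e3 := lap_comp (Ψ := Ψ) hHs (fun y => hΨ.deriv1 _ (h.pos (y, t)))
      (fun y => hΨ.deriv2 _ (h.pos (y, t))) x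
    have e4 := h.eqn x t hx ht
    have e5 := h.radial x t hx ht
    rw [e1, e3]
    simp only [e2]
    have e6 : ∑ i, b (x, t) i * (Ψ1 (H (x, t)) * pd (fun y => H (y, t)) i x)
        = Ψ1 (H (x, t)) * ∑ i, b (x, t) i * pd (fun y => H (y, t)) i x := by
      rw [Finset.mul_sum]; exact Finset.sum_congr rfl fun i _ => by ring
    have e7 : (x 0 * (Ψ1 (H (x, t)) * pd (fun y => H (y, t)) 0 x)
        + x 1 * (Ψ1 (H (x, t)) * pd (fun y => H (y, t)) 1 x)) / (x 0 ^ 2 + x 1 ^ 2)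
        = Ψ1 (H (x, t)) * (pd (fun y => V (y, t) 1) 0 x - pd (fun y => V (y, t) 0) 1 x) := by
      by_cases hr : x 0 ^ 2 + x 1 ^ 2 = 0
      · have h1 : Ψ1 (H (x, t)) = 0 := by
          have h2 : δ < H (x, t) := by rw [hax0 x hr]; linarith [h.one_le_c]
          have h3 : Ψ =ᶠ[nhds (H (x, t))] fun _ => 0 := by
            filter_upwards [lt_mem_nhds h2] with s hs using hΨ.vanish s (le_of_lt hs)
          exact ((hΨ.deriv1 _ (h.pos (x, t))).congr_of_eventuallyEq h3.symm).unique
            (hasDerivAt_const _ _)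
        rw [h1]; simp
      · rw [div_eq_iff hr]
        linear_combination -Ψ1 (H (x, t)) * e5
    rw [e6, e7]
    linear_combination Ψ1 (H (x, t)) * e4
  have e : ∫ x, ζ x * deriv (fun s => Ψ (H (x, s))) t ∂muB
      = ∫ x, ζ x * lap (fun y => Ψ (H (y, t))) x ∂muB
        - ∫ x, ζ x * ∑ i, b (x, t) i * pd (fun y => Ψ (H (y, t))) i x ∂muB
        - ∫ x, ζ x * (Ψ2 (H (x, t)) * gradSq (fun y => H (y, t)) x) ∂muB
        - 2 * ∫ x, ζ x * ((x 0 * pd (fun y => Ψ (H (y, t))) 0 x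
          + x 1 * pd (fun y => Ψ (H (y, t))) 1 x) / (x 0 ^ 2 + x 1 ^ 2)) ∂muB := by
    have cL : Continuous (fun x => ζ x * lap (fun y => Ψ (H (y, t))) x) :=
      hζc.mul (continuous_lap hps)
    have cD : Continuous (fun x => ζ x * ∑ i, b (x, t) i * pd (fun y => Ψ (H (y, t))) i x) :=
      hζc.mul (continuous_finsetSum _ fun i _ =>
        (continuous_slice_coord hbC.continuous t i).mul (continuous_pd hps1 i))
    have cG : Continuous (fun x => ζ x * (Ψ2 (H (x, t)) * gradSq (fun y => H (y, t)) x)) :=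
      hζc.mul c2'
    have cR : Continuous (fun x => 2 * (ζ x * ((x 0 * pd (fun y => Ψ (H (y, t))) 0 x
        + x 1 * pd (fun y => Ψ (H (y, t))) 1 x) / (x 0 ^ 2 + x 1 ^ 2)))) :=
      (hζc.mul cγ).const_mul 2
    rw [← integral_muB_sub cL cD, ← integral_muB_sub (by fun_prop) cG, ← integral_const_mul,
      ← integral_muB_sub (by fun_prop) cR]
    refine integral_muB_congr fun x hx => ?_
    rw [hpt x hx]
    ring
  rw [e]
  linarith

end IsNormSol

/-! ### The truncated logarithm -/

/-- The truncated logarithm `lam (log (δ / s) - k)`. -/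
def tlog (δ k s : ℝ) : ℝ := lam (log δ - log s - k)

/-- Derivative of `tlog`. -/
def tlog1 (δ k s : ℝ) : ℝ := -(lam1 (log δ - log s - k) / s)

/-- Second derivative of `tlog`. -/
def tlog2 (δ k s : ℝ) : ℝ :=
  (lam2 (log δ - log s - k) + lam1 (log δ - log s - k)) / s ^ 2

lemma tlog_eq_zero {δ k s : ℝ} (hδ : 0 < δ) (hk : 0 ≤ k) (hs : δ ≤ s) : tlog δ k s = 0 := by
  have := log_le_log hδ hs
  exact lam_of_nonpos (by linarith)

lemma isTest_tlog {δ k : ℝ} (hδ : 0 < δ) (hk : 0 ≤ k) :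
    IsTest δ (tlog δ k) (tlog1 δ k) (tlog2 δ k) := by
  have harg : ∀ s, 0 < s → HasDerivAt (fun s => log δ - log s - k) (-s⁻¹) s := fun s hs =>
    ((hasDerivAt_log hs.ne').const_sub (log δ)).sub_const k
  have hcl : ContinuousOn (fun s => log δ - log s - k) (Ioi 0) := fun s hs =>
    (harg s hs).continuousAt.continuousWithinAt
  refine ⟨fun s hs => ?_, fun s hs => ?_, ?_, fun s => lam_nonneg _, fun s => tlog_eq_zero hδ hk⟩
  · refine ((hasDerivAt_lam _).comp s (harg s hs)).congr_deriv ?_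
    rw [tlog1]; field_simp
  · have := (((hasDerivAt_lam1 _).comp s (harg s hs)).div (hasDerivAt_id s) hs.ne').neg
    refine this.congr_deriv ?_
    simp only [tlog2, id, Function.comp]
    field_simp; ring
  · have h1 := continuous_lam2.comp_continuousOn hcl
    have h2 := contDiff_lam1.continuous.comp_continuousOn hcl
    exact (h1.add h2).div (by fun_prop) fun s hs => pow_ne_zero 2 (ne_of_gt hs)

lemma tlog1_sq_le (δ k s : ℝ) : tlog1 δ k s ^ 2 ≤ tlog2 δ k s := by
  unfold tlog1 tlog2
  rw [neg_sq, div_pow]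
  gcongr
  have h1 := lam1_nonneg (log δ - log s - k)
  have h2 := lam1_le_one (log δ - log s - k)
  have h3 := lam2_nonneg (log δ - log s - k)
  nlinarith

lemma tlog2_nonneg (δ k s : ℝ) : 0 ≤ tlog2 δ k s := (sq_nonneg _).trans (tlog1_sq_le δ k s)

lemma isTest_tlog_sq {δ k : ℝ} (hδ : 0 < δ) (hk : 0 ≤ k) :
    IsTest δ (fun s => tlog δ k s ^ 2) (fun s => 2 * tlog δ k s * tlog1 δ k s)
      (fun s => 2 * tlog1 δ k s ^ 2 + 2 * tlog δ k s * tlog2 δ k s) := by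
  have h := isTest_tlog hδ hk
  have c0 : ContinuousOn (tlog δ k) (Ioi 0) := fun s hs =>
    (h.deriv1 s hs).continuousAt.continuousWithinAt
  have c1 : ContinuousOn (tlog1 δ k) (Ioi 0) := fun s hs =>
    (h.deriv2 s hs).continuousAt.continuousWithinAt
  refine ⟨fun s hs => ?_, fun s hs => ?_, ?_, fun s => sq_nonneg _, fun s hs => ?_⟩
  · refine ((h.deriv1 s hs).pow 2).congr_deriv ?_
    simp
  · refine (((h.deriv1 s hs).const_mul 2).mul (h.deriv2 s hs)).congr_deriv ?_
    ring
  · have c2 := h.cont2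
    fun_prop
  · simp [h.vanish s hs]

/-! ### The logarithmic estimate -/

lemma integral_weight_sub_sq {w f : E3 → ℝ} (hw : Continuous w) (hf : Continuous f) (s : ℝ) :
    ∫ x, w x * (f x - s) ^ 2 ∂muB
      = ∫ x, w x * f x ^ 2 ∂muB - 2 * s * ∫ x, w x * f x ∂muB + s ^ 2 * ∫ x, w x ∂muB := by
  rw [← integral_const_mul, ← integral_const_mul, ← integral_muB_sub (by fun_prop) (by fun_prop),
    ← integral_muB_add (by fun_prop) (by fun_prop)]
  congr 1; funext x; ring

lemma integral_integral_weight_sub_sq {w f : E3 → ℝ} (hw : Continuous w) (hf : Continuous f) :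
    ∫ y, ∫ x, w x * w y * (f x - f y) ^ 2 ∂muB ∂muB
      = 2 * (∫ x, w x ∂muB) * ∫ x, w x * f x ^ 2 ∂muB - 2 * (∫ x, w x * f x ∂muB) ^ 2 := by
  have e : ∀ y, ∫ x, w x * w y * (f x - f y) ^ 2 ∂muB
      = w y * (∫ x, w x * f x ^ 2 ∂muB) - 2 * (∫ x, w x * f x ∂muB) * (w y * f y)
        + (∫ x, w x ∂muB) * (w y * f y ^ 2) := by
    intro y
    have h := integral_weight_sub_sq hw hf (f y)
    have e1 : ∫ x, w x * w y * (f x - f y) ^ 2 ∂muB = w y * ∫ x, w x * (f x - f y) ^ 2 ∂muB := by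
      rw [← integral_const_mul]; congr 1; funext x; ring
    rw [e1, h]; ring
  simp_rw [e]
  rw [integral_muB_add (by fun_prop) (by fun_prop), integral_muB_sub (by fun_prop) (by fun_prop),
    integral_mul_const, integral_const_mul, integral_const_mul]
  ring

lemma sq_integral_weight_le {w f : E3 → ℝ} (hw : Continuous w) (hf : Continuous f)
    (hw0 : ∀ x, 0 ≤ w x) (hW : 0 < ∫ x, w x ∂muB) :
    (∫ x, w x * f x ∂muB) ^ 2 ≤ (∫ x, w x ∂muB) * ∫ x, w x * f x ^ 2 ∂muB := by
  have h : 0 ≤ ∫ x, w x * (f x - (∫ x, w x * f x ∂muB) / ∫ x, w x ∂muB) ^ 2 ∂muB :=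
    integral_muB_nonneg fun x _ => mul_nonneg (hw0 x) (sq_nonneg _)
  rw [integral_weight_sub_sq hw hf] at h
  have h2 := mul_nonneg hW.le h
  field_simp at h2
  nlinarith

lemma riccati_bound {v v' n : ℝ → ℝ} {κ B A c : ℝ} (hκ : 0 < κ) (hB : 0 < B) (hA : 0 < A)
    (hc : 0 < c) (hv : ∀ t, HasDerivAt v (v' t) t) (hn : Continuous n)
    (h1 : ∀ t ∈ Ioo (-3 / 4 : ℝ) (-1 / 4), v' t ≤ B * A - κ * (n t * v t ^ 2))
    (h2 : ∀ t ∈ Ioo (-3 / 4 : ℝ) (-1 / 4), v' t ≤ B * A)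
    (h3 : c / (2 * A) ≤ ∫ t in (-3 / 4 : ℝ)..(-1 / 4), n t) :
    v (-1 / 4) ≤ (B + 8 / (κ * c)) * A := by
  by_contra! hcon
  set D := B + 8 / (κ * c) with hD
  have hDB : B ≤ D := by have : 0 ≤ 8 / (κ * c) := by positivity
                         linarith
  have hD0 : 0 < D := by linarith
  have hDc : 8 / (κ * c) ≤ D := by linarith
  have hlow : ∀ t ∈ Icc (-3 / 4 : ℝ) (-1 / 4), D * A / 2 < v t := by
    intro t ht
    have h := sub_le_integral_of_deriv_le ht.2 hv (φ := fun _ => B * A) continuous_const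
      fun s hs => h2 s ⟨by linarith [ht.1, hs.1], hs.2⟩
    rw [intervalIntegral.integral_const, smul_eq_mul] at h
    have h4 : (-1 / 4 - t) * (B * A) ≤ 1 / 2 * (D * A) := by
      apply mul_le_mul _ _ (by positivity) (by norm_num)
      · linarith [ht.1]
      · gcongr
    linarith
  have hvpos : ∀ t ∈ Icc (-3 / 4 : ℝ) (-1 / 4), 0 < v t := fun t ht =>
    lt_trans (by positivity) (hlow t ht)
  have hinv : ∀ t ∈ Icc (-3 / 4 : ℝ) (-1 / 4),
      HasDerivAt (fun t => (v t)⁻¹) (-v' t / v t ^ 2) t := fun t ht => (hv t).inv (hvpos t ht).ne'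
  have key := intervalIntegral.integral_le_sub_of_hasDeriv_right_of_le
    (a := (-3 / 4 : ℝ)) (b := -1 / 4) (g := fun t => (v t)⁻¹) (g' := fun t => -v' t / v t ^ 2)
    (φ := fun t => κ * n t - 4 * B / (D ^ 2 * A)) (by norm_num)
    (fun t ht => (hinv t ht).continuousAt.continuousWithinAt)
    (fun t ht => (hinv t (Ioo_subset_Icc_self ht)).hasDerivWithinAt)
    ((by fun_prop : Continuous fun t =>
        κ * n t - 4 * B / (D ^ 2 * A)).continuousOn.integrableOn_compact
      isCompact_Icc) (fun t ht => by
      have hp := hvpos t (Ioo_subset_Icc_self ht)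
      have hl := hlow t (Ioo_subset_Icc_self ht)
      have h5 := h1 t ht
      rw [le_div_iff₀ (by positivity)]
      have h6 : B * A ≤ 4 * B / (D ^ 2 * A) * v t ^ 2 := by
        have h7 : (D * A / 2) ^ 2 ≤ v t ^ 2 := by gcongr
        calc B * A = 4 * B / (D ^ 2 * A) * (D * A / 2) ^ 2 := by field_simp; ring
          _ ≤ _ := by gcongr
      nlinarith)
  rw [intervalIntegral.integral_sub ((hn.const_mul _).intervalIntegrable _ _)
    (continuous_const.intervalIntegrable _ _), intervalIntegral.integral_const_mul,
    intervalIntegral.integral_const, smul_eq_mul] at key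
  have h8 : 0 < (v (-3 / 4))⁻¹ := inv_pos.2 (hvpos _ ⟨le_rfl, by norm_num⟩)
  have h9 : (v (-1 / 4))⁻¹ ≤ (D * A)⁻¹ := inv_anti₀ (by positivity) hcon.le
  have h10 : κ * (c / (2 * A)) ≤ κ * ∫ t in (-3 / 4 : ℝ)..(-1 / 4), n t := by gcongr
  have h11 : (D * A)⁻¹ ≤ κ * c / (8 * A) := by
    rw [div_le_iff₀ (by positivity)] at hDc
    rw [inv_le_comm₀ (by positivity) (by positivity), inv_div, div_le_iff₀ (by positivity)]
    nlinarith
  have h12 : 2 * B / (D ^ 2 * A) ≤ 2 * (D * A)⁻¹ := by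
    calc 2 * B / (D ^ 2 * A) ≤ 2 * D / (D ^ 2 * A) := by gcongr
      _ = _ := by field_simp
  have h13 : κ * (c / (2 * A)) = 4 * (κ * c / (8 * A)) := by field_simp; norm_num
  have h14 : 0 < κ * c / (8 * A) := by positivity
  have h15 : (-1 / 4 - -3 / 4 : ℝ) * (4 * B / (D ^ 2 * A)) = 2 * B / (D ^ 2 * A) := by ring
  rw [h15] at key
  linarith

namespace IsNormSol

variable {A c₀ : ℝ} {H : E3 × ℝ → ℝ} {b V : E3 × ℝ → E3}

lemma log_deriv_le (h : IsNormSol A c₀ H b V) {δ : ℝ} (hδ : 0 < δ) (hδ1 : δ < 1) {t : ℝ}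
    (ht : t ∈ Ioo (-1 : ℝ) 0) :
    ∫ x, wt 1 3 x * deriv (fun s => tlog δ 0 (H (x, s))) t ∂muB
      ≤ (36 * (∫ x, wt 1 1 x ∂muB) + 1) * A
        - 1 / 2 * ∫ x, wt 1 3 x * gradSq (fun y => tlog δ 0 (H (y, t))) x ∂muB := by
  have hΨ := isTest_tlog hδ (le_refl (0 : ℝ))
  have hζ := isRadial_wt zero_le_one le_rfl 0
  have hE := h.energy_ineq hδ1 hΨ hζ ht
  simp only [zero_add] at hE
  have hps : ContDiff ℝ 2 (fun y => tlog δ 0 (H (y, t))) :=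
    contDiff_slice (hΨ.contDiff_comp h.smooth_H h.pos) t
  set p : E3 → ℝ := fun y => tlog δ 0 (H (y, t)) with hp
  have hps1 : ContDiff ℝ 1 p := hps.of_le (by norm_num)
  have hHs1 : ContDiff ℝ 1 (fun y => H (y, t)) := (contDiff_slice h.smooth_H t).of_le (by norm_num)
  have hbc := continuous_slice_coord h.smooth_b.continuous t
  rw [integral_mul_lap hps (contDiff_wt_one 1 (by norm_num))
    fun x hx => wt_eq_zero (by norm_num) zero_le_one hx] at hE
  have hg : ∀ x, wt 1 3 x * gradSq p x
      ≤ wt 1 3 x * (tlog2 δ 0 (H (x, t)) * gradSq (fun y => H (y, t)) x) := by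
    intro x
    refine mul_le_mul_of_nonneg_left ?_ (wt_nonneg _ _ _)
    rw [h.gradSq_comp hΨ]
    exact mul_le_mul_of_nonneg_right (tlog1_sq_le _ _ _) (gradSq_nonneg _ _)
  have hpd : ∀ i x, pd (wt 1 3) i x = -6 * (x i * wt 1 2 x) := by
    intro i x
    have := pd_wt 1 1 i x
    norm_num at this ⊢
    linarith
  have cT : Continuous (fun x => tlog2 δ 0 (H (x, t))) :=
    hΨ.cont2.comp_continuous hHs1.continuous fun x => h.pos _
  have hIG : ∫ x, wt 1 3 x * gradSq p x ∂muB
      ≤ ∫ x, wt 1 3 x * (tlog2 δ 0 (H (x, t)) * gradSq (fun y => H (y, t)) x) ∂muB :=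
    integral_muB_mono (by fun_prop)
      ((continuous_wt 1 3).mul (cT.mul (continuous_gradSq hHs1))) fun x _ => hg x
  have c1 : Continuous (fun x => ∑ i, pd p i x * pd (wt 1 3) i x) :=
    continuous_finsetSum _ fun i _ => (continuous_pd hps1 i).mul
      (continuous_pd (contDiff_wt_one 1 (by norm_num)) i)
  have c2 : Continuous (fun x => wt 1 3 x * ∑ i, b (x, t) i * pd p i x) :=
    (continuous_wt 1 3).mul (continuous_finsetSum _ fun i _ => (hbc i).mul (continuous_pd hps1 i))
  have c3 := h.continuous_sq_drift t
  have hyoung : -(∫ x, ∑ i, pd p i x * pd (wt 1 3) i x ∂muB)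
        - ∫ x, wt 1 3 x * ∑ i, b (x, t) i * pd p i x ∂muB
      ≤ 36 * (∫ x, wt 1 1 x ∂muB) + ∫ x, ∑ i, b (x, t) i ^ 2 ∂muB
        + 1 / 2 * ∫ x, wt 1 3 x * gradSq p x ∂muB := by
    have c4 : Continuous (fun x => 36 * wt 1 1 x) := by fun_prop
    have c5 : Continuous (fun x => 1 / 2 * (wt 1 3 x * gradSq p x)) := by fun_prop
    have c6 : Continuous (fun x => 36 * wt 1 1 x + ∑ i, b (x, t) i ^ 2) := c4.add c3
    have c1n : Continuous (fun x => -∑ i, pd p i x * pd (wt 1 3) i x) := c1.neg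
    rw [← integral_neg, ← integral_muB_sub c1n c2, ← integral_const_mul, ← integral_const_mul,
      ← integral_muB_add c4 c3, ← integral_muB_add c6 c5]
    refine integral_muB_mono (c1n.sub c2) (c6.add c5) fun x hx => ?_
    have hx2 : x 0 ^ 2 + x 1 ^ 2 + x 2 ^ 2 ≤ 1 := by
      rw [← norm_sq_eq_coords]; nlinarith [norm_nonneg x]
    simp only [hpd, gradSq, Fin.sum_univ_three]
    set q := max ((1 : ℝ) ^ 2 - ‖x‖ ^ 2) 0 with hq
    have hq0 : 0 ≤ q := le_max_right _ _
    have hq1 : q ≤ 1 := wt_base_le zero_le_one le_rfl x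
    have hq3 : q ^ 3 ≤ 1 := pow_le_one₀ hq0 hq1
    change -(pd p 0 x * (-6 * (x 0 * q ^ 2)) + pd p 1 x * (-6 * (x 1 * q ^ 2))
        + pd p 2 x * (-6 * (x 2 * q ^ 2)))
      - q ^ 3 * (b (x, t) 0 * pd p 0 x + b (x, t) 1 * pd p 1 x + b (x, t) 2 * pd p 2 x)
      ≤ 36 * q ^ 1 + (b (x, t) 0 ^ 2 + b (x, t) 1 ^ 2 + b (x, t) 2 ^ 2)
        + 1 / 2 * (q ^ 3 * (pd p 0 x ^ 2 + pd p 1 x ^ 2 + pd p 2 x ^ 2))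
    have hone : ∀ a y c : ℝ, 6 * a * (y * q ^ 2) - q ^ 3 * (c * a)
        ≤ 36 * q * y ^ 2 + c ^ 2 + 1 / 2 * (q ^ 3 * a ^ 2) := by
      intro a y c
      have e1 : 0 ≤ q * (q * a / 2 - 6 * y) ^ 2 := by positivity
      have e2 : 0 ≤ q ^ 3 * (a / 2 + c) ^ 2 := by positivity
      have e3 : q ^ 3 * c ^ 2 ≤ c ^ 2 := mul_le_of_le_one_left (sq_nonneg _) hq3
      nlinarith
    have k0 := hone (pd p 0 x) (x 0) (b (x, t) 0)
    have k1 := hone (pd p 1 x) (x 1) (b (x, t) 1)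
    have k2 := hone (pd p 2 x) (x 2) (b (x, t) 2)
    have k3 : q * (x 0 ^ 2 + x 1 ^ 2 + x 2 ^ 2) ≤ q := mul_le_of_le_one_right hq0 hx2
    linarith
  have hen := h.energy t ht
  have hW0 : 0 ≤ ∫ x, wt 1 1 x ∂muB := (integral_wt_pos 1).le
  have hA := h.one_le_A
  have : 36 * (∫ x, wt 1 1 x ∂muB) ≤ 36 * (∫ x, wt 1 1 x ∂muB) * A := le_mul_of_one_le_right
    (by positivity) hA
  linarith

lemma log_gradient_ge (h : IsNormSol A c₀ H b V) {δ : ℝ} (hδ : 0 < δ) {C : ℝ}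
    (hC : ∀ f : E3 → ℝ, ContDiff ℝ 1 f →
      ∫ y, ∫ x, wt 1 3 x * wt 1 3 y * (f x - f y) ^ 2 ∂muB ∂muB
        ≤ C * ∫ x, wt 1 3 x * gradSq f x ∂muB) {t : ℝ} (ht : t ∈ Ioo (-1 : ℝ) 0) :
    (∫ x, wt 1 3 x * H (x, t) ∂muB - δ * ∫ x, wt 1 3 x ∂muB)
        * (∫ x, wt 1 3 x * tlog δ 0 (H (x, t)) ∂muB) ^ 2
      ≤ 3 * (∫ x, wt 1 3 x ∂muB)
        * (C * ∫ x, wt 1 3 x * gradSq (fun y => tlog δ 0 (H (y, t))) x ∂muB) := by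
  have hΨ := isTest_tlog hδ (le_refl (0 : ℝ))
  have hps : ContDiff ℝ 2 (fun y => tlog δ 0 (H (y, t))) :=
    contDiff_slice (hΨ.contDiff_comp h.smooth_H h.pos) t
  have hHc : Continuous H := h.smooth_H.continuous
  have h1 := hC _ (hps.of_le (by norm_num))
  set p : E3 → ℝ := fun y => tlog δ 0 (H (y, t)) with hp
  have hpc : Continuous p := hps.continuous
  set W := ∫ x, wt 1 3 x ∂muB with hW
  have hW0 : 0 < W := integral_wt_pos 3
  have hcs := sq_integral_weight_le (continuous_wt 1 3) hpc (fun x => wt_nonneg _ _ _) hW0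
  refine le_trans ?_ (mul_le_mul_of_nonneg_left h1 (by positivity))
  rw [integral_integral_weight_sub_sq (continuous_wt 1 3) hpc]
  set v := ∫ x, wt 1 3 x * p x ∂muB with hv
  set S := ∫ x, wt 1 3 x * p x ^ 2 ∂muB with hS
  have e1 : (∫ x, wt 1 3 x * H (x, t) ∂muB - δ * W) * v ^ 2
      = ∫ x, wt 1 3 x * ((H (x, t) - δ) * v ^ 2) ∂muB := by
    rw [hW, ← integral_const_mul, ← integral_muB_sub (by fun_prop) (by fun_prop),
      ← integral_mul_const]
    congr 1; funext x; ring
  have e2 : 3 * W * (2 * W * S - 2 * v ^ 2)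
      = ∫ x, wt 1 3 x * (3 * W * (S - 2 * v * p x + W * p x ^ 2)) ∂muB := by
    have e3 : (fun x => wt 1 3 x * (3 * W * (S - 2 * v * p x + W * p x ^ 2)))
        = fun x => 3 * W * (S * wt 1 3 x - 2 * v * (wt 1 3 x * p x) + W * (wt 1 3 x * p x ^ 2)) :=
            by
      funext x; ring
    rw [e3, integral_const_mul, integral_muB_add (by fun_prop) (by fun_prop),
      integral_muB_sub (by fun_prop) (by fun_prop), integral_const_mul, integral_const_mul,
      integral_const_mul, ← hv, ← hS, ← hW]
    ring
  rw [e1, e2]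
  refine integral_muB_mono (by fun_prop) (by fun_prop) fun y hy => ?_
  refine mul_le_mul_of_nonneg_left ?_ (wt_nonneg _ _ _)
  have hq : 0 ≤ S - 2 * v * p y + W * p y ^ 2 := by
    have := integral_weight_sub_sq (continuous_wt 1 3) hpc (p y)
    rw [← hv, ← hS, ← hW] at this
    have h0 : 0 ≤ ∫ x, wt 1 3 x * (p x - p y) ^ 2 ∂muB :=
      integral_muB_nonneg fun x _ => mul_nonneg (wt_nonneg _ _ _) (sq_nonneg _)
    linarith
  rcases le_or_gt (H (y, t)) δ with hle | hlt
  · have : (H (y, t) - δ) * v ^ 2 ≤ 0 := mul_nonpos_of_nonpos_of_nonneg (by linarith) (sq_nonneg _)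
    have : 0 ≤ 3 * W * (S - 2 * v * p y + W * p y ^ 2) := by positivity
    linarith
  · have hpy : p y = 0 := tlog_eq_zero hδ le_rfl hlt.le
    have h3 := h.le_three y t hy ht
    rw [hpy]
    have : (H (y, t) - δ) * v ^ 2 ≤ 3 * v ^ 2 := by
      apply mul_le_mul_of_nonneg_right _ (sq_nonneg _); linarith
    linarith

end IsNormSol

lemma exists_log_const : ∃ c C : ℝ, 0 < c ∧ c < 1 ∧ 0 < C ∧
    ∀ (A c₀ : ℝ) (H : E3 × ℝ → ℝ) (b V : E3 × ℝ → E3), IsNormSol A c₀ H b V →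
      ∫ t in (-1 / 4 : ℝ)..0, ∫ x, wt 1 3 x * tlog (c / A) 0 (H (x, t)) ^ 2 ∂muB ≤ C * A ^ 2 := by
  obtain ⟨c, hc0, hc1, hc⟩ := exists_mass_const
  obtain ⟨P, hP0, hP⟩ := exists_poincare_const
  set W := ∫ x, wt 1 3 x ∂muB with hW
  have hW0 : 0 < W := integral_wt_pos 3
  set B := 36 * (∫ x, wt 1 1 x ∂muB) + 1 with hB
  have hB0 : 0 < B := by have := integral_wt_pos 1; positivity
  set κ := 1 / (6 * W * P) with hκ
  have hκ0 : 0 < κ := by positivity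
  set D := B + 8 / (κ * c) with hD
  have hD0 : 0 < D := by positivity
  set E := D + B with hE
  have hE0 : 0 < E := by positivity
  refine ⟨c / (W + 1), (E ^ 2 + P * E) / W, by positivity, ?_, by positivity, ?_⟩
  · rw [div_lt_one (by positivity)]; linarith
  intro A c₀ H b V h
  have hA1 := h.one_le_A
  have hA : 0 < A := by linarith
  set δ := c / (W + 1) / A with hδ
  have hδ0 : 0 < δ := by positivity
  have hδ1 : δ < 1 := by
    rw [hδ, div_div, div_lt_one (by positivity)]
    nlinarith
  have hΨ := isTest_tlog hδ0 (le_refl (0 : ℝ))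
  have hp2 := hΨ.contDiff_comp h.smooth_H h.pos
  have hp1 : ContDiff ℝ 1 (fun z => tlog δ 0 (H z)) := hp2.of_le (by norm_num)
  set v : ℝ → ℝ := fun t => ∫ x, wt 1 3 x * tlog δ 0 (H (x, t)) ∂muB with hv
  set G : ℝ → ℝ := fun t => ∫ x, wt 1 3 x * gradSq (fun y => tlog δ 0 (H (y, t))) x ∂muB with hG
  have hG0 : ∀ t, 0 ≤ G t := fun t =>
    integral_muB_nonneg fun x _ => mul_nonneg (wt_nonneg _ _ _) (gradSq_nonneg _ _)
  have hv0 : ∀ t, 0 ≤ v t := fun t =>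
    integral_muB_nonneg fun x _ => mul_nonneg (wt_nonneg _ _ _) (lam_nonneg _)
  have hGc : Continuous G :=
    continuous_integral_muB (f := fun z => wt 1 3 z.1 * gradSq (fun y => tlog δ 0 (H (y, z.2))) z.1)
      (((continuous_wt 1 3).comp continuous_fst).mul (continuous_gradSq_slice hp1))
  have hv' := fun t => hasDerivAt_integral_weight hp1 (contDiff_wt_one 1 (m := 3) (by norm_num)) t
  have hd : ∀ t ∈ Ioo (-1 : ℝ) 0, ∫ x, wt 1 3 x * deriv (fun s => tlog δ 0 (H (x, s))) t ∂muB
      ≤ B * A - 1 / 2 * G t := fun t ht => h.log_deriv_le hδ0 hδ1 ht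
  have hlg : ∀ t ∈ Ioo (-1 : ℝ) 0,
      κ * ((∫ x, wt 1 3 x * H (x, t) ∂muB - δ * W) * v t ^ 2) ≤ 1 / 2 * G t := by
    intro t ht
    have h1 := h.log_gradient_ge hδ0 (hP 3 · (by norm_num)) ht
    calc _ ≤ κ * (3 * W * (P * G t)) := by gcongr
      _ = _ := by rw [hκ]; field_simp; ring
  have hm := hc A c₀ H b V h
  have cm := h.continuous_integral_weight 3
  have hmid : v (-1 / 4) ≤ D * A := by
    refine riccati_bound (n := fun t => ∫ x, wt 1 3 x * H (x, t) ∂muB - δ * W) hκ0 hB0 hA hc0 hv'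
      (cm.sub continuous_const) (fun t ht => ?_) (fun t ht => ?_) ?_
    · have ht' : t ∈ Ioo (-1 : ℝ) 0 := ⟨by linarith [ht.1], by linarith [ht.2]⟩
      linarith [hd t ht', hlg t ht']
    · have ht' : t ∈ Ioo (-1 : ℝ) 0 := ⟨by linarith [ht.1], by linarith [ht.2]⟩
      linarith [hd t ht', hG0 t]
    · rw [intervalIntegral.integral_sub (cm.intervalIntegrable _ _)
        (continuous_const.intervalIntegrable _ _), intervalIntegral.integral_const, smul_eq_mul]
      have h5 : δ * W ≤ c / A := by
        rw [hδ, div_div, div_mul_eq_mul_div, div_le_div_iff₀ (by positivity) hA]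
        nlinarith [mul_pos hc0 hA]
      have h6 : c / (2 * A) = 1 / 2 * (c / A) := by field_simp
      rw [h6]; linarith
  have hup : ∀ t ∈ Icc (-1 / 4 : ℝ) 0, v t ≤ E * A := by
    intro t ht
    have h1 := sub_le_integral_of_deriv_le ht.1 hv' (φ := fun _ => B * A) continuous_const
      fun s hs => by
        have hs' : s ∈ Ioo (-1 : ℝ) 0 := ⟨by linarith [hs.1], by linarith [hs.2, ht.2]⟩
        linarith [hd s hs', hG0 s]
    rw [intervalIntegral.integral_const, smul_eq_mul] at h1
    have h4 : (t - -1 / 4) * (B * A) ≤ B * A := mul_le_of_le_one_left (by positivity)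
      (by linarith [ht.2])
    simp only [hE]
    change v t - v (-1 / 4) ≤ _ at h1
    linarith
  have hGI : ∫ t in (-1 / 4 : ℝ)..0, G t ≤ 2 * E * A := by
    have h1 := sub_le_integral_of_deriv_le (a := -1 / 4) (b := 0) (by norm_num) hv'
      (φ := fun t => B * A - 1 / 2 * G t) (by fun_prop)
      fun s hs => hd s ⟨by linarith [hs.1], hs.2⟩
    rw [intervalIntegral.integral_sub (continuous_const.intervalIntegrable _ _)
      ((hGc.const_mul _).intervalIntegrable _ _), intervalIntegral.integral_const, smul_eq_mul,
      intervalIntegral.integral_const_mul] at h1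
    change v 0 - v (-1 / 4) ≤ _ at h1
    have := hv0 0
    simp only [hE]
    nlinarith [mul_pos hB0 hA]
  have hSc : Continuous (fun t => ∫ x, wt 1 3 x * tlog δ 0 (H (x, t)) ^ 2 ∂muB) :=
    continuous_integral_muB (f := fun z => wt 1 3 z.1 * tlog δ 0 (H z) ^ 2)
      (((continuous_wt 1 3).comp continuous_fst).mul (hp1.continuous.pow 2))
  have hS : ∀ t ∈ Icc (-1 / 4 : ℝ) 0, ∫ x, wt 1 3 x * tlog δ 0 (H (x, t)) ^ 2 ∂muB
      ≤ (E ^ 2 * A ^ 2 + P / 2 * G t) / W := by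
    intro t ht
    have hps1 : ContDiff ℝ 1 (fun y => tlog δ 0 (H (y, t))) := contDiff_slice hp1 t
    have h1 := hP 3 _ (by norm_num) hps1
    rw [integral_integral_weight_sub_sq (continuous_wt 1 3) hps1.continuous] at h1
    rw [le_div_iff₀ hW0]
    have h2 : v t ^ 2 ≤ (E * A) ^ 2 := by
      have := hup t ht
      have := hv0 t
      gcongr
    change 2 * W * _ - 2 * v t ^ 2 ≤ P * G t at h1
    linarith
  calc _ ≤ ∫ t in (-1 / 4 : ℝ)..0, (E ^ 2 * A ^ 2 + P / 2 * G t) / W :=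
        intervalIntegral.integral_mono_on (by norm_num) (hSc.intervalIntegrable _ _)
          ((by fun_prop : Continuous fun t => (E ^ 2 * A ^ 2 + P / 2 * G t) / W).intervalIntegrable
            _ _) hS
    _ = (1 / 4 * (E ^ 2 * A ^ 2) + P / 2 * ∫ t in (-1 / 4 : ℝ)..0, G t) / W := by
        rw [intervalIntegral.integral_div, intervalIntegral.integral_add
          (continuous_const.intervalIntegrable _ _) ((hGc.const_mul _).intervalIntegrable _ _),
          intervalIntegral.integral_const, smul_eq_mul, intervalIntegral.integral_const_mul]
        norm_num
    _ ≤ (E ^ 2 * A ^ 2 + P * E * A ^ 2) / W := by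
        have h1 : P / 2 * ∫ t in (-1 / 4 : ℝ)..0, G t ≤ P / 2 * (2 * E * A) := by gcongr
        have h2 : P * E * A ≤ P * E * A ^ 2 := by
          have : A ≤ A ^ 2 := by nlinarith
          gcongr
        have h3 : 0 ≤ E ^ 2 * A ^ 2 := by positivity
        refine div_le_div_of_nonneg_right ?_ hW0.le
        linarith
    _ = _ := by ring

/-! ### The local energy estimate -/

lemma sq_integral_mul_le {f g : E3 → ℝ} (hf : Continuous f) (hg : Continuous g) :
    (∫ x, f x * g x ∂muB) ^ 2 ≤ (∫ x, f x ^ 2 ∂muB) * ∫ x, g x ^ 2 ∂muB := by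
  have h : ∀ s : ℝ, 0 ≤ (∫ x, f x ^ 2 ∂muB) * (s * s) + 2 * (∫ x, f x * g x ∂muB) * s
      + ∫ x, g x ^ 2 ∂muB := by
    intro s
    have h1 : 0 ≤ ∫ x, (f x * s + g x) ^ 2 ∂muB := integral_muB_nonneg fun x _ => sq_nonneg _
    have e : (fun x => (f x * s + g x) ^ 2)
        = fun x => s * s * f x ^ 2 + 2 * s * (f x * g x) + g x ^ 2 := by funext x; ring
    rw [e, integral_muB_add (by fun_prop) (by fun_prop), integral_muB_add (by fun_prop)
        (by fun_prop),
      integral_const_mul, integral_const_mul] at h1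
    linarith
  have := discrim_le_zero h
  unfold discrim at this
  linarith

lemma young_four {T K X N s : ℝ} (hX : 0 ≤ X) (hKN : 0 ≤ K * N) (hs : 0 < s)
    (h : T ^ 4 ≤ K * X ^ 3 * N) : T ≤ s * X + K * N / s ^ 3 := by
  by_contra! hc
  have h0 : 0 ≤ K * N / s ^ 3 := by positivity
  have h1 : s * X < T := by linarith
  have h2 : K * N / s ^ 3 < T := by nlinarith
  have hT : 0 < T := by nlinarith
  rw [div_lt_iff₀ (by positivity)] at h2
  have h3 : (s * X) ^ 3 ≤ T ^ 3 := by gcongr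
  have h4 : K * N * X ^ 3 * s ^ 3 < T ^ 4 * s ^ 3 := by
    calc K * N * X ^ 3 * s ^ 3 = K * N * (s * X) ^ 3 := by ring
      _ ≤ K * N * T ^ 3 := by gcongr
      _ < T * s ^ 3 * T ^ 3 := by gcongr
      _ = T ^ 4 * s ^ 3 := by ring
  have h5 := lt_of_mul_lt_mul_right h4 (by positivity)
  nlinarith

lemma gradSq_mul_le {φ w : E3 → ℝ} (hφ : ContDiff ℝ 1 φ) (hw : ContDiff ℝ 1 w) (x : E3) :
    gradSq (fun y => φ y * w y) x ≤ 2 * (φ x ^ 2 * gradSq w x) + 2 * (w x ^ 2 * gradSq φ x) := by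
  unfold gradSq
  rw [Finset.mul_sum, Finset.mul_sum, Finset.mul_sum, Finset.mul_sum, ← Finset.sum_add_distrib]
  refine Finset.sum_le_sum fun i _ => ?_
  rw [pd_mul (hφ.differentiable (by norm_num) x) (hw.differentiable (by norm_num) x)]
  nlinarith [sq_nonneg (φ x * pd w i x - pd φ i x * w x)]

lemma gradSq_wt_three_le {ρ : ℝ} (h0 : 0 ≤ ρ) (h1 : ρ ≤ 1) {x : E3} (hx : ‖x‖ ≤ 1) :
    gradSq (wt ρ 3) x ≤ 36 * wt ρ 2 x := by
  have hpd : ∀ i, pd (wt ρ 3) i x = -6 * (x i * wt ρ 2 x) := by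
    intro i
    have := pd_wt ρ 1 i x
    norm_num at this ⊢
    linarith
  have hx2 : x 0 ^ 2 + x 1 ^ 2 + x 2 ^ 2 ≤ 1 := by
    rw [← norm_sq_eq_coords]; nlinarith [norm_nonneg x]
  have hw0 := wt_nonneg ρ 2 x
  have hw1 := wt_le_one (m := 2) h0 h1 x
  simp only [gradSq, hpd, Fin.sum_univ_three]
  have e : (-6 * (x 0 * wt ρ 2 x)) ^ 2 + (-6 * (x 1 * wt ρ 2 x)) ^ 2 + (-6 * (x 2 * wt ρ 2 x)) ^ 2
      = 36 * (wt ρ 2 x ^ 2 * (x 0 ^ 2 + x 1 ^ 2 + x 2 ^ 2)) := by ring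
  rw [e]
  have h2 : wt ρ 2 x ^ 2 ≤ wt ρ 2 x := by nlinarith
  have h3 : wt ρ 2 x ^ 2 * (x 0 ^ 2 + x 1 ^ 2 + x 2 ^ 2) ≤ wt ρ 2 x ^ 2 * 1 := by gcongr
  linarith

lemma integral_six_le {C : ℝ} (hC0 : 0 < C)
    (hC : ∀ f : E3 → ℝ, ContDiff ℝ 1 f → (∀ x, 1 ≤ ‖x‖ → f x = 0) →
      ∫ x, f x ^ 6 ∂muB ≤ C * (∫ x, gradSq f x ∂muB) ^ 3) {ρ : ℝ} (h0 : 0 ≤ ρ) (h1 : ρ ≤ 1)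
    {w : E3 → ℝ} (hw : ContDiff ℝ 1 w) :
    ∫ x, (wt ρ 3 x * w x) ^ 6 ∂muB
      ≤ C * (2 * (∫ x, wt ρ 6 x * gradSq w x ∂muB) + 72 * ∫ x, wt ρ 2 x * w x ^ 2 ∂muB) ^ 3 := by
  have hφ : ContDiff ℝ 1 (wt ρ 3) := contDiff_wt_one ρ (by norm_num)
  refine (hC _ (hφ.mul hw) fun x hx => by
    rw [wt_eq_zero (by norm_num) h0 (h1.trans hx), zero_mul]).trans ?_
  have hg0 : 0 ≤ ∫ x, gradSq (fun x => wt ρ 3 x * w x) x ∂muB :=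
    integral_muB_nonneg fun x _ => gradSq_nonneg _ _
  gcongr
  have hwc := hw.continuous
  rw [← integral_const_mul, ← integral_const_mul, ← integral_muB_add (by fun_prop) (by fun_prop)]
  refine integral_muB_mono (continuous_gradSq (hφ.mul hw)) (by fun_prop) fun x hx => ?_
  refine (gradSq_mul_le hφ hw x).trans ?_
  rw [wt_pow]
  have h2 := mul_le_mul_of_nonneg_left (gradSq_wt_three_le h0 h1 hx) (sq_nonneg (w x))
  norm_num
  linarith

namespace IsNormSol

variable {A c₀ : ℝ} {H : E3 × ℝ → ℝ} {b V : E3 × ℝ → E3}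

lemma energy_sq (h : IsNormSol A c₀ H b V) {δ k ρ : ℝ} (hδ : 0 < δ) (hδ1 : δ < 1) (hk : 0 ≤ k)
    (h0 : 0 ≤ ρ) (h1 : ρ ≤ 1) {t : ℝ} (ht : t ∈ Ioo (-1 : ℝ) 0) :
    ∫ x, wt ρ 6 x * deriv (fun s => tlog δ k (H (x, s)) ^ 2) t ∂muB
      ≤ 120 * (∫ x, wt ρ 2 x * tlog δ k (H (x, t)) ^ 2 ∂muB)
        - 12 * (∫ x, (∑ i, b (x, t) i * x i) * (wt ρ 5 x * tlog δ k (H (x, t)) ^ 2) ∂muB)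
        - 2 * ∫ x, wt ρ 6 x * gradSq (fun y => tlog δ k (H (y, t))) x ∂muB := by
  have hΨ := isTest_tlog hδ hk
  have hΨ2 := isTest_tlog_sq hδ hk
  have hζ := isRadial_wt h0 h1 3
  have hE := h.energy_ineq hδ1 hΨ2 hζ ht
  norm_num at hE
  have hps : ContDiff ℝ 2 (fun y => tlog δ k (H (y, t))) :=
    contDiff_slice (hΨ.contDiff_comp h.smooth_H h.pos) t
  set p : E3 → ℝ := fun y => tlog δ k (H (y, t)) with hp
  have hpc : Continuous p := hps.continuous
  have hs2 : ContDiff ℝ 2 (fun y => p y ^ 2) := hps.pow 2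
  have hs1 : ContDiff ℝ 1 (fun y => p y ^ 2) := hs2.of_le (by norm_num)
  have hps1 : ContDiff ℝ 1 p := hps.of_le (by norm_num)
  have hHs1 : ContDiff ℝ 1 (fun y => H (y, t)) := (contDiff_slice h.smooth_H t).of_le (by norm_num)
  have hbc := continuous_slice_coord h.smooth_b.continuous t
  have hpd : ∀ i x, pd (wt ρ 6) i x = -12 * (x i * wt ρ 5 x) := by
    intro i x
    have := pd_wt ρ 4 i x
    norm_num at this ⊢
    linarith
  have hout : ∀ m : ℕ, m ≠ 0 → ∀ x : E3, 1 ≤ ‖x‖ → wt ρ m x = 0 := fun m hm x hx =>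
    wt_eq_zero hm h0 (h1.trans hx)
  have e1 := integral_mul_lap_eq hs2 (contDiff_wt_two ρ (m := 6) (by norm_num))
      (hout 6 (by norm_num))
    fun i x hx => by rw [hpd, hout 5 (by norm_num) x hx]; ring
  have e2 := integral_mul_drift hs1 (contDiff_wt_one ρ (m := 6) (by norm_num))
    (contDiff_slice_vec h.smooth_b t) (hout 6 (by norm_num)) fun x hx => h.div x t hx ht
  have e3 : ∫ x, p x ^ 2 * ∑ i, b (x, t) i * pd (wt ρ 6) i x ∂muB
      = -12 * ∫ x, (∑ i, b (x, t) i * x i) * (wt ρ 5 x * p x ^ 2) ∂muB := by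
    rw [← integral_const_mul]
    congr 1; funext x
    simp only [hpd, Fin.sum_univ_three]
    ring
  have i1 : ∫ x, p x ^ 2 * lap (wt ρ 6) x ∂muB ≤ 120 * ∫ x, wt ρ 2 x * p x ^ 2 ∂muB := by
    rw [← integral_const_mul]
    refine integral_muB_mono ((hpc.pow 2).mul (continuous_lap (contDiff_wt_two ρ (by norm_num))))
      (by fun_prop) fun x hx => ?_
    have := lap_wt ρ 3 x
    norm_num at this
    rw [this]
    have h5 := wt_nonneg ρ 5 x
    have h4 : wt ρ 4 x ≤ wt ρ 2 x := wt_le_wt h0 h1 (by norm_num) x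
    have hx2 : ‖x‖ ^ 2 ≤ 1 := pow_le_one₀ (norm_nonneg _) hx
    have h4' : ‖x‖ ^ 2 * wt ρ 4 x ≤ wt ρ 2 x :=
      (mul_le_of_le_one_left (wt_nonneg _ _ _) hx2).trans h4
    nlinarith [sq_nonneg (p x), mul_le_mul_of_nonneg_left h4' (sq_nonneg (p x)),
      mul_nonneg h5 (sq_nonneg (p x))]
  have cT : Continuous (fun x => tlog2 δ k (H (x, t))) :=
    hΨ.cont2.comp_continuous hHs1.continuous fun x => h.pos _
  have cT2 : Continuous (fun x => 2 * tlog1 δ k (H (x, t)) ^ 2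
      + 2 * tlog δ k (H (x, t)) * tlog2 δ k (H (x, t))) :=
    hΨ2.cont2.comp_continuous hHs1.continuous fun x => h.pos _
  have i2 : 2 * ∫ x, wt ρ 6 x * gradSq p x ∂muB
      ≤ ∫ x, wt ρ 6 x * ((2 * tlog1 δ k (H (x, t)) ^ 2
        + 2 * tlog δ k (H (x, t)) * tlog2 δ k (H (x, t))) * gradSq (fun y => H (y, t)) x) ∂muB := by
    rw [← integral_const_mul]
    refine integral_muB_mono (by fun_prop)
      ((continuous_wt ρ 6).mul (cT2.mul (continuous_gradSq hHs1))) fun x _ => ?_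
    rw [hp, h.gradSq_comp hΨ]
    have h3 : 0 ≤ 2 * tlog δ k (H (x, t)) * tlog2 δ k (H (x, t)) :=
      mul_nonneg (mul_nonneg (by norm_num) (lam_nonneg _)) (tlog2_nonneg _ _ _)
    have h4 := mul_nonneg (wt_nonneg ρ 6 x) (mul_nonneg h3 (gradSq_nonneg (fun y => H (y, t)) x))
    linarith
  rw [e1, e2, e3] at hE
  linarith

lemma drift_four_le (h : IsNormSol A c₀ H b V) {C : ℝ} (hC0 : 0 < C)
    (hC : ∀ f : E3 → ℝ, ContDiff ℝ 1 f → (∀ x, 1 ≤ ‖x‖ → f x = 0) →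
      ∫ x, f x ^ 6 ∂muB ≤ C * (∫ x, gradSq f x ∂muB) ^ 3) {ρ : ℝ}
    (h0 : 0 ≤ ρ) (h1 : ρ ≤ 1) {t : ℝ} (ht : t ∈ Ioo (-1 : ℝ) 0) {w : E3 → ℝ} (hw : ContDiff ℝ 1 w) :
    (∫ x, (∑ i, b (x, t) i * x i) * (wt ρ 5 x * w x ^ 2) ∂muB) ^ 4
      ≤ A ^ 2 * C * (2 * (∫ x, wt ρ 6 x * gradSq w x ∂muB) + 72 * ∫ x, wt ρ 2 x * w x ^ 2 ∂muB) ^ 3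
        * ∫ x, wt ρ 2 x * w x ^ 2 ∂muB := by
  have hwc := hw.continuous
  have cb : Continuous (fun x => ∑ i, b (x, t) i * x i) := continuous_finsetSum _ fun i _ =>
    (continuous_slice_coord h.smooth_b.continuous t i).mul (continuous_coord i)
  have s1 := sq_integral_mul_le cb (by fun_prop : Continuous fun x => wt ρ 5 x * w x ^ 2)
  have s2 : ∫ x, (∑ i, b (x, t) i * x i) ^ 2 ∂muB ≤ A := by
    refine (integral_muB_mono (cb.pow 2) (h.continuous_sq_drift t) fun x hx => ?_).trans
      (h.energy t ht)
    have hx2 : ∑ i, x i ^ 2 ≤ 1 := by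
      rw [Fin.sum_univ_three, ← norm_sq_eq_coords]; nlinarith [norm_nonneg x]
    refine (Finset.sum_mul_sq_le_sq_mul_sq _ _ _).trans ?_
    exact mul_le_of_le_one_right (Finset.sum_nonneg fun i _ => sq_nonneg _) hx2
  have s3 := sq_integral_mul_le (by fun_prop : Continuous fun x => (wt ρ 3 x * w x) ^ 3)
    (by fun_prop : Continuous fun x => wt ρ 1 x * w x)
  have e3 : (fun x => (wt ρ 3 x * w x) ^ 3 * (wt ρ 1 x * w x)) = fun x =>
      (wt ρ 5 x * w x ^ 2) ^ 2 := by
    funext x; simp only [wt]; ring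
  have e4 : (fun x => ((wt ρ 3 x * w x) ^ 3) ^ 2) = fun x => (wt ρ 3 x * w x) ^ 6 := by
    funext x; ring
  have e5 : (fun x => (wt ρ 1 x * w x) ^ 2) = fun x => wt ρ 2 x * w x ^ 2 := by
    funext x; simp only [wt]; ring
  rw [e3, e4, e5] at s3
  have s6 := integral_six_le hC0 hC h0 h1 hw
  have hN : 0 ≤ ∫ x, wt ρ 2 x * w x ^ 2 ∂muB :=
    integral_muB_nonneg fun x _ => mul_nonneg (wt_nonneg _ _ _) (sq_nonneg _)
  have hB : 0 ≤ ∫ x, (∑ i, b (x, t) i * x i) ^ 2 ∂muB := integral_muB_nonneg fun x _ => sq_nonneg _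
  have hQ : 0 ≤ ∫ x, (wt ρ 5 x * w x ^ 2) ^ 2 ∂muB := integral_muB_nonneg fun x _ => sq_nonneg _
  calc (∫ x, (∑ i, b (x, t) i * x i) * (wt ρ 5 x * w x ^ 2) ∂muB) ^ 4
      = ((∫ x, (∑ i, b (x, t) i * x i) * (wt ρ 5 x * w x ^ 2) ∂muB) ^ 2) ^ 2 := by ring
    _ ≤ ((∫ x, (∑ i, b (x, t) i * x i) ^ 2 ∂muB) * ∫ x, (wt ρ 5 x * w x ^ 2) ^ 2 ∂muB) ^ 2 := by
        gcongr
    _ = (∫ x, (∑ i, b (x, t) i * x i) ^ 2 ∂muB) ^ 2 * (∫ x, (wt ρ 5 x * w x ^ 2) ^ 2 ∂muB) ^ 2 :=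
        mul_pow _ _ _
    _ ≤ A ^ 2 * ((C * (2 * (∫ x, wt ρ 6 x * gradSq w x ∂muB)
          + 72 * ∫ x, wt ρ 2 x * w x ^ 2 ∂muB) ^ 3) * ∫ x, wt ρ 2 x * w x ^ 2 ∂muB) := by
        refine mul_le_mul (by gcongr) (s3.trans (by gcongr)) (sq_nonneg _) (sq_nonneg _)
    _ = _ := by ring

end IsNormSol

lemma exists_energy_const : ∃ C : ℝ, 0 < C ∧
    ∀ (A c₀ : ℝ) (H : E3 × ℝ → ℝ) (b V : E3 × ℝ → E3), IsNormSol A c₀ H b V →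
      ∀ δ k ρ : ℝ, 0 < δ → δ < 1 → 0 ≤ k → 0 ≤ ρ → ρ ≤ 1 → ∀ t ∈ Ioo (-1 : ℝ) 0,
        ∫ x, wt ρ 6 x * deriv (fun s => tlog δ k (H (x, s)) ^ 2) t ∂muB
          ≤ C * A ^ 2 * (∫ x, wt ρ 2 x * tlog δ k (H (x, t)) ^ 2 ∂muB)
            - ∫ x, wt ρ 6 x * gradSq (fun y => tlog δ k (H (y, t))) x ∂muB := by
  obtain ⟨S, hS0, hS⟩ := exists_sobolev_const
  refine ⟨138 + 12 * 48 ^ 3 * S, by positivity, ?_⟩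
  intro A c₀ H b V h δ k ρ hδ hδ1 hk h0 h1 t ht
  have hps : ContDiff ℝ 2 (fun y => tlog δ k (H (y, t))) :=
    contDiff_slice ((isTest_tlog hδ hk).contDiff_comp h.smooth_H h.pos) t
  have hE := h.energy_sq hδ hδ1 hk h0 h1 ht
  have hT := h.drift_four_le hS0 hS h0 h1 ht (hps.of_le (by norm_num))
  set T := ∫ x, (∑ i, b (x, t) i * x i) * (wt ρ 5 x * tlog δ k (H (x, t)) ^ 2) ∂muB
  set N := ∫ x, wt ρ 2 x * tlog δ k (H (x, t)) ^ 2 ∂muB with hN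
  set G := ∫ x, wt ρ 6 x * gradSq (fun y => tlog δ k (H (y, t))) x ∂muB with hG
  have hN0 : 0 ≤ N := integral_muB_nonneg fun x _ => mul_nonneg (wt_nonneg _ _ _) (sq_nonneg _)
  have hG0 : 0 ≤ G := integral_muB_nonneg fun x _ =>
      mul_nonneg (wt_nonneg _ _ _) (gradSq_nonneg _ _)
  have hA := h.one_le_A
  have hA2 : 1 ≤ A ^ 2 := one_le_pow₀ hA
  have hY := young_four (T := -T) (s := 1 / 48) (by positivity : 0 ≤ 2 * G + 72 * N)
    (by positivity : 0 ≤ A ^ 2 * S * N) (by norm_num) (by rw [Even.neg_pow (by decide)]; exact hT)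
  have hAN : N ≤ A ^ 2 * N := le_mul_of_one_le_left hN0 hA2
  have e : A ^ 2 * S * N / (1 / 48) ^ 3 = 48 ^ 3 * (A ^ 2 * S * N) := by ring
  rw [e] at hY
  nlinarith

/-! ### De Giorgi iteration -/

lemma integral_le_integral_of_subinterval {f : ℝ → ℝ} (hf : Continuous f) {a b c d : ℝ}
    (hab : a ≤ b)
    (hbc : b ≤ c) (hcd : c ≤ d) (h0 : ∀ t ∈ Icc a d, 0 ≤ f t) : ∫ t in b..c, f t ≤ ∫ t in a..d,
        f t := by
  have h1 : ∫ t in a..d, f t = (∫ t in a..b, f t) + (∫ t in b..c, f t) + ∫ t in c..d, f t := by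
    rw [intervalIntegral.integral_add_adjacent_intervals (hf.intervalIntegrable _ _)
      (hf.intervalIntegrable _ _), intervalIntegral.integral_add_adjacent_intervals
      (hf.intervalIntegrable _ _) (hf.intervalIntegrable _ _)]
  have h2 : 0 ≤ ∫ t in a..b, f t := intervalIntegral.integral_nonneg hab fun t ht =>
    h0 t ⟨ht.1, ht.2.trans (hbc.trans hcd)⟩
  have h3 : 0 ≤ ∫ t in c..d, f t := intervalIntegral.integral_nonneg hcd fun t ht =>
    h0 t ⟨(hab.trans hbc).trans ht.1, ht.2⟩
  linarith

lemma integral_cube_four_le {f : E3 → ℝ} (hf : Continuous f) :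
    (∫ x, f x ^ 3 ∂muB) ^ 4 ≤ (∫ x, f x ^ 6 ∂muB) * (∫ x, f x ^ 2 ∂muB) ^ 3 := by
  have h1 := sq_integral_mul_le (by fun_prop : Continuous fun x => f x ^ 2) hf
  have h2 := sq_integral_mul_le (by fun_prop : Continuous fun x => f x ^ 3) hf
  have e1 : (fun x => f x ^ 2 * f x) = fun x => f x ^ 3 := by funext x; ring
  have e2 : (fun x => (f x ^ 2) ^ 2) = fun x => f x ^ 4 := by funext x; ring
  have e3 : (fun x => f x ^ 3 * f x) = fun x => f x ^ 4 := by funext x; ring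
  have e4 : (fun x => (f x ^ 3) ^ 2) = fun x => f x ^ 6 := by funext x; ring
  rw [e1, e2] at h1
  rw [e3, e4] at h2
  have h3 : 0 ≤ ∫ x, f x ^ 2 ∂muB := integral_muB_nonneg fun x _ => sq_nonneg _
  calc (∫ x, f x ^ 3 ∂muB) ^ 4 = ((∫ x, f x ^ 3 ∂muB) ^ 2) ^ 2 := by ring
    _ ≤ ((∫ x, f x ^ 4 ∂muB) * ∫ x, f x ^ 2 ∂muB) ^ 2 := by gcongr
    _ = (∫ x, f x ^ 4 ∂muB) ^ 2 * (∫ x, f x ^ 2 ∂muB) ^ 2 := mul_pow _ _ _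
    _ ≤ ((∫ x, f x ^ 6 ∂muB) * ∫ x, f x ^ 2 ∂muB) * (∫ x, f x ^ 2 ∂muB) ^ 2 := by gcongr
    _ = _ := by ring

lemma tlog_sq_mul_le {δ k k' s : ℝ} (hk : k ≤ k') :
    tlog δ k' s ^ 2 * lam (k' - k) ≤ tlog δ k s ^ 3 := by
  unfold tlog
  rcases le_or_gt (log δ - log s - k') 0 with h | h
  · rw [lam_of_nonpos h]
    have := lam_nonneg (log δ - log s - k)
    simp only [ne_eq, OfNat.ofNat_ne_zero, not_false_eq_true, zero_pow, zero_mul]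
    positivity
  · have h1 : lam (log δ - log s - k') ≤ lam (log δ - log s - k) := lam_monotone (by linarith)
    have h2 : lam (k' - k) ≤ lam (log δ - log s - k) := lam_monotone (by linarith)
    have h3 := lam_nonneg (log δ - log s - k')
    have h4 := lam_nonneg (k' - k)
    calc _ ≤ lam (log δ - log s - k) ^ 2 * lam (log δ - log s - k) := by gcongr
      _ = _ := by ring

lemma wt_mul_tlog_sq_le {δ k k' s ρ ρ' : ℝ} (hk : k ≤ k') (h0 : 0 ≤ ρ') (hρ : ρ' ≤ ρ) (h1 : ρ ≤ 1)
    (x : E3) :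
    wt ρ' 2 x * tlog δ k' s ^ 2 * (lam (k' - k) * (ρ ^ 2 - ρ' ^ 2) ^ 9)
      ≤ (wt ρ 3 x * tlog δ k s) ^ 3 := by
  have hw : 0 ≤ tlog δ k s := lam_nonneg _
  have hq := wt_nonneg ρ 3 x
  rcases le_or_gt ρ' ‖x‖ with h | h
  · rw [wt_eq_zero two_ne_zero h0 h]
    simp only [zero_mul]
    positivity
  · have h2 := tlog_sq_mul_le (δ := δ) (s := s) hk
    have h3 : wt ρ' 2 x ≤ 1 := wt_le_one h0 (hρ.trans h1) x
    have hd : 0 ≤ ρ ^ 2 - ρ' ^ 2 := by nlinarith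
    have h4 : (ρ ^ 2 - ρ' ^ 2) ^ 9 ≤ wt ρ 9 x := by
      unfold wt
      have : ρ ^ 2 - ρ' ^ 2 ≤ max (ρ ^ 2 - ‖x‖ ^ 2) 0 := by
        refine le_max_of_le_left ?_
        nlinarith [norm_nonneg x]
      gcongr
    have h5 := lam_nonneg (k' - k)
    have h6 := wt_nonneg ρ' 2 x
    calc _ = wt ρ' 2 x * (ρ ^ 2 - ρ' ^ 2) ^ 9 * (tlog δ k' s ^ 2 * lam (k' - k)) := by ring
      _ ≤ 1 * wt ρ 9 x * tlog δ k s ^ 3 := by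
          have h7 : 0 ≤ 1 * wt ρ 9 x := mul_nonneg zero_le_one (wt_nonneg ρ 9 x)
          gcongr
      _ = _ := by rw [mul_pow, wt_pow]; ring

/-- The weighted square norm of the truncated logarithm. -/
def lnorm (δ k ρ : ℝ) (H : E3 × ℝ → ℝ) (t : ℝ) : ℝ :=
  ∫ x, wt ρ 2 x * tlog δ k (H (x, t)) ^ 2 ∂muB

lemma lnorm_nonneg (δ k ρ : ℝ) (H : E3 × ℝ → ℝ) (t : ℝ) : 0 ≤ lnorm δ k ρ H t :=
  integral_muB_nonneg fun _ _ => mul_nonneg (wt_nonneg _ _ _) (sq_nonneg _)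

lemma IsNormSol.continuous_tlog {A c₀ : ℝ} {H : E3 × ℝ → ℝ} {b V : E3 × ℝ → E3}
    (h : IsNormSol A c₀ H b V) (δ k : ℝ) : Continuous (fun z => tlog δ k (H z)) :=
  contDiff_lam.continuous.comp (((continuous_const.sub
    (h.smooth_H.continuous.log fun z => (h.pos z).ne')).sub continuous_const))

lemma IsNormSol.continuous_lnorm {A c₀ : ℝ} {H : E3 × ℝ → ℝ} {b V : E3 × ℝ → E3}
    (h : IsNormSol A c₀ H b V) (δ k ρ : ℝ) : Continuous (lnorm δ k ρ H) :=
  continuous_integral_muB (f := fun z => wt ρ 2 z.1 * tlog δ k (H z) ^ 2)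
    (((continuous_wt ρ 2).comp continuous_fst).mul ((h.continuous_tlog δ k).pow 2))

lemma exists_step_const : ∃ B : ℝ, 0 < B ∧
    ∀ (A c₀ : ℝ) (H : E3 × ℝ → ℝ) (b V : E3 × ℝ → E3), IsNormSol A c₀ H b V →
      ∀ δ k k' ρ ρ' t₀ t₁ z : ℝ, 0 < δ → δ < 1 → 0 ≤ k → k < k' → 0 ≤ ρ' → ρ' < ρ → ρ ≤ 1 →
        -1 ≤ t₀ → t₀ < t₁ → t₁ ≤ 0 → 0 < z →
        B * A ^ 2 * (∫ t in t₀..0, lnorm δ k ρ H t) / (t₁ - t₀) ≤ z ^ 2 →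
        ∫ t in t₁..0, lnorm δ k' ρ' H t ≤ B * z ^ 3 / (lam (k' - k) * (ρ ^ 2 - ρ' ^ 2) ^ 9) := by
  obtain ⟨S, hS0, hS⟩ := exists_sobolev_const
  obtain ⟨C, hC0, hC⟩ := exists_energy_const
  refine ⟨1 + C + 74 + S, by positivity, ?_⟩
  intro A c₀ H b V h δ k k' ρ ρ' t₀ t₁ z hδ hδ1 hk hkk h0 hρ h1 ht0 ht01 ht1 hz hY
  have hA := h.one_le_A
  have hA2 : 1 ≤ A ^ 2 := one_le_pow₀ hA
  have hρ0 : 0 ≤ ρ := h0.trans hρ.le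
  have hΨ := isTest_tlog hδ hk
  have hp2 := hΨ.contDiff_comp h.smooth_H h.pos
  have hp1 : ContDiff ℝ 1 (fun z => tlog δ k (H z)) := hp2.of_le (by norm_num)
  have hq1 : ContDiff ℝ 1 (fun z => tlog δ k (H z) ^ 2) := hp1.pow 2
  set N : ℝ → ℝ := lnorm δ k ρ H with hN
  set E : ℝ → ℝ := fun t => ∫ x, wt ρ 6 x * tlog δ k (H (x, t)) ^ 2 ∂muB with hE
  set G : ℝ → ℝ := fun t => ∫ x, wt ρ 6 x * gradSq (fun y => tlog δ k (H (y, t))) x ∂muB with hG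
  have hN0 : ∀ t, 0 ≤ N t := lnorm_nonneg δ k ρ H
  have hE0 : ∀ t, 0 ≤ E t := fun t =>
    integral_muB_nonneg fun x _ => mul_nonneg (wt_nonneg _ _ _) (sq_nonneg _)
  have hG0 : ∀ t, 0 ≤ G t := fun t =>
    integral_muB_nonneg fun x _ => mul_nonneg (wt_nonneg _ _ _) (gradSq_nonneg _ _)
  have hNc : Continuous N := h.continuous_lnorm δ k ρ
  have hGc : Continuous G :=
    continuous_integral_muB (f := fun z => wt ρ 6 z.1 * gradSq (fun y => tlog δ k (H (y, z.2))) z.1)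
      (((continuous_wt ρ 6).comp continuous_fst).mul (continuous_gradSq_slice hp1))
  have hsl : ∀ t, ContDiff ℝ 1 (fun y => tlog δ k (H (y, t))) := fun t => contDiff_slice hp1 t
  have hEN : ∀ t, E t ≤ N t := by
    intro t
    have hc := (hsl t).continuous
    refine integral_muB_mono ((continuous_wt ρ 6).mul (hc.pow 2))
        ((continuous_wt ρ 2).mul (hc.pow 2))
      fun x _ => ?_
    exact mul_le_mul_of_nonneg_right (wt_le_wt hρ0 h1 (by norm_num) x) (sq_nonneg _)
  have hE' := fun t => hasDerivAt_integral_weight hq1 (contDiff_wt_one ρ (m := 6) (by norm_num)) t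
  set Y := ∫ t in t₀..0, N t with hYdef
  have hY0 : 0 ≤ Y := intervalIntegral.integral_nonneg (by linarith) fun t _ => hN0 t
  have hmain : ∀ s ∈ Icc t₀ 0,
      (s - t₀) * E s ≤ (1 + C * A ^ 2) * Y - ∫ t in t₀..s, (t - t₀) * G t := by
    intro s hs
    have hf : ∀ t, HasDerivAt (fun t => (t - t₀) * E t) _ t := fun t =>
      ((hasDerivAt_id t).sub_const t₀).mul (hE' t)
    have h2 := sub_le_integral_of_deriv_le hs.1 hf
      (φ := fun t => (1 + C * A ^ 2) * N t - (t - t₀) * G t) (by fun_prop) fun t ht => by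
        have hd := hC A c₀ H b V h δ k ρ hδ hδ1 hk hρ0 h1 t
          ⟨by linarith [ht.1], by linarith [ht.2, hs.2]⟩
        have hd2 := mul_le_mul_of_nonneg_left hd (by linarith [ht.1] : 0 ≤ t - t₀)
        have h3 : (t - t₀) * (C * A ^ 2 * N t) ≤ C * A ^ 2 * N t :=
          mul_le_of_le_one_left (mul_nonneg (by positivity) (hN0 t)) (by linarith [ht.2, hs.2])
        have h4 := hEN t
        rw [one_mul]
        change E t + _ ≤ _
        change _ ≤ (t - t₀) * (C * A ^ 2 * N t - G t) at hd2
        simp only [id]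
        linarith
    rw [intervalIntegral.integral_sub ((hNc.const_mul _).intervalIntegrable _ _)
      ((by fun_prop : Continuous fun t => (t - t₀) * G t).intervalIntegrable _ _),
      intervalIntegral.integral_const_mul, sub_self, zero_mul, sub_zero] at h2
    have h5 : ∫ t in t₀..s, N t ≤ Y :=
      integral_le_integral_of_subinterval hNc le_rfl hs.1 hs.2 fun t _ => hN0 t
    have h6 : (1 + C * A ^ 2) * ∫ t in t₀..s, N t ≤ (1 + C * A ^ 2) * Y := by gcongr
    linarith
  have hY2 : (1 + C * A ^ 2) * Y ≤ z ^ 2 * (t₁ - t₀) := by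
    rw [div_le_iff₀ (by linarith)] at hY
    refine le_trans ?_ hY
    gcongr
    nlinarith
  have hYz : Y ≤ z ^ 2 := by
    have h2 : Y ≤ (1 + C * A ^ 2) * Y := le_mul_of_one_le_left hY0 (by nlinarith)
    have h3 : z ^ 2 * (t₁ - t₀) ≤ z ^ 2 := mul_le_of_le_one_right (sq_nonneg _) (by linarith)
    linarith
  have hEz : ∀ s ∈ Icc t₁ 0, E s ≤ z ^ 2 := by
    intro s hs
    have h2 := hmain s ⟨by linarith [hs.1], hs.2⟩
    have h3 : 0 ≤ ∫ t in t₀..s, (t - t₀) * G t :=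
      intervalIntegral.integral_nonneg (by linarith [hs.1]) fun t ht =>
        mul_nonneg (by linarith [ht.1]) (hG0 t)
    have h4 : (t₁ - t₀) * E s ≤ (s - t₀) * E s :=
      mul_le_mul_of_nonneg_right (by linarith [hs.1]) (hE0 s)
    have h5 : (t₁ - t₀) * E s ≤ (t₁ - t₀) * z ^ 2 := by linarith
    exact le_of_mul_le_mul_left h5 (by linarith)
  have hGz : ∫ t in t₁..0, G t ≤ z ^ 2 := by
    have h2 := hmain 0 ⟨by linarith, le_rfl⟩
    have h3 : 0 ≤ (0 - t₀) * E 0 := mul_nonneg (by linarith) (hE0 0)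
    have h4 : ∫ t in t₁..0, (t - t₀) * G t ≤ ∫ t in t₀..0, (t - t₀) * G t :=
      integral_le_integral_of_subinterval (by fun_prop) ht01.le ht1 le_rfl fun t ht =>
        mul_nonneg (by linarith [ht.1]) (hG0 t)
    have h5 : ∫ t in t₁..0, (t₁ - t₀) * G t ≤ ∫ t in t₁..0, (t - t₀) * G t :=
      intervalIntegral.integral_mono_on ht1 ((hGc.const_mul _).intervalIntegrable _ _)
        ((by fun_prop : Continuous fun t => (t - t₀) * G t).intervalIntegrable _ _) fun t ht =>
        mul_le_mul_of_nonneg_right (by linarith [ht.1]) (hG0 t)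
    rw [intervalIntegral.integral_const_mul] at h5
    have h6 : (t₁ - t₀) * ∫ t in t₁..0, G t ≤ (t₁ - t₀) * z ^ 2 := by linarith
    exact le_of_mul_le_mul_left h6 (by linarith)
  have hNz : ∫ t in t₁..0, N t ≤ z ^ 2 :=
    (integral_le_integral_of_subinterval hNc ht01.le ht1 le_rfl fun t _ => hN0 t).trans hYz
  have hg : 0 < lam (k' - k) * (ρ ^ 2 - ρ' ^ 2) ^ 9 := by
    have h2 := lam_pos (sub_pos.2 hkk)
    have h3 : 0 < ρ ^ 2 - ρ' ^ 2 := by nlinarith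
    positivity
  set g := lam (k' - k) * (ρ ^ 2 - ρ' ^ 2) ^ 9 with hgdef
  have hpt : ∀ t ∈ Icc t₁ 0, lnorm δ k' ρ' H t * g ≤ z * (2 * G t + 72 * N t) + S * z ^ 3 := by
    intro t ht
    have hc := (hsl t).continuous
    have hc' : Continuous (fun x => tlog δ k' (H (x, t))) :=
      (h.continuous_tlog δ k').comp (by fun_prop)
    have h2 : lnorm δ k' ρ' H t * g ≤ ∫ x, (wt ρ 3 x * tlog δ k (H (x, t))) ^ 3 ∂muB := by
      unfold lnorm
      rw [← integral_mul_const]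
      exact integral_muB_mono (by fun_prop) (by fun_prop) fun x _ =>
        wt_mul_tlog_sq_le hkk.le h0 hρ.le h1 x
    refine h2.trans ?_
    have h3 := integral_cube_four_le (by fun_prop : Continuous fun x =>
        wt ρ 3 x * tlog δ k (H (x, t)))
    have h4 := integral_six_le hS0 hS hρ0 h1 (hsl t)
    have e2 : ∫ x, (wt ρ 3 x * tlog δ k (H (x, t))) ^ 2 ∂muB = E t := by
      simp only [hE]
      congr 1; funext x
      rw [mul_pow, wt_pow]
    rw [e2] at h3
    change _ ≤ S * (2 * G t + 72 * N t) ^ 3 at h4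
    have hX : 0 ≤ 2 * G t + 72 * N t := by linarith [hG0 t, hN0 t]
    have h5 := young_four hX (mul_nonneg hS0.le (pow_nonneg (hE0 t) 3)) hz
      (h3.trans (mul_le_mul_of_nonneg_right h4 (pow_nonneg (hE0 t) 3)))
    refine h5.trans ?_
    have h6 : E t ^ 3 ≤ (z ^ 2) ^ 3 := by
      have := hEz t ht
      have := hE0 t
      gcongr
    have h7 : S * E t ^ 3 / z ^ 3 ≤ S * z ^ 3 := by
      rw [div_le_iff₀ (by positivity)]
      calc S * E t ^ 3 ≤ S * (z ^ 2) ^ 3 := by gcongr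
        _ = _ := by ring
    linarith
  rw [le_div_iff₀ hg, ← intervalIntegral.integral_mul_const]
  have hc := h.continuous_lnorm δ k' ρ'
  have hR : Continuous fun t => z * (2 * G t + 72 * N t) + S * z ^ 3 := by fun_prop
  calc ∫ t in t₁..0, lnorm δ k' ρ' H t * g
      ≤ ∫ t in t₁..0, (z * (2 * G t + 72 * N t) + S * z ^ 3) :=
        intervalIntegral.integral_mono_on ht1 ((hc.mul_const _).intervalIntegrable _ _)
          (hR.intervalIntegrable _ _) hpt
    _ = z * (2 * (∫ t in t₁..0, G t) + 72 * ∫ t in t₁..0, N t) + (0 - t₁) * (S * z ^ 3) := by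
        rw [intervalIntegral.integral_add
          ((by fun_prop : Continuous fun t => z * (2 * G t + 72 * N t)).intervalIntegrable _ _)
          (continuous_const.intervalIntegrable _ _), intervalIntegral.integral_const, smul_eq_mul,
          intervalIntegral.integral_const_mul, intervalIntegral.integral_add
          ((hGc.const_mul _).intervalIntegrable _ _) ((hNc.const_mul _).intervalIntegrable _ _),
          intervalIntegral.integral_const_mul, intervalIntegral.integral_const_mul]
    _ ≤ z * (2 * z ^ 2 + 72 * z ^ 2) + 1 * (S * z ^ 3) := by
        gcongr
        linarith
    _ ≤ (1 + C + 74 + S) * z ^ 3 := by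
        have : 0 ≤ (1 + C) * z ^ 3 := by positivity
        linarith

lemma eq_zero_of_integral_muB_eq_zero {f : E3 → ℝ} (hf : Continuous f) (h0 : ∀ x, 0 ≤ f x)
    (h : ∫ x, f x ∂muB = 0) {x : E3} (hx : ‖x‖ < 1) : f x = 0 := by
  have h1 := (integral_eq_zero_iff_of_nonneg h0 hf.integrable_muB).1 h
  have h2 : f =ᵐ[volume.restrict (Metric.ball (0 : E3) 1)] fun _ => 0 :=
    ae_restrict_of_ae_restrict_of_subset Metric.ball_subset_closedBall h1
  exact Measure.eqOn_open_of_ae_eq h2 Metric.isOpen_ball hf.continuousOn continuousOn_const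
    (mem_ball_zero_iff.2 hx)

lemma lnorm_le_lnorm {A c₀ : ℝ} {H : E3 × ℝ → ℝ} {b V : E3 × ℝ → E3}
    (h : IsNormSol A c₀ H b V) {δ k k' ρ ρ' : ℝ} (hk : k ≤ k') (h0 : 0 ≤ ρ') (hρ : ρ' ≤ ρ) (t : ℝ) :
    lnorm δ k' ρ' H t ≤ lnorm δ k ρ H t := by
  have hc : ∀ k ρ, Continuous fun x => wt ρ 2 x * tlog δ k (H (x, t)) ^ 2 := fun k ρ =>
    (continuous_wt ρ 2).mul (((h.continuous_tlog δ k).comp (by fun_prop : Continuous fun x : E3 =>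
        (x, t))).pow 2)
  refine integral_muB_mono (hc _ _) (hc _ _) fun x _ => ?_
  have h1 : tlog δ k' (H (x, t)) ≤ tlog δ k (H (x, t)) := lam_monotone (by linarith)
  have h2 : 0 ≤ tlog δ k' (H (x, t)) := lam_nonneg _
  have h3 : wt ρ' 2 x ≤ wt ρ 2 x := by
    unfold wt
    gcongr
  have h4 := wt_nonneg ρ' 2 x
  gcongr
  exact h4.trans h3

lemma integral_lnorm_mono {A c₀ : ℝ} {H : E3 × ℝ → ℝ} {b V : E3 × ℝ → E3}
    (h : IsNormSol A c₀ H b V) {δ k k' ρ ρ' t₀ t₁ : ℝ} (hk : k ≤ k') (h0 : 0 ≤ ρ') (hρ : ρ' ≤ ρ)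
    (ht : t₀ ≤ t₁) (ht1 : t₁ ≤ 0) :
    ∫ t in t₁..0, lnorm δ k' ρ' H t ≤ ∫ t in t₀..0, lnorm δ k ρ H t :=
  (intervalIntegral.integral_mono_on ht1 ((h.continuous_lnorm δ k' ρ').intervalIntegrable _ _)
      ((h.continuous_lnorm δ k ρ).intervalIntegrable _ _)
      fun t _ => lnorm_le_lnorm h hk h0 hρ t).trans
    (integral_le_integral_of_subinterval (h.continuous_lnorm δ k ρ) ht ht1 le_rfl
      fun t _ => lnorm_nonneg _ _ _ _ _)

/-- Vanishing of the localized norm of the truncated logarithm gives a pointwise lower bound. -/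
lemma lower_bound_of_integral_lnorm {A c₀ : ℝ} {H : E3 × ℝ → ℝ} {b V : E3 × ℝ → E3}
    (h : IsNormSol A c₀ H b V) {δ L ρ T : ℝ} (hδ : 0 < δ) (hρ1 : ρ ≤ 1) (hT : T < 0)
    (hI : ∫ t in T..0, lnorm δ L ρ H t ≤ 0) {x : E3} {t : ℝ} (hx : ‖x‖ < ρ) (ht : t ∈ Ioo T 0) :
    δ * exp (-L) ≤ H (x, t) := by
  have hz : lnorm δ L ρ H t = 0 := by
    by_contra hne
    have hpos : 0 < lnorm δ L ρ H t := lt_of_le_of_ne (lnorm_nonneg _ _ _ _ _) (Ne.symm hne)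
    exact absurd (intervalIntegral.integral_pos hT (h.continuous_lnorm δ L ρ).continuousOn
      (fun s _ => lnorm_nonneg _ _ _ _ _) ⟨t, ⟨ht.1.le, ht.2.le⟩, hpos⟩) (not_lt.2 hI)
  have hc : Continuous fun x => wt ρ 2 x * tlog δ L (H (x, t)) ^ 2 :=
    (continuous_wt ρ 2).mul (((h.continuous_tlog δ L).comp (by fun_prop : Continuous fun x : E3 =>
        (x, t))).pow 2)
  have h1 := eq_zero_of_integral_muB_eq_zero hc
    (fun x => mul_nonneg (wt_nonneg _ _ _) (sq_nonneg _)) hz (hx.trans_le hρ1)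
  have h2 : 0 < wt ρ 2 x := by
    unfold wt
    have : 0 < ρ ^ 2 - ‖x‖ ^ 2 := by nlinarith [norm_nonneg x]
    rw [max_eq_left this.le]
    positivity
  have h3 : tlog δ L (H (x, t)) = 0 := by
    rcases mul_eq_zero.1 h1 with h1 | h1
    · exact absurd h1 h2.ne'
    · exact pow_eq_zero_iff two_ne_zero |>.1 h1
  have h4 : log δ - log (H (x, t)) - L ≤ 0 := by
    by_contra hne
    exact absurd h3 (lam_pos (not_le.1 hne)).ne'
  have h5 : log (δ * exp (-L)) ≤ log (H (x, t)) := by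
    rw [log_mul hδ.ne' (exp_pos _).ne', log_exp]; linarith
  exact (log_le_log_iff (by positivity) (h.pos _)).1 h5

lemma exists_exp_const : ∃ c C : ℝ, 0 < c ∧ 0 < C ∧
    ∀ (A c₀ : ℝ) (H : E3 × ℝ → ℝ) (b V : E3 × ℝ → E3), IsNormSol A c₀ H b V →
      ∀ (x : E3) (t : ℝ), ‖x‖ < 1 / 4 → t ∈ Ioo (-1 / 16 : ℝ) 0 →
        c / A * exp (-(C * A ^ 4)) ≤ H (x, t) := by
  obtain ⟨c, C, hc0, hc1, hC0, hC⟩ := exists_log_const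
  obtain ⟨B, hB0, hB⟩ := exists_step_const
  obtain ⟨D, hD0, hDB⟩ : ∃ D : ℝ, 0 < D ∧ 16 * B ≤ D ^ 2 :=
    ⟨√(16 * B), by positivity, (sq_sqrt (by positivity)).ge⟩
  obtain ⟨s, hs0, hsC⟩ : ∃ s : ℝ, 0 < s ∧ C ≤ s ^ 2 :=
    ⟨√C, by positivity, (sq_sqrt (by positivity)).ge⟩
  refine ⟨c, B * D ^ 3 * s * 2 ^ 71 + 1, hc0, by positivity, ?_⟩
  intro A c₀ H b V h x t hx ht
  have hA := h.one_le_A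
  have hA0 : 0 < A := by linarith
  have hA4 : 1 ≤ A ^ 4 := one_le_pow₀ hA
  obtain ⟨L, hL⟩ : ∃ L, L = (B * D ^ 3 * s * 2 ^ 71 + 1) * A ^ 4 := ⟨_, rfl⟩
  rw [← hL]
  have hL1 : 1 ≤ L := by
    have : 0 ≤ B * D ^ 3 * s * 2 ^ 71 * A ^ 4 := by positivity
    rw [hL]; linarith
  have hL2 : B * D ^ 3 * s * 2 ^ 71 * A ^ 4 ≤ L := by rw [hL]; linarith
  have hCH := hC A c₀ H b V h
  have hδ : 0 < c / A := by positivity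
  have hδ1 : c / A < 1 := by rw [div_lt_one hA0]; linarith
  generalize c / A = δ at hCH hδ hδ1 ⊢
  clear hL hC
  have key : ∀ j : ℕ, ∫ t in (-1 / 16 - 3 / 16 * (1 / 2 : ℝ) ^ j)..0,
      lnorm δ (L * (1 - (1 / 2 : ℝ) ^ j)) (1 / 4 + (1 / 2 : ℝ) ^ j / 4) H t
        ≤ (s * A * ((1 / 2 : ℝ) ^ j) ^ 15) ^ 2 := by
    intro j
    clear hx ht
    induction j with
    | zero =>
      have e1 : (-1 / 16 - 3 / 16 * (1 / 2 : ℝ) ^ 0) = -1 / 4 := by norm_num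
      have e2 : L * (1 - (1 / 2 : ℝ) ^ 0) = 0 := by norm_num
      have e3 : (1 / 4 + (1 / 2 : ℝ) ^ 0 / 4) = 1 / 2 := by norm_num
      have e4 : (s * A * ((1 / 2 : ℝ) ^ 0) ^ 15) ^ 2 = s ^ 2 * A ^ 2 := by ring
      rw [e1, e2, e3, e4]
      refine le_trans ?_ (hCH.trans (by gcongr))
      have ci : Continuous fun z : E3 × ℝ => wt 1 3 z.1 * tlog δ 0 (H z) ^ 2 :=
        ((continuous_wt 1 3).comp continuous_fst).mul ((h.continuous_tlog δ 0).pow 2)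
      refine intervalIntegral.integral_mono_on (by norm_num)
        ((h.continuous_lnorm δ 0 (1 / 2)).intervalIntegrable _ _)
        ((continuous_integral_muB ci).intervalIntegrable _ _) fun t _ => ?_
      have hc : ∀ ρ n, Continuous fun x => wt ρ n x * tlog δ 0 (H (x, t)) ^ 2 := fun ρ n =>
        (continuous_wt ρ n).mul (((h.continuous_tlog δ 0).comp
          (by fun_prop : Continuous fun x : E3 => (x, t))).pow 2)
      refine integral_muB_mono (hc _ _) (hc _ _) fun x hx => ?_
      refine mul_le_mul_of_nonneg_right ?_ (sq_nonneg _)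
      unfold wt
      rw [max_eq_left (by nlinarith [norm_nonneg x] : 0 ≤ 1 ^ 2 - ‖x‖ ^ 2)]
      rcases le_total ((1 / 2 : ℝ) ^ 2 - ‖x‖ ^ 2) 0 with h1 | h1
      · rw [max_eq_right h1]
        rw [zero_pow two_ne_zero]
        exact pow_nonneg (by nlinarith [norm_nonneg x]) 3
      · rw [max_eq_left h1]
        nlinarith [sq_nonneg ‖x‖, mul_nonneg h1 h1, mul_nonneg (sq_nonneg ‖x‖) h1,
          mul_nonneg (mul_nonneg h1 h1) h1]
    | succ j ih =>
      set p : ℝ := (1 / 2 : ℝ) ^ j with hp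
      have hp0 : 0 < p := by positivity
      have hp1 : p ≤ 1 := pow_le_one₀ (by norm_num) (by norm_num)
      have e : (1 / 2 : ℝ) ^ (j + 1) = p / 2 := by rw [pow_succ]; ring
      rw [e]
      have hz : 0 < D * A * (s * A) * p ^ 14 := by positivity
      have hstep := hB A c₀ H b V h δ (L * (1 - p)) (L * (1 - p / 2)) (1 / 4 + p / 4)
        (1 / 4 + p / 2 / 4) (-1 / 16 - 3 / 16 * p) (-1 / 16 - 3 / 16 * (p / 2))
        (D * A * (s * A) * p ^ 14) hδ hδ1 (mul_nonneg (by linarith) (by linarith))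
        (by nlinarith) (by positivity) (by linarith) (by linarith) (by linarith) (by linarith)
        (by linarith) hz ?_
      · refine hstep.trans ?_
        have hl : L * (p / 2) ^ 3 / 4 ≤ lam (L * (1 - p / 2) - L * (1 - p)) := by
          have := lam_lower hL1 (by positivity : 0 < p / 2) (by linarith)
          refine this.trans (le_of_eq ?_)
          congr 1; ring
        have hd : p / 16 ≤ (1 / 4 + p / 4) ^ 2 - (1 / 4 + p / 2 / 4) ^ 2 := by nlinarith
        have hLp : 0 < L * (p / 2) ^ 3 / 4 := by positivity
        calc _ ≤ B * (D * A * (s * A) * p ^ 14) ^ 3 / (L * (p / 2) ^ 3 / 4 * (p / 16) ^ 9) := by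
              have hl0 := lam_nonneg (L * (1 - p / 2) - L * (1 - p))
              gcongr
          _ ≤ _ := by
            rw [div_le_iff₀ (by positivity)]
            have e1 : B * (D * A * (s * A) * p ^ 14) ^ 3
                = (B * D ^ 3 * s * 2 ^ 71 * A ^ 4) * (s ^ 2 * A ^ 2 * p ^ 42 / 2 ^ 71) := by ring
            have e2 : (s * A * (p / 2) ^ 15) ^ 2 * (L * (p / 2) ^ 3 / 4 * (p / 16) ^ 9)
                = L * (s ^ 2 * A ^ 2 * p ^ 42 / 2 ^ 71) := by ring
            rw [e1, e2]
            gcongr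
      · rw [div_le_iff₀ (by linarith)]
        calc _ ≤ B * A ^ 2 * (s * A * p ^ 15) ^ 2 := by gcongr
          _ = 16 * B * (A ^ 4 * s ^ 2 * p ^ 28 * (p ^ 2 / 16)) := by ring
          _ ≤ D ^ 2 * (A ^ 4 * s ^ 2 * p ^ 28 *
            (-1 / 16 - 3 / 16 * (p / 2) - (-1 / 16 - 3 / 16 * p))) := by
            gcongr
            nlinarith
          _ = _ := by ring
  have hI : ∫ t in (-1 / 16 : ℝ)..0, lnorm δ L (1 / 4) H t ≤ 0 := by
    have hlim : Filter.Tendsto (fun j : ℕ => (s * A * ((1 / 2 : ℝ) ^ j) ^ 15) ^ 2) Filter.atTop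
        (nhds 0) := by
      have := ((((tendsto_pow_atTop_nhds_zero_of_lt_one (by norm_num : (0 : ℝ) ≤ 1 / 2)
        (by norm_num)).pow 15).const_mul (s * A)).pow 2)
      simpa using this
    refine ge_of_tendsto' hlim fun j => le_trans ?_ (key j)
    have hp0 : 0 < (1 / 2 : ℝ) ^ j := by positivity
    exact integral_lnorm_mono h (mul_le_of_le_one_right (by linarith) (by linarith)) (by norm_num)
        (by linarith) (by linarith)
      (by norm_num)
  exact lower_bound_of_integral_lnorm h hδ (by norm_num) (by norm_num) hI hx ht

/-! ### Consequences of axial symmetry -/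

/-- Rotation by the angle `s` about the `x₃`-axis. -/
def rotz (x : E3) (s : ℝ) : E3 :=
  cos s • (x 0 • ee 0 + x 1 • ee 1) + sin s • (x 0 • ee 1 - x 1 • ee 0) + x 2 • ee 2

lemma ee_apply (i j : Fin 3) : ee i j = if j = i then 1 else 0 := by
  simp [ee]

lemma eq_sum_ee (x : E3) : x = x 0 • ee 0 + x 1 • ee 1 + x 2 • ee 2 := by
  ext j
  fin_cases j <;> simp [ee_apply]

lemma rotz_zero (x : E3) (s : ℝ) : rotz x s 0 = cos s * x 0 - sin s * x 1 := by
  simp [rotz, ee_apply]; ring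

lemma rotz_one (x : E3) (s : ℝ) : rotz x s 1 = sin s * x 0 + cos s * x 1 := by
  simp [rotz, ee_apply]; ring

lemma rotz_two (x : E3) (s : ℝ) : rotz x s 2 = x 2 := by
  simp [rotz, ee_apply]

lemma rotz_radius (x : E3) (s : ℝ) : rotz x s 0 ^ 2 + rotz x s 1 ^ 2 = x 0 ^ 2 + x 1 ^ 2 := by
  rw [rotz_zero, rotz_one]
  linear_combination (x 0 ^ 2 + x 1 ^ 2) * sin_sq_add_cos_sq s

lemma norm_rotz (x : E3) (s : ℝ) : ‖rotz x s‖ = ‖x‖ := by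
  have h : ‖rotz x s‖ ^ 2 = ‖x‖ ^ 2 := by
    rw [norm_sq_eq_coords, norm_sq_eq_coords, rotz_radius, rotz_two]
  exact (pow_left_inj₀ (norm_nonneg _) (norm_nonneg _) two_ne_zero).1 h

lemma rotz_at_zero (x : E3) : rotz x 0 = x := by
  conv_rhs => rw [eq_sum_ee x]
  simp [rotz]

lemma hasDerivAt_rotz (x : E3) : HasDerivAt (rotz x) (x 0 • ee 1 - x 1 • ee 0) 0 := by
  have h := (((hasDerivAt_cos 0).smul_const (x 0 • ee 0 + x 1 • ee 1)).add
    ((hasDerivAt_sin 0).smul_const (x 0 • ee 1 - x 1 • ee 0))).add_const (x 2 • ee 2)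
  have e : -sin 0 • (x 0 • ee 0 + x 1 • ee 1) + cos 0 • (x 0 • ee 1 - x 1 • ee 0)
      = x 0 • ee 1 - x 1 • ee 0 := by simp
  rw [e] at h
  exact h

/-- The angular derivative of a function that is linear along the orbit of the rotation. -/
lemma angular_deriv_of_orbit {f : E3 → ℝ} {x : E3} (hf : DifferentiableAt ℝ f x) {p q r : ℝ}
    (h : ∀ s, f (rotz x s) = p * rotz x s 0 + q * rotz x s 1 + r) :
    x 0 * pd f 1 x - x 1 * pd f 0 x = q * x 0 - p * x 1 := by
  have h1 : HasDerivAt (fun s => f (rotz x s)) (fderiv ℝ f x (x 0 • ee 1 - x 1 • ee 0)) 0 := by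
    have hf' : HasFDerivAt f (fderiv ℝ f x) (rotz x 0) := by
      rw [rotz_at_zero]; exact hf.hasFDerivAt
    exact hf'.comp_hasDerivAt 0 (hasDerivAt_rotz x)
  have h2 : HasDerivAt (fun s => f (rotz x s))
      (p * (-sin 0 * x 0 - cos 0 * x 1) + q * (cos 0 * x 0 + -sin 0 * x 1)) 0 := by
    have e : (fun s => f (rotz x s)) = fun s =>
        p * (cos s * x 0 - sin s * x 1) + q * (sin s * x 0 + cos s * x 1) + r := by
      funext s; rw [h, rotz_zero, rotz_one]
    rw [e]
    exact (((((hasDerivAt_cos 0).mul_const _).sub ((hasDerivAt_sin 0).mul_const _)).const_mul p).add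
      ((((hasDerivAt_sin 0).mul_const _).add ((hasDerivAt_cos 0).mul_const _)).const_mul
          q)).add_const r
  have h3 := h1.unique h2
  simp only [map_sub, map_smul, smul_eq_mul, sin_zero, cos_zero] at h3
  unfold pd
  linarith

/-- A continuous function vanishing off the axis vanishes on the axis. -/
lemma eq_zero_of_off_axis {g : E3 → ℝ} {x : E3} (hg : ContinuousAt g x)
    (h : ∀ᶠ y in nhds x, y 0 ^ 2 + y 1 ^ 2 ≠ 0 → g y = 0) : g x = 0 := by
  by_cases hx : x 0 ^ 2 + x 1 ^ 2 = 0
  · have hx0 : x 0 = 0 := by nlinarith [sq_nonneg (x 0), sq_nonneg (x 1)]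
    have hc : Filter.Tendsto (fun s : ℝ => x + s • ee 0) (nhdsWithin 0 {0}ᶜ) (nhds x) := by
      have : ContinuousAt (fun s : ℝ => x + s • ee 0) 0 := by fun_prop
      have h2 := this.tendsto
      simp only [zero_smul, add_zero] at h2
      exact h2.mono_left nhdsWithin_le_nhds
    have h1 := hg.tendsto.comp hc
    have h2 : Filter.Tendsto (g ∘ fun s : ℝ => x + s • ee 0) (nhdsWithin 0 {0}ᶜ) (nhds 0) := by
      refine tendsto_const_nhds.congr' ?_
      filter_upwards [hc.eventually h, self_mem_nhdsWithin] with s hs hs0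
      refine (hs ?_).symm
      have : s ≠ 0 := hs0
      have e0 : (x + s • ee 0) 0 = s := by simp [ee_apply, hx0]
      rw [e0]
      positivity
    exact tendsto_nhds_unique h1 h2
  · exact h.self_of_nhds hx

lemma continuousAt_pd {f : E3 → ℝ} {x : E3} (hf : ContDiffAt ℝ (⊤ : ℕ∞) f x) (i : Fin 3) :
    ContinuousAt (pd f i) x := by
  have h1 : ContDiffAt ℝ 0 (fderiv ℝ f) x := hf.fderiv_right (by norm_cast)
  exact (h1.clm_apply contDiffAt_const).continuousAt

lemma isOpen_Qyl (z : E3 × ℝ) (R : ℝ) : IsOpen (Qyl z R) := Metric.isOpen_ball.prod isOpen_Ioo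

lemma mem_Qyl_zero {R : ℝ} {x : E3} {t : ℝ} :
    (x, t) ∈ Qyl (0, 0) R ↔ ‖x‖ < R ∧ -R ^ 2 < t ∧ t < 0 := by
  simp [Qyl]

lemma IsNSQ1.mem_U {u : E3 → ℝ → E3} {P : E3 → ℝ → ℝ} {U : Set (E3 × ℝ)} (h : IsNSQ1 u P U)
    {z : E3 × ℝ} (hz : z ∈ Qyl (0, 0) 1) : z ∈ U := h.subset_U (subset_closure hz)

lemma IsNSQ1.contDiffAt_u {u : E3 → ℝ → E3} {P : E3 → ℝ → ℝ} {U : Set (E3 × ℝ)}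
    (h : IsNSQ1 u P U) {x : E3} {t : ℝ} (hx : (x, t) ∈ U) (j : Fin 3) :
    ContDiffAt ℝ (⊤ : ℕ∞) (fun y => u y t j) x := by
  have h1 : ContDiffAt ℝ (⊤ : ℕ∞) (fun z : E3 × ℝ => u z.1 z.2) (x, t) :=
    h.smooth_u.contDiffAt (h.open_U.mem_nhds hx)
  have h2 : ContDiffAt ℝ (⊤ : ℕ∞) (fun y : E3 => u y t) x :=
    ContDiffAt.comp (f := fun y : E3 => (y, t)) (g := fun z : E3 × ℝ => u z.1 z.2) x h1
      (contDiff_id.prodMk contDiff_const).contDiffAt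
  exact ContDiffAt.comp (f := fun y : E3 => u y t) (g := fun v : E3 => v j) x
    (contDiff_coord j).contDiffAt h2

lemma IsNSQ1.contDiffAt_P {u : E3 → ℝ → E3} {P : E3 → ℝ → ℝ} {U : Set (E3 × ℝ)}
    (h : IsNSQ1 u P U) {x : E3} {t : ℝ} (hx : (x, t) ∈ U) :
    ContDiffAt ℝ (⊤ : ℕ∞) (fun y => P y t) x := by
  have h1 : ContDiffAt ℝ (⊤ : ℕ∞) (fun z : E3 × ℝ => P z.1 z.2) (x, t) :=
    h.smooth_P.contDiffAt (h.open_U.mem_nhds hx)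
  exact ContDiffAt.comp (f := fun y : E3 => (y, t)) (g := fun z : E3 × ℝ => P z.1 z.2) x h1
      (contDiff_id.prodMk contDiff_const).contDiffAt

lemma angular_deriv_of_off_axis {f g : E3 → ℝ → ℝ} {x : E3} {t : ℝ} (hx : (x, t) ∈ Qyl (0, 0) 1)
    (hf : ∀ y, (y, t) ∈ Qyl (0, 0) 1 → ContDiffAt ℝ (⊤ : ℕ∞) (fun y => f y t) y)
    (hg : ContinuousAt (fun y => g y t) x)
    (h : ∀ y, (y, t) ∈ Qyl (0, 0) 1 → y 0 ^ 2 + y 1 ^ 2 ≠ 0 →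
      ∃ p q r : ℝ, (∀ s, f (rotz y s) t = p * rotz y s 0 + q * rotz y s 1 + r) ∧
        q * y 0 - p * y 1 = g y t) :
    x 0 * pd (fun y => f y t) 1 x - x 1 * pd (fun y => f y t) 0 x = g x t := by
  have h0 : ContinuousAt (fun y : E3 => y 0 * pd (fun y => f y t) 1 y
      - y 1 * pd (fun y => f y t) 0 y - g y t) x :=
    (((continuous_coord 0).continuousAt.mul (continuousAt_pd (hf x hx) 1)).sub
      ((continuous_coord 1).continuousAt.mul (continuousAt_pd (hf x hx) 0))).sub hg
  refine sub_eq_zero.1 (eq_zero_of_off_axis h0 ?_)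
  have hn : ∀ᶠ y in nhds x, (y, t) ∈ Qyl (0, 0) 1 :=
    ((by fun_prop : Continuous fun y : E3 => (y, t)).tendsto x).eventually
      ((isOpen_Qyl _ _).mem_nhds hx)
  filter_upwards [hn] with y hy hy0
  obtain ⟨p, q, r, h1, h2⟩ := h y hy hy0
  rw [angular_deriv_of_orbit ((hf y hy).differentiableAt (by simp)) h1, h2, sub_self]

lemma IsAxisym.angular {u : E3 → ℝ → E3} {P : E3 → ℝ → ℝ} {U : Set (E3 × ℝ)}
    (hax : IsAxisym u P U) (h : IsNSQ1 u P U) {x : E3} {t : ℝ} (hx : (x, t) ∈ Qyl (0, 0) 1) :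
    x 0 * pd (fun y => u y t 0) 1 x - x 1 * pd (fun y => u y t 0) 0 x = -u x t 1 ∧
    x 0 * pd (fun y => u y t 1) 1 x - x 1 * pd (fun y => u y t 1) 0 x = u x t 0 ∧
    x 0 * pd (fun y => P y t) 1 x - x 1 * pd (fun y => P y t) 0 x = 0 := by
  obtain ⟨ur, uθ, u3, pp, hu⟩ := hax
  have hrot : ∀ y s, (y, t) ∈ Qyl (0, 0) 1 → (rotz y s, t) ∈ Qyl (0, 0) 1 := by
    intro y s hy
    rw [mem_Qyl_zero] at hy ⊢
    rwa [norm_rotz]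
  have hor : ∀ y, (y, t) ∈ Qyl (0, 0) 1 → y 0 ^ 2 + y 1 ^ 2 ≠ 0 → ∀ s, _ := fun y hy hy0 s =>
    hu (rotz y s) t (h.mem_U (hrot y s hy)) (by rwa [rotz_radius])
  simp only [rotz_radius, rotz_two] at hor
  refine ⟨?_, ?_, ?_⟩
  · refine angular_deriv_of_off_axis (f := fun y t => u y t 0) (g := fun y t => -u y t 1) hx
      (fun y hy => h.contDiffAt_u (h.mem_U hy) 0)
      (h.contDiffAt_u (h.mem_U hx) 1).continuousAt.neg fun y hy hy0 => ?_
    set ρ := √(y 0 ^ 2 + y 1 ^ 2)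
    refine ⟨ur ρ (y 2) t / ρ, -(uθ ρ (y 2) t / ρ), 0, fun s => ?_, ?_⟩
    · simp only
      rw [(hor y hy hy0 s).1]; ring
    · have := (hu y t (h.mem_U hy) hy0).2.1
      simp only
      rw [this]; ring
  · refine angular_deriv_of_off_axis (f := fun y t => u y t 1) (g := fun y t => u y t 0) hx
      (fun y hy => h.contDiffAt_u (h.mem_U hy) 1)
      (h.contDiffAt_u (h.mem_U hx) 0).continuousAt fun y hy hy0 => ?_
    set ρ := √(y 0 ^ 2 + y 1 ^ 2)
    refine ⟨uθ ρ (y 2) t / ρ, ur ρ (y 2) t / ρ, 0, fun s => ?_, ?_⟩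
    · simp only
      rw [(hor y hy hy0 s).2.1]; ring
    · have := (hu y t (h.mem_U hy) hy0).1
      simp only
      rw [this]; ring
  · refine angular_deriv_of_off_axis (f := P) (g := fun y t => 0) hx
      (fun y hy => h.contDiffAt_P (h.mem_U hy)) continuousAt_const fun y hy hy0 => ?_
    refine ⟨0, 0, pp √(y 0 ^ 2 + y 1 ^ 2) (y 2) t, fun s => ?_, by ring⟩
    rw [(hor y hy hy0 s).2.2.2]; ring

/-! ### From swirl flows to normalized solutions -/

/-- The pointwise identities satisfied by an axisymmetric flow in the unit cylinder. -/
structure IsSwirlFlow (F : E3 × ℝ → E3) : Prop where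
  smooth : ContDiff ℝ 2 F
  div : ∀ x t, ‖x‖ ≤ 1 → t ∈ Ioo (-1 : ℝ) 0 → ∑ i, pd (fun y => F (y, t) i) i x = 0
  rot_zero : ∀ x t, ‖x‖ ≤ 1 → t ∈ Ioo (-1 : ℝ) 0 →
    x 0 * pd (fun y => F (y, t) 0) 1 x - x 1 * pd (fun y => F (y, t) 0) 0 x = -F (x, t) 1
  rot_one : ∀ x t, ‖x‖ ≤ 1 → t ∈ Ioo (-1 : ℝ) 0 →
    x 0 * pd (fun y => F (y, t) 1) 1 x - x 1 * pd (fun y => F (y, t) 1) 0 x = F (x, t) 0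
  angular : ∀ x t, ‖x‖ ≤ 1 → t ∈ Ioo (-1 : ℝ) 0 →
    x 0 * (deriv (fun s => F (x, s) 1) t + (∑ i, F (x, t) i * pd (fun y => F (y, t) 1) i x)
        - lap (fun y => F (y, t) 1) x)
      = x 1 * (deriv (fun s => F (x, s) 0) t + (∑ i, F (x, t) i * pd (fun y => F (y, t) 0) i x)
        - lap (fun y => F (y, t) 0) x)

/-- Partial derivatives of `x₁ g - x₂ f`. -/
lemma pd_swirl {f g : E3 → ℝ} {x : E3} (hf : DifferentiableAt ℝ f x) (hg : DifferentiableAt ℝ g x)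
    (i : Fin 3) : pd (fun y => y 0 * g y - y 1 * f y) i x
      = x 0 * pd g i x - x 1 * pd f i x + ((if 0 = i then g x else 0) - if 1 = i then f x else 0)
          := by
  rw [pd_sub ((differentiable_coord 0 x).fun_mul hg) ((differentiable_coord 1 x).fun_mul hf),
    pd_mul (differentiable_coord 0 x) hg, pd_mul (differentiable_coord 1 x) hf, pd_coord, pd_coord]
  split_ifs <;> ring

lemma lap_swirl {f g : E3 → ℝ} (hf : ContDiff ℝ 2 f) (hg : ContDiff ℝ 2 g) (x : E3) :
    lap (fun y => y 0 * g y - y 1 * f y) x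
      = x 0 * lap g x - x 1 * lap f x + 2 * (pd g 0 x - pd f 1 x) := by
  have df : Differentiable ℝ f := hf.differentiable (by norm_num)
  have dg : Differentiable ℝ g := hg.differentiable (by norm_num)
  have dpf : ∀ i, Differentiable ℝ (pd f i) := fun i =>
    (contDiff_pd_one hf i).differentiable (by norm_num)
  have dpg : ∀ i, Differentiable ℝ (pd g i) := fun i =>
    (contDiff_pd_one hg i).differentiable (by norm_num)
  have e : ∀ i, pd (fun y => y 0 * g y - y 1 * f y) i
      = fun y => (y 0 * pd g i y - y 1 * pd f i y)
        + ((if 0 = i then g y else 0) - if 1 = i then f y else 0) := fun i => by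
    funext y; exact pd_swirl (df y) (dg y) i
  have h0 : pd (pd (fun y => y 0 * g y - y 1 * f y) 0) 0 x
      = x 0 * pd (pd g 0) 0 x - x 1 * pd (pd f 0) 0 x + 2 * pd g 0 x := by
    rw [e 0]
    simp only [if_true, one_ne_zero, if_false, sub_zero]
    rw [pd_add (((differentiable_coord 0 x).fun_mul (dpg 0 x)).fun_sub
      ((differentiable_coord 1 x).fun_mul (dpf 0 x))) (dg x), pd_swirl (dpf 0 x) (dpg 0 x)]
    simp; ring
  have h1 : pd (pd (fun y => y 0 * g y - y 1 * f y) 1) 1 x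
      = x 0 * pd (pd g 1) 1 x - x 1 * pd (pd f 1) 1 x - 2 * pd f 1 x := by
    rw [e 1]
    simp only [if_true, zero_ne_one, if_false, zero_sub, ← sub_eq_add_neg]
    rw [pd_sub (((differentiable_coord 0 x).fun_mul (dpg 1 x)).fun_sub
      ((differentiable_coord 1 x).fun_mul (dpf 1 x))) (df x), pd_swirl (dpf 1 x) (dpg 1 x)]
    simp; ring
  have h2 : pd (pd (fun y => y 0 * g y - y 1 * f y) 2) 2 x
      = x 0 * pd (pd g 2) 2 x - x 1 * pd (pd f 2) 2 x := by
    rw [e 2]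
    have n0 : (0 : Fin 3) ≠ 2 := by decide
    have n1 : (1 : Fin 3) ≠ 2 := by decide
    simp only [n0, n1, if_false, sub_zero, add_zero]
    rw [pd_swirl (dpf 2 x) (dpg 2 x)]
    simp [n0, n1]
  have hl : ∀ f : E3 → ℝ, lap f x = pd (pd f 0) 0 x + pd (pd f 1) 1 x + pd (pd f 2) 2 x :=
      fun f => by
    simp only [lap, Fin.sum_univ_three]
  rw [hl, hl f, hl g, h0, h1, h2]
  ring

lemma IsSwirlFlow.isNormSol {F : E3 × ℝ → E3} (h : IsSwirlFlow F) {A c₀ κ : ℝ} (hA : 1 ≤ A)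
    (hc : 1 ≤ c₀) (hpos : ∀ z : E3 × ℝ, 0 < c₀ + κ * (z.1 0 * F z 1 - z.1 1 * F z 0))
    (hle : ∀ x t, ‖x‖ ≤ 1 → t ∈ Ioo (-1 : ℝ) 0 →
      c₀ + κ * (x 0 * F (x, t) 1 - x 1 * F (x, t) 0) ≤ 3)
    (hE : ∀ t ∈ Ioo (-1 : ℝ) 0, ∫ x, ∑ i, F (x, t) i ^ 2 ∂muB ≤ A) :
    IsNormSol A c₀ (fun z => c₀ + κ * (z.1 0 * F z 1 - z.1 1 * F z 0)) F (fun z => κ • F z) := by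
  have hF1 : ContDiff ℝ 1 F := h.smooth.of_le (by norm_num)
  have hFj : ∀ j : Fin 3, ContDiff ℝ 2 (fun z => F z j) := fun j => (contDiff_coord j).comp h.smooth
  have hx : ∀ j : Fin 3, ContDiff ℝ 2 (fun z : E3 × ℝ => z.1 j) := fun j =>
    (contDiff_coord j).comp contDiff_fst
  have hFt : ∀ (j : Fin 3) (t : ℝ), ContDiff ℝ 2 (fun y => F (y, t) j) := fun j t =>
    contDiff_slice (F := fun z => F z j) (hFj j) t
  have hFd : ∀ (j : Fin 3) (t : ℝ) (x : E3), DifferentiableAt ℝ (fun y => F (y, t) j) x :=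
    fun j t x => (hFt j t).differentiable (by norm_num) x
  have hΓ : ∀ t, ContDiff ℝ 2 (fun y : E3 => y 0 * F (y, t) 1 - y 1 * F (y, t) 0) := fun t =>
    ((contDiff_coord 0).mul (hFt 1 t)).sub ((contDiff_coord 1).mul (hFt 0 t))
  have hΓd : ∀ t x, DifferentiableAt ℝ (fun y : E3 => y 0 * F (y, t) 1 - y 1 * F (y, t) 0) x :=
    fun t x => (hΓ t).differentiable (by norm_num) x
  have hpd : ∀ (t : ℝ) (x : E3) (i : Fin 3),
      pd (fun y => c₀ + κ * (y 0 * F (y, t) 1 - y 1 * F (y, t) 0)) i x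
        = κ * (x 0 * pd (fun y => F (y, t) 1) i x - x 1 * pd (fun y => F (y, t) 0) i x
          + ((if 0 = i then F (x, t) 1 else 0) - if 1 = i then F (x, t) 0 else 0)) := by
    intro t x i
    rw [pd_add (differentiableAt_const _) ((hΓd t x).const_mul κ), pd_const, zero_add,
      pd_const_mul (hΓd t x), pd_swirl (hFd 0 t x) (hFd 1 t x)]
  have hV : ∀ (t : ℝ) (x : E3) (j i : Fin 3), pd (fun y => (κ • F (y, t)) j) i x
      = κ * pd (fun y => F (y, t) j) i x := fun t x j i => pd_const_mul (hFd j t x) κ i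
  constructor
  · exact hA
  · exact hc
  · exact contDiff_const.add (contDiff_const.mul (((hx 0).mul (hFj 1)).sub ((hx 1).mul (hFj 0))))
  · exact hF1
  · exact hF1.const_smul κ
  · exact hpos
  · exact hle
  · intro x t
    simp only [PiLp.smul_apply, smul_eq_mul]
    ring
  · exact h.div
  · intro x t hx ht
    have hlap : lap (fun y => c₀ + κ * (y 0 * F (y, t) 1 - y 1 * F (y, t) 0)) x
        = κ * (x 0 * lap (fun y => F (y, t) 1) x - x 1 * lap (fun y => F (y, t) 0) x
          + 2 * (pd (fun y => F (y, t) 1) 0 x - pd (fun y => F (y, t) 0) 1 x)) := by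
      rw [← lap_swirl (hFt 0 t) (hFt 1 t)]
      unfold lap
      rw [Finset.mul_sum]
      refine Finset.sum_congr rfl fun i _ => ?_
      rw [← pd_const_mul ((contDiff_pd_one (hΓ t) i).differentiable (by norm_num) x)]
      congr 1
      funext y
      rw [pd_add (differentiableAt_const _) ((hΓd t y).const_mul κ), pd_const, zero_add,
        pd_const_mul (hΓd t y)]
    have hdt : ∀ j, HasDerivAt (fun s => F (x, s) j) (deriv (fun s => F (x, s) j) t) t := fun j =>
      (hasDerivAt_slice (F := fun z => F z j)
        ((hFj j).differentiable (by norm_num) (x, t))).differentiableAt.hasDerivAt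
    have hd := ((((hdt 1).const_mul (x 0)).sub ((hdt 0).const_mul (x 1))).const_mul κ).const_add c₀
    have hd' : deriv (fun s => c₀ + κ * (x 0 * F (x, s) 1 - x 1 * F (x, s) 0)) t = _ := hd.deriv
    have hang := h.angular x t hx ht
    simp only [Fin.sum_univ_three] at hang
    simp only [Fin.sum_univ_three, hlap, hd', hpd, hV]
    have n0 : (0 : Fin 3) ≠ 2 := by decide
    have n1 : (1 : Fin 3) ≠ 2 := by decide
    simp only [n0, n1, if_true, if_false, one_ne_zero, zero_ne_one]
    linear_combination κ * hang
  · intro x t hx ht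
    have h0 := h.rot_zero x t hx ht
    have h1 := h.rot_one x t hx ht
    simp only [hpd, hV]
    simp only [if_true, if_false, one_ne_zero, zero_ne_one]
    linear_combination (-κ * x 0) * h0 - (κ * x 1) * h1
  · exact hE

/-! ### Rescaling and localizing a Navier–Stokes solution -/

lemma pd_comp_smul (f : E3 → ℝ) (c R : ℝ) (i : Fin 3) (x : E3) :
    pd (fun y => c * f (R • y)) i x = c * R * pd f i (R • x) := by
  have h : fderiv ℝ (fun y => c • f (R • y)) x = c • R • fderiv ℝ f (R • x) := by
    rw [← fderiv_comp_smul]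
    exact congrFun (fderiv_const_smul_field (𝕜 := ℝ) (f := fun y : E3 => f (R • y)) c) x
  unfold pd
  simp only [smul_eq_mul] at h
  rw [h]
  simp [mul_assoc]

lemma lap_comp_smul (f : E3 → ℝ) (c R : ℝ) (x : E3) :
    lap (fun y => c * f (R • y)) x = c * R ^ 2 * lap f (R • x) := by
  unfold lap
  rw [Finset.mul_sum]
  refine Finset.sum_congr rfl fun i _ => ?_
  have e : (fun y => pd (fun y => c * f (R • y)) i y) = fun y => c * R * pd f i (R • y) := by
    funext y; exact pd_comp_smul f c R i y
  rw [e, pd_comp_smul (pd f i)]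
  ring

lemma lap_congr {f g : E3 → ℝ} {x : E3} (h : f =ᶠ[nhds x] g) : lap f x = lap g x := by
  unfold lap
  refine Finset.sum_congr rfl fun i _ => pd_congr ?_ i
  filter_upwards [h.eventually_nhds] with y hy
  exact pd_congr hy i

lemma exists_cutoff {O K : Set (E3 × ℝ)} (hO : IsOpen O) (hK : IsClosed K) (h : K ⊆ O) :
    ∃ χ : E3 × ℝ → ℝ, ContDiff ℝ (⊤ : ℕ∞) χ ∧ (∀ z ∉ O, ∀ᶠ y in nhds z, χ y = 0) ∧
      (∀ z ∈ K, ∀ᶠ y in nhds z, χ y = 1) ∧ ∀ z, χ z ∈ Icc (0 : ℝ) 1 := by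
  obtain ⟨f, h0, h1, h2⟩ := exists_contMDiffMap_zero_one_nhds_of_isClosed (n := (⊤ : ℕ∞))
    (modelWithCornersSelf ℝ (E3 × ℝ)) hO.isClosed_compl hK
    (disjoint_left.2 fun z hz hz' => hz (h hz'))
  exact ⟨f, f.contMDiff.contDiff, fun z hz => (eventually_nhdsSet_iff_forall.1 h0 z hz),
    fun z hz => (eventually_nhdsSet_iff_forall.1 h1 z hz), h2⟩

lemma closure_Qyl_zero {R : ℝ} (hR : 0 < R) :
    closure (Qyl (0, 0) R) = Metric.closedBall (0 : E3) R ×ˢ Icc (-R ^ 2) 0 := by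
  unfold Qyl
  rw [closure_prod_eq, closure_ball _ hR.ne', closure_Ioo (by simp; positivity)]
  simp

lemma exists_swirlFlow {u : E3 → ℝ → E3} {P : E3 → ℝ → ℝ} {U : Set (E3 × ℝ)}
    (h : IsNSQ1 u P U) (hax : IsAxisym u P U) {R κ a ε : ℝ} (hR : 0 < R) (hR4 : R ≤ 1 / 4)
    (ha : 0 ≤ a) (hε : 0 < ε)
    (hlow : ∀ x t, (x, t) ∈ Qyl (0, 0) R → 0 ≤ a + κ * Gam u x t) :
    ∃ F : E3 × ℝ → E3, IsSwirlFlow F ∧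
      (∀ y s, ‖y‖ ≤ 1 → s ∈ Ioo (-1 : ℝ) 0 → F (y, s) = R • u (R • y) (R ^ 2 * s)) ∧
      ∀ z : E3 × ℝ, -(a + ε) < κ * (z.1 0 * F z 1 - z.1 1 * F z 0) := by
  set S : E3 × ℝ → E3 × ℝ := fun z => (R • z.1, R ^ 2 * z.2) with hS
  have hSs : ContDiff ℝ (⊤ : ℕ∞) S :=
    (contDiff_fst.const_smul R).prodMk (contDiff_const.mul contDiff_snd)
  set w : E3 × ℝ → E3 := fun z => R • u (R • z.1) (R ^ 2 * z.2) with hw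
  have hwc : ∀ z, S z ∈ U → ContDiffAt ℝ (⊤ : ℕ∞) w z := fun z hz =>
    (ContDiffAt.comp (f := S) (g := fun z : E3 × ℝ => u z.1 z.2) z
      (h.smooth_u.contDiffAt (h.open_U.mem_nhds hz)) hSs.contDiffAt).const_smul R
  set g : E3 × ℝ → ℝ := fun z => κ * (z.1 0 * w z 1 - z.1 1 * w z 0) with hg
  have hgc : ∀ z, S z ∈ U → ContinuousAt g z := fun z hz => by
    have hc := (hwc z hz).continuousAt
    have hj : ∀ j : Fin 3, ContinuousAt (fun z => w z j) z := fun j =>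
      ContinuousAt.comp (f := w) (g := fun v : E3 => v j) (continuous_coord j).continuousAt hc
    have hx : ∀ j : Fin 3, ContinuousAt (fun z : E3 × ℝ => z.1 j) z := fun j =>
      ((continuous_coord j).comp continuous_fst).continuousAt
    exact (((hx 0).mul (hj 1)).sub ((hx 1).mul (hj 0))).const_mul κ
  have hgΓ : ∀ z : E3 × ℝ, g z = κ * Gam u (R • z.1) (R ^ 2 * z.2) := fun z => by
    simp only [hg, hw, Gam, PiLp.smul_apply, smul_eq_mul]; ring
  have hUo : IsOpen (S ⁻¹' U) := h.open_U.preimage hSs.continuous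
  set O : Set (E3 × ℝ) := S ⁻¹' U ∩ g ⁻¹' Ioi (-(a + ε)) with hOd
  have hO : IsOpen O :=
    ContinuousOn.isOpen_inter_preimage (fun z hz => (hgc z hz).continuousWithinAt) hUo isOpen_Ioi
  set K : Set (E3 × ℝ) := Metric.closedBall (0 : E3) 1 ×ˢ Icc (-1) 0 with hK
  have hKc : closure (Qyl (0, 0) 1) = K := by rw [closure_Qyl_zero one_pos]; norm_num [hK]
  have hR2 : R ^ 2 ≤ 1 := by nlinarith
  have hSK : ∀ z ∈ K, S z ∈ U := by
    rintro ⟨y, s⟩ ⟨hy, hs⟩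
    refine h.subset_U ?_
    rw [hKc]
    simp only [mem_closedBall_zero_iff] at hy
    refine ⟨?_, ?_, ?_⟩
    · simp only [hS, mem_closedBall_zero_iff, norm_smul, norm_eq_abs, abs_of_pos hR]
      nlinarith [norm_nonneg y]
    · simp only [hS]; nlinarith [hs.1, hs.2, sq_nonneg R]
    · simp only [hS]; nlinarith [hs.1, hs.2, sq_nonneg R]
  have hSQ : ∀ y s, ‖y‖ < 1 → s ∈ Ioo (-1 : ℝ) 0 → S (y, s) ∈ Qyl (0, 0) R := by
    intro y s hy hs
    simp only [hS]
    rw [mem_Qyl_zero, norm_smul, norm_eq_abs, abs_of_pos hR]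
    have : 0 < R ^ 2 := by positivity
    refine ⟨by nlinarith, by nlinarith [hs.1], by nlinarith [hs.2]⟩
  have hKO : K ⊆ O := by
    intro z hz
    refine ⟨hSK z hz, ?_⟩
    have h1 : (fun _ => -a) z ≤ g z := by
      refine le_on_closure (s := Qyl (0, 0) 1) (f := fun _ => -a) ?_ continuousOn_const
        (fun z hz => (hgc z (hSK z (hKc ▸ hz))).continuousWithinAt) (hKc.symm ▸ hz)
      rintro ⟨y, s⟩ hys
      rw [mem_Qyl_zero] at hys
      have := hlow _ _ (hSQ y s hys.1 ⟨by simpa using hys.2.1, hys.2.2⟩)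
      rw [hgΓ]
      linarith
    simp only [mem_preimage, mem_Ioi]
    linarith
  obtain ⟨χ, hχs, hχ0, hχ1, hχ⟩ := exists_cutoff hO (hKc ▸ isClosed_closure) hKO
  have hloc : ∀ z ∈ K, (fun z => χ z • w z) =ᶠ[nhds z] w := fun z hz => by
    filter_upwards [hχ1 z hz] with y hy
    rw [hy, one_smul]
  refine ⟨fun z => χ z • w z, ?_, ?_, ?_⟩
  · have hKm : ∀ y s, ‖y‖ ≤ 1 → s ∈ Ioo (-1 : ℝ) 0 → (y, s) ∈ K := fun y s hy hs =>
      ⟨by simpa using hy, hs.1.le, hs.2.le⟩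
    have hslx : ∀ y s, ‖y‖ ≤ 1 → s ∈ Ioo (-1 : ℝ) 0 → ∀ j : Fin 3,
        (fun y => (χ (y, s) • w (y, s)) j) =ᶠ[nhds y]
          fun y => R * (fun x => u x (R ^ 2 * s) j) (R • y) := by
      intro y s hy hs j
      have := ((by fun_prop : Continuous fun y : E3 => (y, s)).tendsto y).eventually
        (hloc _ (hKm y s hy hs))
      filter_upwards [this] with y' hy'
      change χ (y', s) • w (y', s) = w (y', s) at hy'
      rw [hy']
      simp only [hw, PiLp.smul_apply, smul_eq_mul]
    have hslt : ∀ y s, ‖y‖ ≤ 1 → s ∈ Ioo (-1 : ℝ) 0 → ∀ j : Fin 3,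
        (fun s => (χ (y, s) • w (y, s)) j) =ᶠ[nhds s]
          fun s => R * (fun τ => u (R • y) τ j) (R ^ 2 * s) := by
      intro y s hy hs j
      have := ((by fun_prop : Continuous fun s : ℝ => (y, s)).tendsto s).eventually
        (hloc _ (hKm y s hy hs))
      filter_upwards [this] with s' hs'
      change χ (y, s') • w (y, s') = w (y, s') at hs'
      rw [hs']
      simp only [hw, PiLp.smul_apply, smul_eq_mul]
    have hv : ∀ y s, ‖y‖ ≤ 1 → s ∈ Ioo (-1 : ℝ) 0 → ∀ j : Fin 3,
        (χ (y, s) • w (y, s)) j = R * u (R • y) (R ^ 2 * s) j := fun y s hy hs j =>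
      (hslx y s hy hs j).self_of_nhds
    have hp : ∀ y s, ‖y‖ ≤ 1 → s ∈ Ioo (-1 : ℝ) 0 → ∀ j i : Fin 3,
        pd (fun y => (χ (y, s) • w (y, s)) j) i y
          = R ^ 2 * pd (fun x => u x (R ^ 2 * s) j) i (R • y) := fun y s hy hs j i => by
      rw [pd_congr (hslx y s hy hs j) i, pd_comp_smul (fun x => u x (R ^ 2 * s) j) R R i y]; ring
    have hl : ∀ y s, ‖y‖ ≤ 1 → s ∈ Ioo (-1 : ℝ) 0 → ∀ j : Fin 3,
        lap (fun y => (χ (y, s) • w (y, s)) j) y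
          = R ^ 3 * lap (fun x => u x (R ^ 2 * s) j) (R • y) := fun y s hy hs j => by
      rw [lap_congr (hslx y s hy hs j), lap_comp_smul (fun x => u x (R ^ 2 * s) j) R R y]; ring
    have hd : ∀ y s, ‖y‖ ≤ 1 → s ∈ Ioo (-1 : ℝ) 0 → ∀ j : Fin 3,
        deriv (fun s => (χ (y, s) • w (y, s)) j) s
          = R ^ 3 * deriv (fun τ => u (R • y) τ j) (R ^ 2 * s) := fun y s hy hs j => by
      rw [(hslt y s hy hs j).deriv_eq, deriv_const_mul_field R,
        deriv_comp_mul_left (R ^ 2) (fun τ => u (R • y) τ j) s, smul_eq_mul]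
      ring
    have hQ1 : ∀ y s, ‖y‖ ≤ 1 → s ∈ Ioo (-1 : ℝ) 0 → (R • y, R ^ 2 * s) ∈ Qyl (0, 0) 1 := by
      intro y s hy hs
      rw [mem_Qyl_zero, norm_smul, norm_eq_abs, abs_of_pos hR]
      have : 0 < R ^ 2 := by positivity
      have h16 : R ^ 2 ≤ 1 / 16 := by nlinarith
      refine ⟨by nlinarith [norm_nonneg y], by nlinarith [hs.1], by nlinarith [hs.2]⟩
    constructor
    · rw [contDiff_iff_contDiffAt]
      intro z
      by_cases hz : z ∈ O
      · exact (hχs.contDiffAt.smul (hwc z hz.1)).of_le (by norm_cast)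
      · have : (fun z => χ z • w z) =ᶠ[nhds z] fun _ => 0 := by
          filter_upwards [hχ0 z hz] with y hy
          rw [hy, zero_smul]
        exact contDiffAt_const.congr_of_eventuallyEq this
    · intro y s hy hs
      simp only [hp y s hy hs]
      rw [← Finset.mul_sum, h.divfree _ _ (h.mem_U (hQ1 y s hy hs)), mul_zero]
    · intro y s hy hs
      have := (hax.angular h (hQ1 y s hy hs)).1
      simp only [hp y s hy hs, hv y s hy hs]
      simp only [PiLp.smul_apply, smul_eq_mul] at this
      linear_combination R * this
    · intro y s hy hs
      have := (hax.angular h (hQ1 y s hy hs)).2.1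
      simp only [hp y s hy hs, hv y s hy hs]
      simp only [PiLp.smul_apply, smul_eq_mul] at this
      linear_combination R * this
    · intro y s hy hs
      have hP := (hax.angular h (hQ1 y s hy hs)).2.2
      have m0 := h.momentum _ _ (h.mem_U (hQ1 y s hy hs)) 0
      have m1 := h.momentum _ _ (h.mem_U (hQ1 y s hy hs)) 1
      simp only [hp y s hy hs, hv y s hy hs, hl y s hy hs, hd y s hy hs, Fin.sum_univ_three]
      simp only [PiLp.smul_apply, smul_eq_mul] at hP
      simp only [Fin.sum_univ_three] at m0 m1
      linear_combination (R ^ 3 * y 0) * m1 - (R ^ 3 * y 1) * m0 - R ^ 2 * hP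
  · intro y s hy hs
    exact (hloc (y, s) ⟨by simpa using hy, hs.1.le, hs.2.le⟩).self_of_nhds
  · intro z
    have e : κ * (z.1 0 * (χ z • w z) 1 - z.1 1 * (χ z • w z) 0) = χ z * g z := by
      simp only [hg, PiLp.smul_apply, smul_eq_mul]; ring
    rw [e]
    by_cases hz : z ∈ O
    · have h1 : -(a + ε) < g z := hz.2
      have h2 := hχ z
      rcases le_or_gt 0 (g z) with h3 | h3
      · nlinarith [mul_nonneg h2.1 h3]
      · nlinarith [h2.1, h2.2]
    · rw [(hχ0 z hz).self_of_nhds, zero_mul]; linarith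

/-! ### Bounds on the cylinder of radius `R` -/

lemma isCompact_closure_Qyl {R : ℝ} (hR : 0 < R) : IsCompact (closure (Qyl (0, 0) R)) := by
  rw [closure_Qyl_zero hR]
  exact (isCompact_closedBall 0 R).prod isCompact_Icc

lemma closure_Qyl_subset {R : ℝ} (hR : 0 < R) (hR1 : R ≤ 1) :
    closure (Qyl (0, 0) R) ⊆ closure (Qyl (0, 0) 1) := by
  refine closure_mono ?_
  rintro ⟨x, t⟩ hx
  rw [mem_Qyl_zero] at hx ⊢
  exact ⟨by linarith [hx.1], by nlinarith [hx.2.1], hx.2.2⟩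

lemma IsNSQ1.continuousOn_closure {u : E3 → ℝ → E3} {P : E3 → ℝ → ℝ} {U : Set (E3 × ℝ)}
    (h : IsNSQ1 u P U) {R : ℝ} (hR : 0 < R) (hR1 : R ≤ 1) :
    ContinuousOn (fun z : E3 × ℝ => u z.1 z.2) (closure (Qyl (0, 0) R)) :=
  h.smooth_u.continuousOn.mono ((closure_Qyl_subset hR hR1).trans h.subset_U)

lemma IsNSQ1.isBounded_Gam {u : E3 → ℝ → E3} {P : E3 → ℝ → ℝ} {U : Set (E3 × ℝ)}
    (h : IsNSQ1 u P U) {R : ℝ} (hR : 0 < R) (hR1 : R ≤ 1) :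
    Bornology.IsBounded ((fun z : E3 × ℝ => Gam u z.1 z.2) '' Qyl (0, 0) R) := by
  have hc := h.continuousOn_closure hR hR1
  have hj : ∀ j : Fin 3, ContinuousOn (fun z : E3 × ℝ => u z.1 z.2 j) (closure (Qyl (0, 0) R)) :=
    fun j => (continuous_coord j).comp_continuousOn hc
  have hx : ∀ j : Fin 3, ContinuousOn (fun z : E3 × ℝ => z.1 j) (closure (Qyl (0, 0) R)) :=
    fun j => ((continuous_coord j).comp continuous_fst).continuousOn
  have hG : ContinuousOn (fun z : E3 × ℝ => Gam u z.1 z.2) (closure (Qyl (0, 0) R)) :=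
    ((hx 0).mul (hj 1)).sub ((hx 1).mul (hj 0))
  exact ((isCompact_closure_Qyl hR).image_of_continuousOn hG).isBounded.subset
    (image_mono subset_closure)

lemma IsNSQ1.le_AA {u : E3 → ℝ → E3} {P : E3 → ℝ → ℝ} {U : Set (E3 × ℝ)}
    (h : IsNSQ1 u P U) {R : ℝ} (hR : 0 < R) (hR1 : R ≤ 1) {t : ℝ} (ht : t ∈ Ioo (-R ^ 2) 0) :
    R⁻¹ * ∫ x in Metric.ball 0 R, ‖u x t‖ ^ 2 ≤ AA u (0, 0) R := by
  obtain ⟨C, hC⟩ := (isCompact_closure_Qyl hR).exists_bound_of_continuousOn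
    (h.continuousOn_closure hR hR1)
  have hI : ∀ s, 0 ≤ R⁻¹ * ∫ x in Metric.ball 0 R, ‖u x s‖ ^ 2 := fun s =>
    mul_nonneg (inv_nonneg.2 hR.le) (integral_nonneg fun x => by positivity)
  set B := R⁻¹ * (C ^ 2 * volume.real (Metric.ball (0 : E3) R)) with hB
  have hb : ∀ s ∈ Ioo (-R ^ 2) 0, R⁻¹ * ∫ x in Metric.ball 0 R, ‖u x s‖ ^ 2 ≤ B := by
    intro s hs
    refine mul_le_mul_of_nonneg_left ?_ (inv_nonneg.2 hR.le)
    refine (Real.le_norm_self _).trans (norm_setIntegral_le_of_norm_le_const measure_ball_lt_top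
      fun x hx => ?_)
    have := hC (x, s) (subset_closure (mem_Qyl_zero.2 ⟨by simpa using hx, hs⟩))
    rw [norm_pow, norm_norm]
    exact pow_le_pow_left₀ (norm_nonneg _) this 2
  unfold AA
  simp only [zero_sub]
  have hin : ∀ s (hs : s ∈ Ioo (-R ^ 2) 0),
      (⨆ _ : s ∈ Ioo (-R ^ 2) 0, R⁻¹ * ∫ x in Metric.ball 0 R, ‖u x s‖ ^ 2)
        = R⁻¹ * ∫ x in Metric.ball 0 R, ‖u x s‖ ^ 2 := fun s hs => by
    have : Nonempty (s ∈ Ioo (-R ^ 2) 0) := ⟨hs⟩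
    exact ciSup_const
  rw [← hin t ht]
  refine le_ciSup (f := fun s => ⨆ _ : s ∈ Ioo (-R ^ 2) 0,
    R⁻¹ * ∫ x in Metric.ball 0 R, ‖u x s‖ ^ 2) ⟨max B 0, ?_⟩ t
  rintro _ ⟨s, rfl⟩
  by_cases hs : s ∈ Ioo (-R ^ 2) 0
  · simp only [hin s hs]
    exact (hb s hs).trans (le_max_left _ _)
  · have : IsEmpty (s ∈ Ioo (-R ^ 2) 0) := ⟨hs⟩
    simp only [Real.iSup_of_isEmpty]
    exact le_max_right _ _

open scoped Pointwise in
lemma IsNSQ1.energy_rescaled {u : E3 → ℝ → E3} {P : E3 → ℝ → ℝ} {U : Set (E3 × ℝ)}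
    (h : IsNSQ1 u P U) {R : ℝ} (hR : 0 < R) (hR1 : R ≤ 1) {F : E3 × ℝ → E3}
    (hF : ∀ y s, ‖y‖ ≤ 1 → s ∈ Ioo (-1 : ℝ) 0 → F (y, s) = R • u (R • y) (R ^ 2 * s))
    {s : ℝ} (hs : s ∈ Ioo (-1 : ℝ) 0) :
    ∫ y, ∑ i, F (y, s) i ^ 2 ∂muB ≤ AA u (0, 0) R := by
  have hR2 : 0 < R ^ 2 := by positivity
  have e1 : ∫ y, ∑ i, F (y, s) i ^ 2 ∂muB
      = ∫ y in Metric.closedBall 0 1, R ^ 2 * (fun x => ‖u x (R ^ 2 * s)‖ ^ 2) (R • y) := by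
    refine setIntegral_congr_fun Metric.isClosed_closedBall.measurableSet fun y hy => ?_
    simp only
    rw [hF y s (by simpa using hy) hs, EuclideanSpace.norm_sq_eq, Finset.mul_sum]
    refine Finset.sum_congr rfl fun i _ => ?_
    rw [PiLp.smul_apply, smul_eq_mul, norm_eq_abs, sq_abs]
    ring
  rw [e1, integral_const_mul,
    Measure.setIntegral_comp_smul_of_pos volume (fun x => ‖u x (R ^ 2 * s)‖ ^ 2) _ hR]
  refine le_trans (le_of_eq ?_) (h.le_AA hR hR1 (t := R ^ 2 * s)
    ⟨by nlinarith [hs.1], by nlinarith [hs.2]⟩)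
  have hsm : R • Metric.closedBall (0 : E3) 1 = Metric.closedBall 0 R := by
    rw [smul_unitClosedBall, norm_eq_abs, abs_of_pos hR]
  have hae : (Metric.ball (0 : E3) R : Set E3) =ᵐ[volume] Metric.closedBall 0 R :=
    ae_eq_of_subset_of_measure_ge Metric.ball_subset_closedBall
      (Measure.addHaar_closedBall_eq_addHaar_ball _ _ _).le
      Metric.isOpen_ball.measurableSet.nullMeasurableSet measure_closedBall_lt_top.ne
  rw [hsm, setIntegral_congr_set hae, finrank_euclideanSpace_fin, smul_eq_mul, ← mul_assoc]
  congr 1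
  field_simp

lemma IsNSQ1.lower_bound_of_nonneg {c C : ℝ} (hC : ∀ A c₀ H b V, IsNormSol A c₀ H b V →
      ∀ x t, ‖x‖ < 1 / 4 → t ∈ Ioo (-1 / 16 : ℝ) 0 → c / A * exp (-(C * A ^ 4)) ≤ H (x, t))
    {u : E3 → ℝ → E3} {P : E3 → ℝ → ℝ} {U : Set (E3 × ℝ)}
    (h : IsNSQ1 u P U) (hax : IsAxisym u P U) {R κ a A : ℝ} (hR : 0 < R) (hR4 : R ≤ 1 / 4)
    (ha : 1 ≤ a) (hA : 1 ≤ A) (hAA : AA u (0, 0) R ≤ A)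
    (hlow : ∀ x t, (x, t) ∈ Qyl (0, 0) R → 0 ≤ a + κ * Gam u x t)
    (hup : ∀ x t, (x, t) ∈ Qyl (0, 0) R → a + κ * Gam u x t ≤ 2)
    {x : E3} {t : ℝ} (hx : (x, t) ∈ Qyl (0, 0) (R / 4)) :
    c / A * exp (-(C * A ^ 4)) ≤ a + κ * Gam u x t := by
  have hR2 : 0 < R ^ 2 := by positivity
  have hR1 : R ≤ 1 := by linarith
  refine le_of_forall_pos_lt_add fun δ hδ => ?_
  set ε := min (δ / 2) 1 with hε
  have hε0 : 0 < ε := lt_min (by linarith) one_pos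
  obtain ⟨F, hF, hFu, hFl⟩ := exists_swirlFlow h hax (κ := κ) (ε := ε) hR hR4
    (by linarith : 0 ≤ a) hε0 hlow
  have hΓ : ∀ y s, ‖y‖ ≤ 1 → s ∈ Ioo (-1 : ℝ) 0 →
      y 0 * F (y, s) 1 - y 1 * F (y, s) 0 = Gam u (R • y) (R ^ 2 * s) := fun y s hy hs => by
    rw [hFu y s hy hs]
    simp only [Gam, PiLp.smul_apply, smul_eq_mul]
    ring
  have hc1 : ∀ t, Continuous fun y => F (y, t) := fun t =>
    hF.smooth.continuous.comp (by fun_prop)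
  have hle : ∀ y s, ‖y‖ ≤ 1 → s ∈ Ioo (-1 : ℝ) 0 →
      a + ε + κ * (y 0 * F (y, s) 1 - y 1 * F (y, s) 0) ≤ 3 := by
    intro y s hy hs
    have hcl : y ∈ closure (Metric.ball (0 : E3) 1) := by
      rw [closure_ball _ one_ne_zero]; simpa using hy
    have hcont : Continuous fun y : E3 => a + ε + κ * (y 0 * F (y, s) 1 - y 1 * F (y, s) 0) := by
      have hj : ∀ j : Fin 3, Continuous fun y => F (y, s) j := fun j =>
        (continuous_coord j).comp (hc1 s)
      exact continuous_const.add (continuous_const.mul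
        (((continuous_coord 0).mul (hj 1)).sub ((continuous_coord 1).mul (hj 0))))
    refine le_on_closure (g := fun _ => (3 : ℝ)) (fun y hy => ?_) hcont.continuousOn
      continuousOn_const hcl
    have hy1 : ‖y‖ < 1 := by simpa using hy
    simp only
    rw [hΓ y s hy1.le hs]
    have := hup (R • y) (R ^ 2 * s) (mem_Qyl_zero.2 ⟨by
      rw [norm_smul, norm_eq_abs, abs_of_pos hR]; nlinarith, by nlinarith [hs.1],
      by nlinarith [hs.2]⟩)
    linarith [min_le_right (δ / 2) 1]
  have hsol := hF.isNormSol (κ := κ) (c₀ := a + ε) hA (by linarith)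
    (fun z => by linarith [hFl z]) hle
    (fun s hs => (h.energy_rescaled hR hR1 hFu hs).trans hAA)
  rw [mem_Qyl_zero] at hx
  have hy : ‖R⁻¹ • x‖ < 1 / 4 := by
    rw [norm_smul, norm_inv, norm_eq_abs, abs_of_pos hR, inv_mul_lt_iff₀ hR]
    linarith [hx.1]
  have hs : (R ^ 2)⁻¹ * t ∈ Ioo (-1 / 16 : ℝ) 0 := by
    refine ⟨?_, mul_neg_of_pos_of_neg (inv_pos.2 hR2) hx.2.2⟩
    rw [lt_inv_mul_iff₀ hR2]
    linarith [hx.2.1]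
  have := hC _ _ _ _ _ hsol (R⁻¹ • x) ((R ^ 2)⁻¹ * t) hy hs
  simp only at this
  rw [hΓ _ _ (by linarith) ⟨by linarith [hs.1], hs.2⟩, smul_inv_smul₀ hR.ne',
    mul_inv_cancel_left₀ hR2.ne'] at this
  linarith [min_le_left (δ / 2) 1]

lemma IsNSQ1.hfun_lower_bound {c C : ℝ} (hC : ∀ A c₀ H b V, IsNormSol A c₀ H b V →
      ∀ x t, ‖x‖ < 1 / 4 → t ∈ Ioo (-1 / 16 : ℝ) 0 → c / A * exp (-(C * A ^ 4)) ≤ H (x, t))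
    {u : E3 → ℝ → E3} {P : E3 → ℝ → ℝ} {U : Set (E3 × ℝ)}
    (h : IsNSQ1 u P U) (hax : IsAxisym u P U) {R A : ℝ} (hR : 0 < R) (hR4 : R ≤ 1 / 4)
    (hJ : 0 < JR u R) (hA : 1 ≤ A) (hAA : AA u (0, 0) R ≤ A)
    {x : E3} {t : ℝ} (hx : (x, t) ∈ Qyl (0, 0) (R / 4)) :
    c / A * exp (-(C * A ^ 4)) ≤ hfun u R x t := by
  have hbd := h.isBounded_Gam hR (by linarith)
  have hM : ∀ x t, (x, t) ∈ Qyl (0, 0) R → Gam u x t ≤ MMR u R := fun x t hx =>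
    le_csSup hbd.bddAbove ⟨(x, t), hx, rfl⟩
  have hm : ∀ x t, (x, t) ∈ Qyl (0, 0) R → mR u R ≤ Gam u x t := fun x t hx =>
    csInf_le hbd.bddBelow ⟨(x, t), hx, rfl⟩
  have hJd : JR u R = MMR u R - mR u R := rfl
  unfold hfun
  split_ifs with hlt
  · have e : ∀ x t, 2 * (MMR u R - Gam u x t) / JR u R
        = 2 * MMR u R / JR u R + -2 / JR u R * Gam u x t := fun x t => by ring
    rw [e]
    refine h.lower_bound_of_nonneg hC hax hR hR4 ?_ hA hAA (fun x t hx => ?_)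
      (fun x t hx => ?_) hx
    · rw [le_div_iff₀ hJ]; linarith
    · rw [← e]; exact div_nonneg (by linarith [hM x t hx]) hJ.le
    · rw [← e, div_le_iff₀ hJ]; linarith [hm x t hx]
  · have e : ∀ x t, 2 * (Gam u x t - mR u R) / JR u R
        = -2 * mR u R / JR u R + 2 / JR u R * Gam u x t := fun x t => by ring
    rw [e]
    refine h.lower_bound_of_nonneg hC hax hR hR4 ?_ hA hAA (fun x t hx => ?_)
      (fun x t hx => ?_) hx
    · rw [le_div_iff₀ hJ]; linarith
    · rw [← e]; exact div_nonneg (by linarith [hm x t hx]) hJ.le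
    · rw [← e, div_le_iff₀ hJ]; linarith [hM x t hx]

/-! ### The logarithmic rate -/

lemma exists_rate_const {β K τ c C : ℝ} (hβ : 0 < β) (hβ' : β < 1 / 8) (hK : 0 < K)
    (hτ : τ < 1) (hc : 0 < c) (hC : 0 < C) :
    ∃ N : ℝ, 0 < N ∧ N < 1 ∧ ∀ y : ℝ, 1 ≤ y →
      1 / 2 * N * exp y ^ (τ - 1)
        ≤ c / (1 + K * y ^ β) * exp (-(C * (1 + K * y ^ β) ^ 4)) := by
  set d := C * (1 + K) ^ 4 + 1 with hd
  set σ := 1 - τ with hσ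
  have hσ0 : 0 < σ := by linarith
  set L := d ^ 2 / (4 * σ) with hL
  set N := min (1 / 2) (c / (1 + K) * exp (-L)) with hN
  refine ⟨N, by positivity, lt_of_le_of_lt (min_le_left _ _) (by norm_num), fun y hy => ?_⟩
  have hy0 : 0 < y := by linarith
  set A := 1 + K * y ^ β with hA
  set q := √y with hq
  have hq1 : 1 ≤ q := by rw [hq]; exact Real.one_le_sqrt.2 hy
  have hqq : q ^ 2 = y := Real.sq_sqrt hy0.le
  have hb : (y ^ β) ^ 4 ≤ q := by
    rw [← rpow_natCast, ← rpow_mul hy0.le, hq, sqrt_eq_rpow]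
    exact rpow_le_rpow_of_exponent_le hy (by push_cast; linarith)
  have hb1 : 1 ≤ y ^ β := one_le_rpow hy hβ.le
  have hA1 : 0 < A := by positivity
  have hAle : A ≤ (1 + K) * y ^ β := by rw [hA]; linarith
  have hA4 : A ^ 4 ≤ (1 + K) ^ 4 * q := by
    calc A ^ 4 ≤ ((1 + K) * y ^ β) ^ 4 := pow_le_pow_left₀ hA1.le hAle 4
      _ = (1 + K) ^ 4 * (y ^ β) ^ 4 := by ring
      _ ≤ _ := by gcongr
  have hbq : y ^ β ≤ q := by
    refine le_trans ?_ hb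
    exact le_self_pow₀ hb1 (by norm_num)
  have hqe : q ≤ exp q := by linarith [add_one_le_exp q]
  have hAq : A ≤ (1 + K) * exp q := hAle.trans (by gcongr; exact hbq.trans hqe)
  have hyoung : d * q ≤ σ * y + L := by
    rw [← hqq, hL, ← sub_nonneg]
    have : σ * q ^ 2 + d ^ 2 / (4 * σ) - d * q = (2 * σ * q - d) ^ 2 / (4 * σ) := by
      field_simp; ring
    rw [this]; positivity
  have hexp : exp y ^ (τ - 1) = exp (-(σ * y)) := by
    rw [← exp_mul]; congr 1; rw [hσ]; ring
  rw [hexp]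
  calc 1 / 2 * N * exp (-(σ * y)) ≤ N * exp (-(σ * y)) := by
        have : 0 < N := by positivity
        gcongr; linarith
    _ ≤ c / (1 + K) * exp (-L) * exp (-(σ * y)) := by gcongr; exact min_le_right _ _
    _ = c / (1 + K) * exp (-(σ * y + L)) := by
        rw [mul_assoc, ← exp_add]; congr 2; ring
    _ ≤ c / (1 + K) * exp (-(d * q)) := by gcongr
    _ = c / ((1 + K) * exp q) * exp (-(C * ((1 + K) ^ 4 * q))) := by
        have : exp (-(d * q)) = (exp q)⁻¹ * exp (-(C * ((1 + K) ^ 4 * q))) := by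
          rw [← exp_neg, ← exp_add]; congr 1; rw [hd]; ring
        rw [this]; field_simp
    _ ≤ c / A * exp (-(C * A ^ 4)) := by gcongr

lemma one_le_log_log {R : ℝ} (hR : 0 < R) (hR4 : R ≤ 1 / 4) : 1 ≤ log (log (100 / R)) := by
  have e1 := exp_one_lt_d9
  have h400 : 400 ≤ 100 / R := by rw [le_div_iff₀ hR]; linarith
  rw [le_log_iff_exp_le (log_pos (by linarith)), le_log_iff_exp_le (by linarith)]
  have h3 : exp (exp 1) ≤ exp 3 := exp_le_exp.2 (by linarith)
  have h4 : exp 3 = exp 1 ^ 3 := by rw [← exp_nat_mul]; norm_num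
  have h5 : exp 1 ^ 3 ≤ 3 ^ 3 := pow_le_pow_left₀ (exp_pos 1).le (by linarith) 3
  linarith

/-- strong Harnack inequality for `h`. -/
theorem strong_harnack (β K τ : ℝ) (hβ : 0 < β) (hβ' : β < 1/8) (hK : 0 < K)
    (hτ : 0 < τ) (hτ' : τ < 1) :
    ∃ N₇ : ℝ, 0 < N₇ ∧ N₇ < 1 ∧
      ∀ (u : E3 → ℝ → E3) (P : E3 → ℝ → ℝ) (U : Set (E3 × ℝ)),
        IsNSQ1 u P U → IsAxisym u P U →
        (∀ R : ℝ, 0 < R → R ≤ 1/4 → AA u (0, 0) R * omg R ^ β ≤ K) →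
        ∀ R : ℝ, 0 < R → R ≤ 1/4 → 0 < JR u R →
        ∀ (x : E3) (t : ℝ), (x, t) ∈ Qyl (0, 0) (R/4) →
          (1/2) * N₇ * (Real.log (100/R)) ^ (τ - 1) ≤ hfun u R x t := by
  obtain ⟨c, C, hc, hC, hmain⟩ := exists_exp_const
  obtain ⟨N, hN0, hN1, hN⟩ := exists_rate_const hβ hβ' hK hτ' hc hC
  refine ⟨N, hN0, hN1, fun u P U h hax hAA R hR hR4 hJ x t hx => ?_⟩
  have hy := one_le_log_log hR hR4
  have hy0 : 0 < log (log (100 / R)) := by linarith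
  have hl : 0 < log (100 / R) := log_pos (by rw [lt_div_iff₀ hR]; linarith)
  have hrate := hN _ hy
  rw [exp_log hl] at hrate
  refine hrate.trans (h.hfun_lower_bound hmain hax hR hR4 hJ ?_ ?_ hx)
  · have : 0 ≤ K * log (log (100 / R)) ^ β := by positivity
    linarith
  · have h1 := hAA R hR hR4
    have hb : 0 < log (log (100 / R)) ^ β := rpow_pos_of_pos hy0 β
    rw [omg, inv_rpow hy0.le, mul_inv_le_iff₀ hb] at h1
    linarith
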